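/- arXiv:1701.08184 — 2 statements merged into one kernel-verified Lean document; each statement's English description precedes it below -/
import Mathlib

section
/- Let n ≥ 1, 0 < ε < 1 and k = [n/2]+1, and let 2 ≤ p < ∞. Let a : 𝕋ⁿ × ℤⁿ → ℂ be a symbol, smooth in x, such that for all multi-indices α, β with |α|, |β| ≤ k there are constants C_α, C_β > 0 with |Δ_ξ^α a(x,ξ)| ≤ C_α ⟨ξ⟩^{−(n/2)ε − (1−ε)|α|} and |∂_x^β a(x,ξ)| ≤ C_β ⟨ξ⟩^{−(n/2)ε} for all (x,ξ) ∈ 𝕋ⁿ × ℤⁿ. Then the periodic pseudo-differential operator a(x,D) : L^p(𝕋ⁿ) → L^p(𝕋ⁿ) is a bounded linear operator. -/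
open MeasureTheory Real ENNReal

noncomputable section

/-- Partial derivative of a complex-valued function on `ℝⁿ` in the `j`-th coordinate
direction. -/
def pd {n : ℕ} (j : Fin n) (f : (Fin n → ℝ) → ℂ) : (Fin n → ℝ) → ℂ :=
  fun x => fderiv ℝ f x (Pi.single j 1)

/-- The canonical list of directions associated to a multi-index `β ∈ ℕⁿ`. -/
def mIdxList {n : ℕ} (β : Fin n → ℕ) : List (Fin n) :=
  (List.finRange n).flatMap fun j => List.replicate (β j) j

/-- Iterated partial derivative `∂^β` associated to a multi-index `β`. -/
def pdM {n : ℕ} (β : Fin n → ℕ) (f : (Fin n → ℝ) → ℂ) : (Fin n → ℝ) → ℂ :=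
  (mIdxList β).foldr pd f

/-- Forward difference operator in the `j`-th direction on functions of `ξ ∈ ℤⁿ`. -/
def dd {n : ℕ} (j : Fin n) (g : (Fin n → ℤ) → ℂ) : (Fin n → ℤ) → ℂ :=
  fun ξ => g (ξ + Pi.single j 1) - g ξ

/-- Iterated difference operator `Δ_ξ^α` associated to a multi-index `α`. -/
def ddM {n : ℕ} (α : Fin n → ℕ) (g : (Fin n → ℤ) → ℂ) : (Fin n → ℤ) → ℂ :=
  (mIdxList α).foldr dd g

/-- Japanese bracket `⟨ξ⟩ = (1+|ξ|²)^{1/2}` of a lattice point `ξ ∈ ℤⁿ`. -/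
def jb {n : ℕ} (ξ : Fin n → ℤ) : ℝ := Real.sqrt (1 + ∑ j, ((ξ j : ℝ)) ^ 2)

/-- Japanese bracket `⟨ξ⟩ = (1+|ξ|²)^{1/2}` of a vector `ξ ∈ ℝⁿ`. -/
def jbR {n : ℕ} (ξ : Fin n → ℝ) : ℝ := Real.sqrt (1 + ∑ j, (ξ j) ^ 2)

/-- The canonical embedding `ℤⁿ → ℝⁿ`. -/
def castZ {n : ℕ} (ξ : Fin n → ℤ) : Fin n → ℝ := fun j => (ξ j : ℝ)

/-- The fundamental domain `[0,1)ⁿ` of the torus `𝕋ⁿ = ℝⁿ/ℤⁿ`. -/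
def cube (n : ℕ) : Set (Fin n → ℝ) := Set.univ.pi fun _ => Set.Ico (0 : ℝ) 1

/-- The normalized Lebesgue measure of the torus `𝕋ⁿ`, realized as the Lebesgue measure
on `ℝⁿ` restricted to the fundamental domain `[0,1)ⁿ`. -/
def μT (n : ℕ) : Measure (Fin n → ℝ) := volume.restrict (cube n)

/-- `1`-periodicity of a function on `ℝⁿ` (i.e. the function descends to `𝕋ⁿ`). -/
def Per {n : ℕ} (f : (Fin n → ℝ) → ℂ) : Prop :=
  ∀ (x : Fin n → ℝ) (v : Fin n → ℤ), f (x + fun j => (v j : ℝ)) = f x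

/-- The character `e^{2πi⟨x,ξ⟩}`. -/
def eChar {n : ℕ} (x : Fin n → ℝ) (ξ : Fin n → ℤ) : ℂ :=
  Complex.exp (2 * (π : ℂ) * Complex.I * ∑ j, (x j : ℂ) * (ξ j : ℂ))

/-- Fourier coefficient `f̂(ξ) = ∫_{𝕋ⁿ} e^{-2πi⟨x,ξ⟩} f(x) dx` of a function on `𝕋ⁿ`. -/
def fc {n : ℕ} (f : (Fin n → ℝ) → ℂ) (ξ : Fin n → ℤ) : ℂ :=
  ∫ x, Complex.exp (-(2 * (π : ℂ) * Complex.I) * ∑ j, (x j : ℂ) * (ξ j : ℂ)) * f x ∂(μT n)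

/-- Periodic pseudo-differential operator
    `σ(x,D)f(x) = Σ_{ξ ∈ ℤⁿ} e^{2πi⟨x,ξ⟩} σ(x,ξ) f̂(ξ)`
with symbol `σ` on `𝕋ⁿ × ℤⁿ`. -/
def Op {n : ℕ} (σ : (Fin n → ℝ) → (Fin n → ℤ) → ℂ) (f : (Fin n → ℝ) → ℂ) :
    (Fin n → ℝ) → ℂ :=
  fun x => ∑' ξ : Fin n → ℤ, eChar x ξ * σ x ξ * fc f ξ

/-- The `L^p(𝕋ⁿ)` norm, for a real exponent `p`. -/
def lpT (n : ℕ) (p : ℝ) (g : (Fin n → ℝ) → ℂ) : ℝ :=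
  (∫ x, ‖g x‖ ^ p ∂(μT n)) ^ (1 / p)

/-- `∂_x^β Δ_ξ^α σ(x,ξ)` for a symbol `σ` on `𝕋ⁿ × ℤⁿ` (difference operator applied first,
then the derivatives in `x`). -/
def symbDxD {n : ℕ} (β α : Fin n → ℕ) (σ : (Fin n → ℝ) → (Fin n → ℤ) → ℂ)
    (x : Fin n → ℝ) (ξ : Fin n → ℤ) : ℂ :=
  pdM β (fun x' => ddM α (σ x') ξ) x

/-- `Δ_ξ^α ∂_x^β σ(x,ξ)` for a symbol `σ` on `𝕋ⁿ × ℤⁿ` (derivatives in `x` applied first,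
then the difference operator in `ξ`). -/
def symbDDx {n : ℕ} (α β : Fin n → ℕ) (σ : (Fin n → ℝ) → (Fin n → ℤ) → ℂ)
    (x : Fin n → ℝ) (ξ : Fin n → ℤ) : ℂ :=
  ddM α (fun ξ' => pdM β (fun x' => σ x' ξ') x) ξ

/-- `∂_ξ^α ∂_x^β σ(x,ξ)` for a symbol `σ` on `𝕋ⁿ × ℝⁿ` (derivatives in `x` applied first,
then the derivatives in `ξ`). -/
def symbDξDx {n : ℕ} (α β : Fin n → ℕ) (σ : (Fin n → ℝ) → (Fin n → ℝ) → ℂ)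
    (x ξ : Fin n → ℝ) : ℂ :=
  pdM α (fun ξ' => pdM β (fun x' => σ x' ξ') x) ξ

/-- `∂_x^β ∂_ξ^α σ(x,ξ)` for a symbol `σ` on `𝕋ⁿ × ℝⁿ` (derivatives in `ξ` applied first,
then the derivatives in `x`). -/
def symbDxDξ {n : ℕ} (β α : Fin n → ℕ) (σ : (Fin n → ℝ) → (Fin n → ℝ) → ℂ)
    (x ξ : Fin n → ℝ) : ℂ :=
  pdM β (fun x' => pdM α (σ x') ξ) x

/-- The Euclidean Fourier transform `û(ξ) = ∫_{ℝⁿ} e^{-2πi⟨x,ξ⟩} u(x) dx`. -/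
def FT {n : ℕ} (u : (Fin n → ℝ) → ℂ) (ξ : Fin n → ℝ) : ℂ :=
  ∫ x, Complex.exp (-(2 * (π : ℂ) * Complex.I) * ∑ j, (x j : ℂ) * (ξ j : ℂ)) * u x

/-- Pseudo-differential operator on `ℝⁿ`:
`T_σ u(x) = ∫_{ℝⁿ} e^{2πi⟨x,ξ⟩} σ(x,ξ) û(ξ) dξ`. -/
def OpR {n : ℕ} (σ : (Fin n → ℝ) → (Fin n → ℝ) → ℂ) (u : (Fin n → ℝ) → ℂ) :
    (Fin n → ℝ) → ℂ :=
  fun x => ∫ ξ, Complex.exp (2 * (π : ℂ) * Complex.I * ∑ j, (x j : ℂ) * (ξ j : ℂ)) * σ x ξ * FT u ξ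

/-- Periodic amplitude operator
`a(x,y,D)u(x) = ∫_{𝕋ⁿ} ∫_{ℝⁿ} e^{2πi⟨x-y,ξ⟩} a(x,y,ξ) u(y) dξ dy`. -/
def OpAmp {n : ℕ} (a : (Fin n → ℝ) → (Fin n → ℝ) → (Fin n → ℝ) → ℂ)
    (u : (Fin n → ℝ) → ℂ) : (Fin n → ℝ) → ℂ :=
  fun x => ∫ y,
    (∫ ξ, Complex.exp (2 * (π : ℂ) * Complex.I * ∑ j, ((x j : ℂ) - (y j : ℂ)) * (ξ j : ℂ)) *
        a x y ξ) * u y ∂(μT n)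

/-- The `L^p(ℝⁿ)` norm, for a real exponent `p`. -/
def lpR (n : ℕ) (p : ℝ) (g : (Fin n → ℝ) → ℂ) : ℝ :=
  (∫ x, ‖g x‖ ^ p) ^ (1 / p)


lemma μT_eq_pi (n : ℕ) :
    μT n = Measure.pi fun _ : Fin n => (volume : Measure ℝ).restrict (Set.Ico (0 : ℝ) 1) := by
  rw [μT, cube, volume_pi, Measure.restrict_pi_pi]

instance isProbabilityMeasure_volume_Ico :
    IsProbabilityMeasure ((volume : Measure ℝ).restrict (Set.Ico (0 : ℝ) 1)) :=
  ⟨by simp⟩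

instance isProbabilityMeasure_μT (n : ℕ) : IsProbabilityMeasure (μT n) := by
  rw [μT_eq_pi]; infer_instance

section Characters

variable {n : ℕ}

lemma eChar_eq_exp_real (x : Fin n → ℝ) (ξ : Fin n → ℤ) :
    eChar x ξ = Complex.exp (((2 * π * ∑ j, x j * ξ j : ℝ) : ℂ) * Complex.I) := by
  rw [eChar]; congr 1; push_cast; ring

lemma eChar_eq_prod (x : Fin n → ℝ) (ξ : Fin n → ℤ) :
    eChar x ξ = ∏ j, Complex.exp (2 * π * Complex.I * ((x j : ℂ) * (ξ j : ℂ))) := by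
  rw [eChar, Finset.mul_sum, Complex.exp_sum]

@[simp] lemma norm_eChar (x : Fin n → ℝ) (ξ : Fin n → ℤ) : ‖eChar x ξ‖ = 1 := by
  rw [eChar_eq_exp_real, Complex.norm_exp_ofReal_mul_I]

lemma eChar_add (x : Fin n → ℝ) (ξ η : Fin n → ℤ) :
    eChar x (ξ + η) = eChar x ξ * eChar x η := by
  simp only [eChar, ← Complex.exp_add, ← mul_add, ← Finset.sum_add_distrib, Pi.add_apply,
    Int.cast_add]

lemma eChar_add_left (x y : Fin n → ℝ) (ξ : Fin n → ℤ) :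
    eChar (x + y) ξ = eChar x ξ * eChar y ξ := by
  simp only [eChar, ← Complex.exp_add, ← mul_add, ← Finset.sum_add_distrib, Pi.add_apply,
    Complex.ofReal_add, add_mul]

lemma eChar_neg (x : Fin n → ℝ) (ξ : Fin n → ℤ) : eChar x (-ξ) = (starRingEnd ℂ) (eChar x ξ) := by
  rw [eChar_eq_exp_real, eChar_eq_exp_real, ← Complex.exp_conj, map_mul, Complex.conj_ofReal,
    Complex.conj_I]
  simp

lemma eChar_neg_left (x : Fin n → ℝ) (ξ : Fin n → ℤ) : eChar (-x) ξ = eChar x (-ξ) := by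
  simp [eChar]

lemma eChar_sub_left (x y : Fin n → ℝ) (ξ : Fin n → ℤ) :
    eChar (x - y) ξ = eChar x ξ * eChar y (-ξ) := by
  rw [sub_eq_add_neg, eChar_add_left, eChar_neg_left]

lemma contDiff_eChar (ξ : Fin n → ℤ) : ContDiff ℝ (⊤ : ℕ∞) fun x : Fin n → ℝ => eChar x ξ := by
  simp only [eChar]
  have h : ∀ j : Fin n, ContDiff ℝ (⊤ : ℕ∞) fun x : Fin n → ℝ => (x j : ℂ) := fun j =>
    Complex.ofRealCLM.contDiff.comp (contDiff_apply ℝ ℝ j)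
  fun_prop

@[fun_prop] lemma continuous_eChar (ξ : Fin n → ℤ) : Continuous fun x : Fin n → ℝ => eChar x ξ :=
  (contDiff_eChar ξ).continuous

lemma eChar_periodic (ξ v : Fin n → ℤ) (x : Fin n → ℝ) :
    eChar (x + fun j => (v j : ℝ)) ξ = eChar x ξ := by
  rw [eChar_add_left]
  have : eChar (fun j => (v j : ℝ)) ξ = 1 := by
    rw [eChar, Complex.exp_eq_one_iff]
    exact ⟨∑ j, v j * ξ j, by push_cast; ring⟩
  rw [this, mul_one]

lemma fc_eq (f : (Fin n → ℝ) → ℂ) (ξ : Fin n → ℤ) :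
    fc f ξ = ∫ x, eChar x (-ξ) * f x ∂(μT n) := by
  simp [fc, eChar]

lemma integral_eChar (ξ : Fin n → ℤ) :
    ∫ x, eChar x ξ ∂(μT n) = if ξ = 0 then 1 else 0 := by
  simp_rw [eChar_eq_prod]
  rw [μT_eq_pi, integral_fintype_prod_eq_prod
    (fun (j : Fin n) (t : ℝ) => Complex.exp (2 * π * Complex.I * ((t : ℂ) * (ξ j : ℂ))))]
  have key : ∀ m : ℤ, ∫ t in Set.Ico (0 : ℝ) 1,
      Complex.exp (2 * π * Complex.I * ((t : ℂ) * (m : ℂ))) = if m = 0 then 1 else 0 := by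
    intro m
    rw [integral_Ico_eq_integral_Ioc, ← intervalIntegral.integral_of_le zero_le_one]
    split_ifs with hm
    · simp [hm]
    · have hc : (2 * π * Complex.I * m : ℂ) ≠ 0 :=
        mul_ne_zero Complex.two_pi_I_ne_zero (by exact_mod_cast hm)
      have : ∀ t : ℝ, Complex.exp (2 * π * Complex.I * ((t : ℂ) * (m : ℂ))) =
          Complex.exp ((2 * π * Complex.I * m) * t) := fun t => by congr 1; ring
      simp_rw [this]
      rw [integral_exp_mul_complex hc]
      have h1 : Complex.exp (2 * π * Complex.I * m * (1 : ℝ)) = 1 := by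
        rw [Complex.exp_eq_one_iff]; exact ⟨m, by push_cast; ring⟩
      rw [h1]; simp
  simp_rw [key]
  split_ifs with h
  · simp [h]
  · obtain ⟨j, hj⟩ := Function.ne_iff.1 h
    exact Finset.prod_eq_zero (Finset.mem_univ j) (if_neg hj)

lemma Continuous.integrable_μT {E : Type*} [NormedAddCommGroup E]
    {f : (Fin n → ℝ) → E} (hf : Continuous f) : Integrable f (μT n) := by
  have h : IntegrableOn f (Set.Icc (0 : Fin n → ℝ) 1) :=
    hf.continuousOn.integrableOn_compact isCompact_Icc
  refine h.mono_set fun x hx => ?_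
  exact ⟨fun j => (hx j trivial).1, fun j => (hx j trivial).2.le⟩

lemma integral_norm_sq_trigPoly (F : Finset (Fin n → ℤ)) (c : (Fin n → ℤ) → ℂ) :
    ∫ x, ‖∑ ξ ∈ F, c ξ * eChar x ξ‖ ^ 2 ∂(μT n) = ∑ ξ ∈ F, ‖c ξ‖ ^ 2 := by
  have h : ∀ x : Fin n → ℝ, ((‖∑ ξ ∈ F, c ξ * eChar x ξ‖ ^ 2 : ℝ) : ℂ) =
      ∑ ξ ∈ F, ∑ η ∈ F, c ξ * (starRingEnd ℂ) (c η) * eChar x (ξ + -η) := by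
    intro x
    push_cast
    rw [← Complex.mul_conj', map_sum, Finset.sum_mul_sum]
    refine Finset.sum_congr rfl fun ξ _ => Finset.sum_congr rfl fun η _ => ?_
    rw [eChar_add, eChar_neg, map_mul]; ring
  have hc : ∀ ξ : Fin n → ℤ, Integrable (fun x => eChar x ξ) (μT n) := fun ξ =>
    (continuous_eChar ξ).integrable_μT
  apply Complex.ofReal_injective
  rw [← integral_complex_ofReal]
  simp_rw [h]
  rw [integral_finsetSum _ fun ξ _ => integrable_finsetSum _ fun η _ => (hc _).const_mul _]
  push_cast
  refine Finset.sum_congr rfl fun ξ hξ => ?_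
  rw [integral_finsetSum _ fun η _ => (hc _).const_mul _]
  simp_rw [integral_const_mul, integral_eChar, ← sub_eq_add_neg, sub_eq_zero]
  simp [hξ, Complex.mul_conj']

lemma lintegral_enorm_sq_trigPoly (F : Finset (Fin n → ℤ)) (c : (Fin n → ℤ) → ℂ) :
    ∫⁻ x, ‖∑ ξ ∈ F, c ξ * eChar x ξ‖ₑ ^ 2 ∂(μT n) = ∑ ξ ∈ F, ‖c ξ‖ₑ ^ 2 := by
  have h1 : ∀ z : ℂ, ‖z‖ₑ ^ 2 = ENNReal.ofReal (‖z‖ ^ 2) := fun z => by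
    rw [ENNReal.ofReal_pow (norm_nonneg _), ofReal_norm]
  simp_rw [h1]
  rw [← ofReal_integral_eq_lintegral_ofReal, integral_norm_sq_trigPoly,
    ENNReal.ofReal_sum_of_nonneg fun _ _ => by positivity]
  · apply Continuous.integrable_μT; fun_prop
  · exact Filter.Eventually.of_forall fun x => by positivity

lemma sum_norm_sq_fc_le (F : Finset (Fin n → ℤ)) {f : (Fin n → ℝ) → ℂ}
    (hf : AEStronglyMeasurable f (μT n)) {M : ℝ} (hM : ∀ᵐ x ∂(μT n), ‖f x‖ ≤ M) :
    ∑ ξ ∈ F, ‖fc f ξ‖ ^ 2 ≤ ∫ x, ‖f x‖ ^ 2 ∂(μT n) := by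
  set P : (Fin n → ℝ) → ℂ := fun x => ∑ ξ ∈ F, fc f ξ * eChar x ξ with hP
  have hPc : Continuous P := by fun_prop
  have hfi : Integrable f (μT n) := Integrable.of_bound hf M hM
  have hf2 : Integrable (fun x => ‖f x‖ ^ 2) (μT n) := by
    refine Integrable.of_bound (hf.norm.pow 2) (M ^ 2) (hM.mono fun x hx => ?_)
    rw [norm_pow, norm_norm]; gcongr
  have hP2 : Integrable (fun x => ‖P x‖ ^ 2) (μT n) := (by fun_prop : Continuous _).integrable_μT
  have hei : ∀ ξ : Fin n → ℤ, Integrable (fun x => eChar x ξ * f x) (μT n) := fun ξ =>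
    hfi.bdd_mul (c := 1) (continuous_eChar ξ).aestronglyMeasurable (by simp)
  have hcross : ∀ x, (starRingEnd ℂ) (P x) * f x =
      ∑ ξ ∈ F, (starRingEnd ℂ) (fc f ξ) * (eChar x (-ξ) * f x) := by
    intro x
    rw [hP, map_sum, Finset.sum_mul]
    refine Finset.sum_congr rfl fun ξ _ => ?_
    rw [eChar_neg, map_mul]; ring
  have hcrossi : Integrable (fun x => (starRingEnd ℂ) (P x) * f x) (μT n) := by
    simp_rw [hcross]
    exact integrable_finsetSum _ fun ξ _ => (hei _).const_mul _
  have hI : ∫ x, (starRingEnd ℂ) (P x) * f x ∂(μT n) = ((∑ ξ ∈ F, ‖fc f ξ‖ ^ 2 : ℝ) : ℂ) := by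
    simp_rw [hcross]
    rw [integral_finsetSum _ fun ξ _ => (hei _).const_mul _]
    simp_rw [integral_const_mul, ← fc_eq]
    push_cast
    exact Finset.sum_congr rfl fun ξ _ => by rw [Complex.conj_mul']
  have hre : ∫ x, ((starRingEnd ℂ) (P x) * f x).re ∂(μT n) = ∑ ξ ∈ F, ‖fc f ξ‖ ^ 2 := by
    have := integral_re hcrossi
    rw [hI] at this
    exact this.trans (Complex.ofReal_re _)
  have hle : ∫ x, 2 * ((starRingEnd ℂ) (P x) * f x).re ∂(μT n) ≤
      ∫ x, (‖P x‖ ^ 2 + ‖f x‖ ^ 2) ∂(μT n) := by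
    refine integral_mono (hcrossi.re.const_mul 2) (hP2.add hf2) fun x => ?_
    have h1 : ((starRingEnd ℂ) (P x) * f x).re ≤ ‖P x‖ * ‖f x‖ := by
      refine (Complex.re_le_norm _).trans ?_
      rw [norm_mul, Complex.norm_conj]
    have h2 := sq_nonneg (‖P x‖ - ‖f x‖)
    simp only
    nlinarith
  rw [integral_const_mul, hre, integral_add hP2 hf2, integral_norm_sq_trigPoly] at hle
  linarith

lemma sum_enorm_sq_fc_le (F : Finset (Fin n → ℤ)) {f : (Fin n → ℝ) → ℂ}
    (hf : AEStronglyMeasurable f (μT n)) {M : ℝ} (hM : ∀ᵐ x ∂(μT n), ‖f x‖ ≤ M) :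
    ∑ ξ ∈ F, ‖fc f ξ‖ₑ ^ 2 ≤ ∫⁻ x, ‖f x‖ₑ ^ 2 ∂(μT n) := by
  have h1 : ∀ z : ℂ, ‖z‖ₑ ^ 2 = ENNReal.ofReal (‖z‖ ^ 2) := fun z => by
    rw [ENNReal.ofReal_pow (norm_nonneg _), ofReal_norm]
  simp_rw [h1]
  rw [← ofReal_integral_eq_lintegral_ofReal, ← ENNReal.ofReal_sum_of_nonneg fun _ _ => by positivity]
  · exact ENNReal.ofReal_le_ofReal (sum_norm_sq_fc_le F hf hM)
  · refine Integrable.of_bound (hf.norm.pow 2) (M ^ 2) (hM.mono fun x hx => ?_)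
    rw [norm_pow, norm_norm]; gcongr
  · exact Filter.Eventually.of_forall fun x => by positivity

end Characters

section Fourier

variable {n : ℕ}

lemma pd_contDiff (l : Fin n) {g : (Fin n → ℝ) → ℂ} (hg : ContDiff ℝ (⊤ : ℕ∞) g) :
    ContDiff ℝ (⊤ : ℕ∞) (pd l g) := by
  have h : ContDiff ℝ (⊤ : ℕ∞) (fderiv ℝ g) := hg.fderiv_right (by simp)
  exact h.clm_apply contDiff_const

lemma Per.pd (l : Fin n) {g : (Fin n → ℝ) → ℂ} (hg : Per g) : Per (pd l g) := by
  intro x v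
  have h : (fun y => g (y + fun j => (v j : ℝ))) = g := funext fun y => hg y v
  have := fderiv_comp_add_right (𝕜 := ℝ) (f := g) (x := x) (fun j => (v j : ℝ))
  rw [h] at this
  simp only [_root_.pd, this]

lemma integral_pd_eq_zero (l : Fin n) {g : (Fin n → ℝ) → ℂ} (hg : ContDiff ℝ (⊤ : ℕ∞) g)
    (hper : Per g) : ∫ x, pd l g x ∂(μT n) = 0 := by
  obtain _ | m := n
  · exact l.elim0
  have hcube : cube (m + 1) =ᵐ[volume] Set.Icc 0 1 :=
    Measure.univ_pi_Ico_ae_eq_Icc (f := fun _ => (0 : ℝ)) (g := fun _ => (1 : ℝ))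
  rw [μT, setIntegral_congr_set hcube]
  have hd : Differentiable ℝ g := hg.differentiable (by simp)
  have hsum : ∀ x, ∑ i, (if i = l then fderiv ℝ g x else 0) (Pi.single i 1) = pd l g x := by
    intro x
    rw [Finset.sum_eq_single l (fun i _ hi => by simp [hi]) (by simp)]
    simp [pd]
  have := integral_divergence_of_hasFDerivAt_off_countable' (0 : Fin (m + 1) → ℝ) 1
    (fun i => by simp) (fun i x => if i = l then g x else 0)
    (fun i x => if i = l then fderiv ℝ g x else 0) ∅ Set.countable_empty
    (fun i => by split_ifs <;> [exact hd.continuous.continuousOn; exact continuousOn_const])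
    (fun x _ i => by
      by_cases hi : i = l
      · simpa [hi] using (hd x).hasFDerivAt
      · simpa [hi] using hasFDerivAt_const (0 : ℂ) x)
    (by
      simp_rw [hsum]
      exact (pd_contDiff l hg).continuous.continuousOn.integrableOn_compact isCompact_Icc)
  simp_rw [hsum] at this
  rw [this]
  refine Finset.sum_eq_zero fun i _ => ?_
  rw [sub_eq_zero]
  refine integral_congr_ae (Filter.Eventually.of_forall fun x => ?_)
  simp only
  split_ifs
  · refine Eq.trans ?_ (hper _ (Pi.single i 1))
    congr 1
    ext j
    induction j using Fin.succAboveCases i with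
    | x => simp
    | p j => simp
  · rfl

lemma pd_eChar (l : Fin n) (ξ : Fin n → ℤ) (x : Fin n → ℝ) :
    pd l (fun x => eChar x ξ) x = 2 * π * Complex.I * ξ l * eChar x ξ := by
  have hL : ∀ y : Fin n → ℝ, 2 * (π : ℂ) * Complex.I * ∑ j, (y j : ℂ) * (ξ j : ℂ) =
      (2 * (π : ℂ) * Complex.I) • (∑ j, (ξ j : ℂ) • Complex.ofRealCLM.comp
        (ContinuousLinearMap.proj (R := ℝ) (φ := fun _ : Fin n => ℝ) j)) y := by
    intro y
    simp [mul_comm]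
  have h := ((((2 * (π : ℂ) * Complex.I) • (∑ j, (ξ j : ℂ) • Complex.ofRealCLM.comp
        (ContinuousLinearMap.proj (R := ℝ) (φ := fun _ : Fin n => ℝ) j)) :
        (Fin n → ℝ) →L[ℝ] ℂ)).hasFDerivAt (x := x)).cexp
  have h2 : (fun x : Fin n → ℝ => eChar x ξ) = fun y => Complex.exp
      (((2 * (π : ℂ) * Complex.I) • (∑ j, (ξ j : ℂ) • Complex.ofRealCLM.comp
        (ContinuousLinearMap.proj (R := ℝ) (φ := fun _ : Fin n => ℝ) j)) :
        (Fin n → ℝ) →L[ℝ] ℂ) y) := by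
    funext y; rw [eChar, hL]; rfl
  rw [pd, h2, h.fderiv]
  simp only [smul_apply, sum_apply, smul_eq_mul, eChar, hL,
    ContinuousLinearMap.comp_apply, ContinuousLinearMap.proj_apply, Complex.ofRealCLM_apply,
    Pi.single_apply, apply_ite Complex.ofReal, Complex.ofReal_one, Complex.ofReal_zero, mul_ite,
    mul_one, mul_zero, Finset.sum_ite_eq', Finset.mem_univ, if_true]
  ring

lemma fc_pd (l : Fin n) {g : (Fin n → ℝ) → ℂ} (hg : ContDiff ℝ (⊤ : ℕ∞) g)
    (hper : Per g) (ξ : Fin n → ℤ) : fc (pd l g) ξ = 2 * π * Complex.I * ξ l * fc g ξ := by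
  have hP : Per fun x => eChar x (-ξ) * g x := fun x v => by
    simp only [eChar_periodic, hper x v]
  have he := contDiff_eChar (-ξ)
  have h0 := integral_pd_eq_zero l (he.mul hg) hP
  have h1 : ∀ x, pd l (fun x => eChar x (-ξ) * g x) x =
      eChar x (-ξ) * pd l g x - 2 * π * Complex.I * ξ l * (eChar x (-ξ) * g x) := by
    intro x
    have := pd_eChar l (-ξ) x
    rw [pd] at this ⊢
    rw [fderiv_fun_mul (he.differentiable (by simp) x) (hg.differentiable (by simp) x)]
    simp only [add_apply, smul_apply, this, smul_eq_mul]
    rw [pd]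
    push_cast [Pi.neg_apply]; ring
  simp_rw [h1] at h0
  have hc := (pd_contDiff l hg).continuous
  have hc' := hg.continuous
  rw [integral_sub (by fun_prop : Continuous _).integrable_μT
    (by fun_prop : Continuous _).integrable_μT, integral_const_mul, ← fc_eq, ← fc_eq,
    sub_eq_zero] at h0
  exact h0

lemma fc_iterate_pd (l : Fin n) (k : ℕ) {g : (Fin n → ℝ) → ℂ} (hg : ContDiff ℝ (⊤ : ℕ∞) g)
    (hper : Per g) (ξ : Fin n → ℤ) :
    fc ((pd l)^[k] g) ξ = (2 * π * Complex.I * ξ l) ^ k * fc g ξ := by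
  induction k generalizing g with
  | zero => simp
  | succ k ih =>
    rw [Function.iterate_succ_apply, ih (pd_contDiff l hg) (hper.pd l), fc_pd l hg hper]; ring

lemma hasSum_fc {g : (Fin n → ℝ) → ℂ} (hg : Continuous g) (hper : Per g)
    (hs : Summable (fc g)) (x : Fin n → ℝ) : HasSum (fun ξ => eChar x ξ * fc g ξ) (g x) := by
  let q : (Fin n → ℝ) → UnitAddTorus (Fin n) := Pi.map fun _ t => (t : UnitAddCircle)
  have hq : IsOpenQuotientMap q := IsOpenQuotientMap.piMap fun _ =>
    QuotientAddGroup.isOpenQuotientMap_mk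
  have hfib : ∀ x y, q x = q y → g x = g y := by
    intro x y hxy
    have : ∀ j, ∃ m : ℤ, x j + m = y j := by
      intro j
      have hj : ((x j : ℝ) : UnitAddCircle) = (y j : ℝ) := congrFun hxy j
      obtain ⟨m, hm⟩ := (QuotientAddGroup.eq.1 hj)
      exact ⟨m, by simp at hm; linarith⟩
    choose v hv using this
    rw [← hper x v]
    congr 1; ext j; exact hv j
  let G : C(UnitAddTorus (Fin n), ℂ) :=
    ⟨fun t => g (Function.surjInv hq.surjective t), by
      rw [hq.isQuotientMap.continuous_iff]
      convert hg using 1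
      funext y
      exact hfib _ _ (Function.surjInv_eq hq.surjective _)⟩
  have hG : ∀ y, G (q y) = g y := fun y => hfib _ _ (Function.surjInv_eq hq.surjective _)
  have hF : ∀ ξ y, UnitAddTorus.mFourier ξ (q y) = eChar y ξ := by
    intro ξ y
    rw [eChar_eq_prod]
    change ∏ j, fourier (ξ j) (q y j) = _
    refine Finset.prod_congr rfl fun j _ => ?_
    simp only [q, Pi.map_apply]
    rw [fourier_coe_apply]
    congr 1; push_cast; ring
  have hcoef : UnitAddTorus.mFourierCoeff G = fc g := by
    funext ξ
    have hcube : {x : Fin n → ℝ | ∀ i, x i ∈ Set.Ioc (0 : ℝ) (0 + 1)} =ᵐ[volume] cube n := by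
      have h1 := Measure.univ_pi_Ico_ae_eq_Icc (f := fun _ : Fin n => (0 : ℝ))
        (g := fun _ => (1 : ℝ)) (μ := fun _ => (volume : Measure ℝ))
      have h2 := Measure.univ_pi_Ioc_ae_eq_Icc (f := fun _ : Fin n => (0 : ℝ))
        (g := fun _ => (1 : ℝ)) (μ := fun _ => (volume : Measure ℝ))
      have h3 : {x : Fin n → ℝ | ∀ i, x i ∈ Set.Ioc (0 : ℝ) (0 + 1)} =
          Set.univ.pi fun _ => Set.Ioc (0 : ℝ) 1 := by ext; simp
      rw [h3]
      exact h2.trans h1.symm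
    rw [UnitAddTorus.mFourierCoeff_eq_integral _ _ 0]
    simp only [Pi.zero_apply]
    rw [setIntegral_congr_set hcube, fc_eq]
    refine integral_congr_ae (Filter.Eventually.of_forall fun y => ?_)
    change UnitAddTorus.mFourier (-ξ) (q y) • G (q y) = _
    rw [hF, hG]; rfl
  have := UnitAddTorus.hasSum_mFourier_series_apply_of_summable (f := G)
    (by rw [hcoef]; exact hs) (q x)
  rw [hcoef, hG] at this
  simp_rw [hF, smul_eq_mul] at this
  simpa only [mul_comm] using this

end Fourier

lemma inv_one_add_sum_pow_le_prod {n k : ℕ} (hn : n ≠ 0) {s : Fin n → ℝ} (hs : ∀ l, 0 ≤ s l) :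
    (1 + ∑ l, s l ^ (2 * k))⁻¹ ≤ ∏ l, (max 1 (s l)) ^ (-(2 * k / n : ℝ)) := by
  set S := 1 + ∑ l, s l ^ (2 * k) with hS
  have hsum : 0 ≤ ∑ l, s l ^ (2 * k) := Finset.sum_nonneg fun l _ => pow_nonneg (hs l) _
  have hS1 : 1 ≤ S := by linarith
  have hn' : (n : ℝ) ≠ 0 := by exact_mod_cast hn
  have h1 : ∀ l, (max 1 (s l)) ^ (2 * k / n : ℝ) ≤ S ^ (1 / n : ℝ) := by
    intro l
    have h2 : (max 1 (s l)) ^ (2 * k) ≤ S := by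
      rcases max_choice 1 (s l) with h | h <;> rw [h]
      · simpa using hS1
      · have := Finset.single_le_sum (f := fun l => s l ^ (2 * k))
          (fun l _ => pow_nonneg (hs l) _) (Finset.mem_univ l)
        linarith
    have h3 : (max 1 (s l)) ^ (2 * k / n : ℝ) = ((max 1 (s l)) ^ (2 * k)) ^ (1 / n : ℝ) := by
      rw [← Real.rpow_natCast, ← Real.rpow_mul (by positivity)]
      congr 1; push_cast; ring
    rw [h3]
    gcongr
  have h4 : ∀ l, (max 1 (s l)) ^ (-(2 * k / n : ℝ)) = ((max 1 (s l)) ^ (2 * k / n : ℝ))⁻¹ :=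
    fun l => Real.rpow_neg (by positivity) _
  simp_rw [h4]
  rw [Finset.prod_inv_distrib]
  refine inv_anti₀ (Finset.prod_pos fun l _ => by positivity) ?_
  calc ∏ l, (max 1 (s l)) ^ (2 * k / n : ℝ) ≤ ∏ _l : Fin n, S ^ (1 / n : ℝ) :=
      Finset.prod_le_prod (fun l _ => by positivity) fun l _ => h1 l
    _ = S := by
      rw [Finset.prod_const, Finset.card_univ, Fintype.card_fin, ← Real.rpow_natCast,
        ← Real.rpow_mul (by linarith), one_div_mul_cancel hn', Real.rpow_one]

lemma summable_max_one_abs_rpow {q : ℝ} (hq : 1 < q) :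
    Summable fun m : ℤ => (max 1 |(m : ℝ)|) ^ (-q) := by
  refine Summable.of_nonneg_of_le (fun m => by positivity) (fun m => ?_)
    ((Real.summable_abs_int_rpow hq).add
      (summable_of_hasFiniteSupport (f := fun m : ℤ => if m = 0 then (1 : ℝ) else 0)
        ((Set.finite_singleton (0 : ℤ)).subset fun m hm => by simpa using hm)))
  by_cases hm : m = 0
  · simp [hm]; positivity
  · have : (1 : ℝ) ≤ |(m : ℝ)| := by exact_mod_cast Int.one_le_abs hm
    simp [hm, max_eq_right this]

lemma summable_inv_one_add_sum_pow {n k : ℕ} (hn : n ≠ 0) (hk : n < 2 * k) :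
    Summable fun η : Fin n → ℤ => (1 + ∑ l, |(η l : ℝ)| ^ (2 * k))⁻¹ := by
  have hq : 1 < (2 * k / n : ℝ) := by
    rw [one_lt_div (by positivity)]; exact_mod_cast hk
  have hs := summable_max_one_abs_rpow hq
  refine summable_of_sum_le (c := (∑' m : ℤ, (max 1 |(m : ℝ)|) ^ (-(2 * k / n : ℝ))) ^ n)
    (fun η => by positivity) fun F => ?_
  classical
  calc ∑ η ∈ F, (1 + ∑ l, |(η l : ℝ)| ^ (2 * k))⁻¹
      ≤ ∑ η ∈ F, ∏ l, (max 1 |(η l : ℝ)|) ^ (-(2 * k / n : ℝ)) :=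
        Finset.sum_le_sum fun η _ => inv_one_add_sum_pow_le_prod hn fun l => abs_nonneg _
    _ ≤ ∑ η ∈ Fintype.piFinset fun l => F.image fun η : Fin n → ℤ => η l,
          ∏ l, (max 1 |(η l : ℝ)|) ^ (-(2 * k / n : ℝ)) := by
        refine Finset.sum_le_sum_of_subset_of_nonneg (fun η hη => ?_) fun η _ _ => by positivity
        exact Fintype.mem_piFinset.2 fun l => Finset.mem_image_of_mem _ hη
    _ = ∏ l : Fin n, ∑ m ∈ F.image fun η : Fin n → ℤ => η l, (max 1 |(m : ℝ)|) ^ (-(2 * k / n : ℝ)) :=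
        (Finset.prod_univ_sum _ fun _ (m : ℤ) => (max 1 |(m : ℝ)|) ^ (-(2 * k / n : ℝ))).symm
    _ ≤ ∏ _l : Fin n, ∑' m : ℤ, (max 1 |(m : ℝ)|) ^ (-(2 * k / n : ℝ)) :=
        Finset.prod_le_prod (fun l _ => by positivity) fun l _ =>
          hs.sum_le_tsum _ fun m _ => by positivity
    _ = _ := by simp

lemma ENNReal.sq_tsum_le {ι : Type*} [Countable ι] {v : ι → ℝ} (hv : ∀ i, 0 < v i)
    (z : ι → ℝ≥0∞) :
    (∑' i, z i) ^ 2 ≤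
      (∑' i, ENNReal.ofReal (v i)⁻¹) * ∑' i, ENNReal.ofReal (v i) * z i ^ 2 := by
  let _ : MeasurableSpace ι := ⊤
  have h := ENNReal.lintegral_mul_le_Lp_mul_Lq (Measure.count : Measure ι)
    (Real.HolderConjugate.two_two) (f := fun i => ENNReal.ofReal (v i) ^ (-(1 / 2) : ℝ))
    (g := fun i => ENNReal.ofReal (v i) ^ (1 / 2 : ℝ) * z i)
    (Measurable.of_discrete).aemeasurable (Measurable.of_discrete).aemeasurable
  have hv0 : ∀ i, ENNReal.ofReal (v i) ≠ 0 := fun i => by simpa using hv i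
  simp only [lintegral_count, Pi.mul_apply] at h
  have e1 : ∀ i, ENNReal.ofReal (v i) ^ (-(1 / 2) : ℝ) * (ENNReal.ofReal (v i) ^ (1 / 2 : ℝ) * z i)
      = z i := fun i => by
    rw [← mul_assoc, ← ENNReal.rpow_add _ _ (hv0 i) ENNReal.ofReal_ne_top]; simp
  have e2 : ∀ i, (ENNReal.ofReal (v i) ^ (-(1 / 2) : ℝ)) ^ (2 : ℝ) = ENNReal.ofReal (v i)⁻¹ :=
    fun i => by
      rw [← ENNReal.rpow_mul, ENNReal.ofReal_inv_of_pos (hv i), ← ENNReal.rpow_neg_one]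
      norm_num
  have e3 : ∀ i, (ENNReal.ofReal (v i) ^ (1 / 2 : ℝ) * z i) ^ (2 : ℝ) =
      ENNReal.ofReal (v i) * z i ^ 2 := fun i => by
    rw [ENNReal.mul_rpow_of_nonneg _ _ (by norm_num), ← ENNReal.rpow_mul]
    norm_num
  simp_rw [e1, e2, e3] at h
  calc (∑' i, z i) ^ 2 ≤ _ := pow_le_pow_left' h 2
    _ = _ := by
      rw [mul_pow, ← ENNReal.rpow_natCast, ← ENNReal.rpow_natCast, ← ENNReal.rpow_mul,
        ← ENNReal.rpow_mul]
      norm_num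

section Sobolev

variable {n k : ℕ}

lemma sum_weight_mul_norm_sq_fc_le {g : (Fin n → ℝ) → ℂ} (hg : ContDiff ℝ (⊤ : ℕ∞) g)
    (hper : Per g) {M : ℝ} (h0 : ∀ x, ‖g x‖ ≤ M) (hk : ∀ l x, ‖(pd l)^[k] g x‖ ≤ M)
    (E : Finset (Fin n → ℤ)) :
    ∑ η ∈ E, (1 + ∑ l, |(η l : ℝ)| ^ (2 * k)) * ‖fc g η‖ ^ 2 ≤ (1 + n) * M ^ 2 := by
  have bessel : ∀ h : (Fin n → ℝ) → ℂ, ContDiff ℝ (⊤ : ℕ∞) h → (∀ x, ‖h x‖ ≤ M) →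
      ∑ η ∈ E, ‖fc h η‖ ^ 2 ≤ M ^ 2 := by
    intro h hh hM
    refine (sum_norm_sq_fc_le E hh.continuous.aestronglyMeasurable
      (Filter.Eventually.of_forall hM)).trans ?_
    calc ∫ x, ‖h x‖ ^ 2 ∂(μT n) ≤ ∫ _x, M ^ 2 ∂(μT n) := by
          have := hh.continuous
          refine integral_mono (by fun_prop : Continuous _).integrable_μT (integrable_const _)
            fun x => ?_
          have := hM x
          simp only
          gcongr
      _ = M ^ 2 := by simp
  have hsm : ∀ l (i : ℕ), ContDiff ℝ (⊤ : ℕ∞) ((pd l)^[i] g) := by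
    intro l i
    induction i with
    | zero => exact hg
    | succ i ih => rw [Function.iterate_succ_apply']; exact pd_contDiff l ih
  have hl : ∀ l : Fin n, ∑ η ∈ E, |(η l : ℝ)| ^ (2 * k) * ‖fc g η‖ ^ 2 ≤ M ^ 2 := by
    intro l
    refine le_trans (Finset.sum_le_sum fun η _ => ?_) (bessel _ (hsm l k) (hk l))
    rw [fc_iterate_pd l k hg hper, norm_mul, mul_pow, norm_pow, ← pow_mul, mul_comm k 2]
    have : |(η l : ℝ)| ≤ ‖2 * (π : ℂ) * Complex.I * η l‖ := by
      have h2 : (1 : ℝ) ≤ 2 * π := by linarith [Real.pi_gt_three]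
      simp [abs_of_pos Real.pi_pos]
      nlinarith [abs_nonneg (η l : ℝ)]
    gcongr
  calc ∑ η ∈ E, (1 + ∑ l, |(η l : ℝ)| ^ (2 * k)) * ‖fc g η‖ ^ 2
      = ∑ η ∈ E, ‖fc g η‖ ^ 2 + ∑ l, ∑ η ∈ E, |(η l : ℝ)| ^ (2 * k) * ‖fc g η‖ ^ 2 := by
        rw [Finset.sum_comm, ← Finset.sum_add_distrib]
        simp_rw [add_mul, one_mul, Finset.sum_mul]
    _ ≤ M ^ 2 + ∑ _l : Fin n, M ^ 2 :=
        add_le_add (bessel g hg h0) (Finset.sum_le_sum fun l _ => hl l)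
    _ = (1 + n) * M ^ 2 := by simp; ring

lemma summable_fc (hn : n ≠ 0) (hk : n < 2 * k) {g : (Fin n → ℝ) → ℂ}
    (hg : ContDiff ℝ (⊤ : ℕ∞) g) (hper : Per g) {M : ℝ} (h0 : ∀ x, ‖g x‖ ≤ M)
    (hM : ∀ l x, ‖(pd l)^[k] g x‖ ≤ M) : Summable (fc g) := by
  have h1 : Summable fun η : Fin n → ℤ => (1 + ∑ l, |(η l : ℝ)| ^ (2 * k)) * ‖fc g η‖ ^ 2 :=
    summable_of_sum_le (fun η => by positivity) (sum_weight_mul_norm_sq_fc_le hg hper h0 hM)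
  refine Summable.of_norm_bounded ((summable_inv_one_add_sum_pow hn hk).add h1) fun η => ?_
  have hw : 0 < 1 + ∑ l, |(η l : ℝ)| ^ (2 * k) := by positivity
  set w := 1 + ∑ l, |(η l : ℝ)| ^ (2 * k)
  have h2 : w⁻¹ + w * ‖fc g η‖ ^ 2 - 2 * ‖fc g η‖ = w⁻¹ * (1 - w * ‖fc g η‖) ^ 2 := by
    field_simp; ring
  have h3 : 0 ≤ w⁻¹ * (1 - w * ‖fc g η‖) ^ 2 := by positivity
  linarith [norm_nonneg (fc g η)]

lemma Op_eq_sum {σ : (Fin n → ℝ) → (Fin n → ℤ) → ℂ} {F : Finset (Fin n → ℤ)}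
    (hF : ∀ x, ∀ ξ ∉ F, σ x ξ = 0) (f : (Fin n → ℝ) → ℂ) (x : Fin n → ℝ) :
    Op σ f x = ∑ ξ ∈ F, eChar x ξ * σ x ξ * fc f ξ :=
  tsum_eq_sum fun ξ hξ => by simp [hF x ξ hξ]

theorem exists_lintegral_Op_sq_le (hn : n ≠ 0) (hk : n < 2 * k) :
    ∃ D : ℝ≥0∞, D ≠ ∞ ∧ ∀ (σ : (Fin n → ℝ) → (Fin n → ℤ) → ℂ) (F : Finset (Fin n → ℤ)) (M : ℝ),
      (∀ ξ, ContDiff ℝ (⊤ : ℕ∞) fun x => σ x ξ) → (∀ ξ, Per fun x => σ x ξ) →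
      (∀ x, ∀ ξ ∉ F, σ x ξ = 0) → (∀ x ξ, ‖σ x ξ‖ ≤ M) →
      (∀ l ξ x, ‖(pd l)^[k] (fun y => σ y ξ) x‖ ≤ M) →
      ∀ (f : (Fin n → ℝ) → ℂ) (K : ℝ), AEStronglyMeasurable f (μT n) →
        (∀ᵐ x ∂(μT n), ‖f x‖ ≤ K) →
        ∫⁻ x, ‖Op σ f x‖ₑ ^ 2 ∂(μT n) ≤
          D * ENNReal.ofReal (M ^ 2) * ∫⁻ x, ‖f x‖ₑ ^ 2 ∂(μT n) := by
  let w : (Fin n → ℤ) → ℝ := fun η => 1 + ∑ l, |(η l : ℝ)| ^ (2 * k)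
  have hw : ∀ η, 0 < w η := fun η => by positivity
  refine ⟨(∑' η, ENNReal.ofReal (w η)⁻¹) * ENNReal.ofReal (1 + n),
    ENNReal.mul_ne_top (summable_inv_one_add_sum_pow hn hk).tsum_ofReal_ne_top
      ENNReal.ofReal_ne_top, ?_⟩
  intro σ F M hsm hper hF h0 hM f K hf hK
  let b : (Fin n → ℤ) → (Fin n → ℤ) → ℂ := fun ξ η => fc (fun x => σ x ξ) η
  let G : (Fin n → ℤ) → (Fin n → ℝ) → ℂ := fun η x => ∑ ξ ∈ F, b ξ η * fc f ξ * eChar x ξ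
  have hG : ∀ η, ∫⁻ x, ‖G η x‖ₑ ^ 2 ∂(μT n) = ∑ ξ ∈ F, ‖b ξ η‖ₑ ^ 2 * ‖fc f ξ‖ₑ ^ 2 := by
    intro η
    rw [lintegral_enorm_sq_trigPoly]
    simp_rw [enorm_mul, mul_pow]
  have hsum : ∀ x, HasSum (fun η => eChar x η * G η x) (Op σ f x) := by
    intro x
    rw [Op_eq_sum hF]
    have : ∀ η, eChar x η * G η x = ∑ ξ ∈ F, eChar x ξ * (eChar x η * b ξ η) * fc f ξ := by
      intro η
      simp only [G, Finset.mul_sum]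
      exact Finset.sum_congr rfl fun ξ _ => by ring
    simp_rw [this]
    refine hasSum_sum fun ξ _ => ?_
    exact ((hasSum_fc (hsm ξ).continuous (hper ξ) (summable_fc hn hk (hsm ξ) (hper ξ)
      (fun x => h0 x ξ) fun l x => hM l ξ x) x).mul_left _).mul_right _
  have hpt : ∀ x, ‖Op σ f x‖ₑ ^ 2 ≤
      (∑' η, ENNReal.ofReal (w η)⁻¹) * ∑' η, ENNReal.ofReal (w η) * ‖G η x‖ₑ ^ 2 := by
    intro x
    refine le_trans (pow_le_pow_left' ?_ 2) (ENNReal.sq_tsum_le hw _)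
    rw [← (hsum x).tsum_eq]
    refine enorm_tsum_le_tsum_enorm.trans (le_of_eq (tsum_congr fun η => ?_))
    rw [enorm_mul, ← ofReal_norm (eChar x η), norm_eChar]; simp
  have hb : ∀ ξ, ∑' η, ENNReal.ofReal (w η) * ‖b ξ η‖ₑ ^ 2 ≤
      ENNReal.ofReal (1 + n) * ENNReal.ofReal (M ^ 2) := by
    intro ξ
    have h1 : ∀ η, ENNReal.ofReal (w η) * ‖b ξ η‖ₑ ^ 2 =
        ENNReal.ofReal (w η * ‖b ξ η‖ ^ 2) := fun η => by
      rw [ENNReal.ofReal_mul (hw η).le, ENNReal.ofReal_pow (norm_nonneg _), ofReal_norm]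
    simp_rw [h1]
    rw [← ENNReal.ofReal_mul (by positivity), ENNReal.tsum_eq_iSup_sum]
    refine iSup_le fun E => ?_
    rw [← ENNReal.ofReal_sum_of_nonneg fun η _ => mul_nonneg (hw η).le (by positivity)]
    exact ENNReal.ofReal_le_ofReal (sum_weight_mul_norm_sq_fc_le (hsm ξ) (hper ξ)
      (fun x => h0 x ξ) (fun l x => hM l ξ x) E)
  have hGc : ∀ η, Continuous (G η) := fun η => by fun_prop
  calc ∫⁻ x, ‖Op σ f x‖ₑ ^ 2 ∂(μT n)
      ≤ ∫⁻ x, (∑' η, ENNReal.ofReal (w η)⁻¹) *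
          ∑' η, ENNReal.ofReal (w η) * ‖G η x‖ₑ ^ 2 ∂(μT n) := lintegral_mono hpt
    _ = (∑' η, ENNReal.ofReal (w η)⁻¹) *
          ∑' η, ENNReal.ofReal (w η) * ∑ ξ ∈ F, ‖b ξ η‖ₑ ^ 2 * ‖fc f ξ‖ₑ ^ 2 := by
        have hm : ∀ η, Measurable fun x => ‖G η x‖ₑ ^ 2 := fun η =>
          (hGc η).measurable.enorm.pow_const 2
        rw [lintegral_const_mul _ (Measurable.tsum fun η => (hm η).const_mul _),
          lintegral_tsum fun η => ((hm η).const_mul _).aemeasurable]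
        simp_rw [lintegral_const_mul _ (hm _), hG]
    _ = (∑' η, ENNReal.ofReal (w η)⁻¹) *
          ∑ ξ ∈ F, (∑' η, ENNReal.ofReal (w η) * ‖b ξ η‖ₑ ^ 2) * ‖fc f ξ‖ₑ ^ 2 := by
        congr 1
        simp_rw [Finset.mul_sum, ← ENNReal.tsum_mul_right, ← mul_assoc]
        rw [← Summable.tsum_finsetSum fun _ _ => ENNReal.summable]
    _ ≤ (∑' η, ENNReal.ofReal (w η)⁻¹) *
          ∑ ξ ∈ F, (ENNReal.ofReal (1 + n) * ENNReal.ofReal (M ^ 2)) * ‖fc f ξ‖ₑ ^ 2 := by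
        gcongr with ξ _; exact hb ξ
    _ ≤ _ := by
        rw [← Finset.mul_sum, ← mul_assoc, ← mul_assoc]
        refine mul_le_mul_right (α := ℝ≥0∞) ?_ _
        exact sum_enorm_sq_fc_le F hf hK

end Sobolev

lemma integrable_max_one_four_mul_abs_rpow {q : ℝ} (hq : 1 < q) :
    Integrable fun s : ℝ => (max 1 (4 * |s|)) ^ (-q) := by
  have h1 : Integrable (fun s : ℝ => (1 + ‖s‖) ^ (-q)) volume :=
    integrable_one_add_norm (by simpa using hq)
  have hc : Continuous fun s : ℝ => (max 1 (4 * |s|)) ^ (-q) :=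
    (by fun_prop : Continuous fun s : ℝ => max 1 (4 * |s|)).rpow_const
      fun s => Or.inl (by positivity)
  refine (h1.const_mul ((2 : ℝ) ^ q)).mono' hc.aestronglyMeasurable
    (Filter.Eventually.of_forall fun s => ?_)
  rw [Real.norm_of_nonneg (by positivity), Real.rpow_neg (by positivity),
    Real.rpow_neg (by positivity), ← div_eq_mul_inv, ← inv_div, ← Real.div_rpow (by positivity)
    (by positivity)]
  refine inv_anti₀ (by positivity) (Real.rpow_le_rpow (by positivity) ?_ (by linarith))
  rw [Real.norm_eq_abs]
  have h2 := le_max_left 1 (4 * |s|)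
  have h3 := le_max_right 1 (4 * |s|)
  have := abs_nonneg s
  linarith

lemma four_mul_abs_le_norm_exp_sub_one {s : ℝ} (hs : |s| ≤ 1 / 2) :
    4 * |s| ≤ ‖Complex.exp (Complex.I * ((2 * π * s : ℝ) : ℂ)) - 1‖ := by
  rw [Complex.norm_exp_I_mul_ofReal_sub_one, norm_mul, Real.norm_eq_abs, Real.norm_eq_abs,
    show 2 * π * s / 2 = π * s by ring]
  have hp := Real.pi_pos
  have h := Real.mul_abs_le_abs_sin (x := π * s) (by rw [abs_mul, abs_of_pos hp]; nlinarith)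
  rw [abs_mul, abs_of_pos hp, ← mul_assoc, div_mul_cancel₀ _ hp.ne'] at h
  rw [abs_of_pos (two_pos : (0 : ℝ) < 2)]
  linarith

lemma setIntegral_max_one_mul_norm_exp_sub_one_le {q : ℝ} (hq : 1 < q) {R : ℝ} (hR : 0 < R)
    (x : ℝ) :
    ∫ t in Set.Ico (0 : ℝ) 1,
        (max 1 (R * ‖Complex.exp (Complex.I * ((2 * π * (x - t) : ℝ) : ℂ)) - 1‖)) ^ (-q) ≤
      (∫ s : ℝ, (max 1 (4 * |s|)) ^ (-q)) * R⁻¹ := by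
  set h : ℝ → ℝ := fun s =>
    (max 1 (R * ‖Complex.exp (Complex.I * ((2 * π * s : ℝ) : ℂ)) - 1‖)) ^ (-q) with hh
  have hper : Function.Periodic h 1 := by
    intro s
    simp only [hh]
    congr 5
    rw [Complex.exp_eq_exp_iff_exists_int]
    exact ⟨1, by push_cast; ring⟩
  have hc : Continuous h :=
    (by fun_prop : Continuous fun s : ℝ =>
      max 1 (R * ‖Complex.exp (Complex.I * ((2 * π * s : ℝ) : ℂ)) - 1‖)).rpow_const
      fun s => Or.inl (by positivity)
  have hi := integrable_max_one_four_mul_abs_rpow hq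
  have hi2 : Integrable fun s : ℝ => (max 1 (4 * |R * s|)) ^ (-q) :=
    hi.comp_mul_left' hR.ne'
  calc ∫ t in Set.Ico (0 : ℝ) 1, h (x - t)
      = ∫ t in (0 : ℝ)..1, h (x - t) := by
        rw [integral_Ico_eq_integral_Ioc, intervalIntegral.integral_of_le zero_le_one]
    _ = ∫ s in (-(1 / 2) : ℝ)..(-(1 / 2) + 1), h s := by
        rw [intervalIntegral.integral_comp_sub_left, ← hper.intervalIntegral_add_eq (x - 1)]
        congr 1; ring
    _ ≤ ∫ s in (-(1 / 2) : ℝ)..(-(1 / 2) + 1), (max 1 (4 * |R * s|)) ^ (-q) := by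
        refine intervalIntegral.integral_mono_on (by norm_num) (hc.intervalIntegrable _ _)
          hi2.intervalIntegrable fun s hs => ?_
        have hs2 : |s| ≤ 1 / 2 := abs_le.2 ⟨hs.1, by linarith [hs.2]⟩
        refine Real.rpow_le_rpow_of_nonpos (by positivity) (max_le_max le_rfl ?_) (by linarith)
        rw [abs_mul, abs_of_pos hR]
        have := four_mul_abs_le_norm_exp_sub_one hs2
        nlinarith
    _ ≤ ∫ s : ℝ, (max 1 (4 * |R * s|)) ^ (-q) := by
        rw [intervalIntegral.integral_of_le (by norm_num)]
        exact setIntegral_le_integral hi2 (Filter.Eventually.of_forall fun s => by positivity)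
    _ = _ := by
        rw [Measure.integral_comp_mul_left (fun s : ℝ => (max 1 (4 * |s|)) ^ (-q)),
          abs_of_pos (inv_pos.2 hR), smul_eq_mul, mul_comm]

section Kernel

variable {n k : ℕ}

lemma eChar_neg_single (z : Fin n → ℝ) (l : Fin n) :
    eChar z (-Pi.single l 1) = Complex.exp (Complex.I * ((2 * π * (-z l) : ℝ) : ℂ)) := by
  have : ∑ j, z j * (((-Pi.single l 1 : Fin n → ℤ) j : ℤ) : ℝ) = -z l := by
    rw [Finset.sum_eq_single l (fun j _ hj => by simp [hj]) (by simp)]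
    simp
  rw [eChar_eq_exp_real, this]
  congr 1
  push_cast; ring

lemma exists_integral_inv_weight_le (hn : n ≠ 0) (hk : n < 2 * k) :
    ∃ D : ℝ, 0 ≤ D ∧ ∀ (R : ℝ), 0 < R → ∀ x : Fin n → ℝ,
      ∫ y, (1 + ∑ l, (R * ‖eChar (y - x) (-Pi.single l 1) - 1‖) ^ (2 * k))⁻¹ ∂(μT n) ≤
        D * (R ^ n)⁻¹ := by
  have hq : 1 < (2 * k / n : ℝ) := by
    rw [one_lt_div (by positivity)]; exact_mod_cast hk
  refine ⟨(∫ s : ℝ, (max 1 (4 * |s|)) ^ (-(2 * k / n : ℝ))) ^ n,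
    pow_nonneg (integral_nonneg fun s => by positivity) _, fun R hR x => ?_⟩
  have hc : Continuous fun y : Fin n → ℝ =>
      (1 + ∑ l, (R * ‖eChar (y - x) (-Pi.single l 1) - 1‖) ^ (2 * k))⁻¹ := by
    have : ∀ ξ : Fin n → ℤ, Continuous fun y : Fin n → ℝ => eChar (y - x) ξ := fun ξ =>
      (continuous_eChar ξ).comp (by fun_prop)
    exact Continuous.inv₀ (by fun_prop) fun y => by positivity
  have hc2 : Continuous fun y : Fin n → ℝ =>
      ∏ l, (max 1 (R * ‖eChar (y - x) (-Pi.single l 1) - 1‖)) ^ (-(2 * k / n : ℝ)) := by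
    have : ∀ ξ : Fin n → ℤ, Continuous fun y : Fin n → ℝ => eChar (y - x) ξ := fun ξ =>
      (continuous_eChar ξ).comp (by fun_prop)
    exact continuous_finsetProd _ fun l _ =>
      Continuous.rpow_const (by fun_prop) fun s => Or.inl (by positivity)
  refine (integral_mono hc.integrable_μT hc2.integrable_μT fun y =>
    inv_one_add_sum_pow_le_prod hn fun l => by positivity).trans ?_
  have : ∀ y : Fin n → ℝ, ∀ l, eChar (y - x) (-Pi.single l 1) =
      Complex.exp (Complex.I * ((2 * π * (x l - y l) : ℝ) : ℂ)) := fun y l => by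
    rw [eChar_neg_single]; simp
  simp_rw [this]
  rw [μT_eq_pi, integral_fintype_prod_eq_prod (fun (l : Fin n) (t : ℝ) =>
    (max 1 (R * ‖Complex.exp (Complex.I * ((2 * π * (x l - t) : ℝ) : ℂ)) - 1‖)) ^
      (-(2 * k / n : ℝ)))]
  calc _ ≤ ∏ _l : Fin n, (∫ s : ℝ, (max 1 (4 * |s|)) ^ (-(2 * k / n : ℝ))) * R⁻¹ :=
        Finset.prod_le_prod (fun l _ => integral_nonneg fun t => by positivity) fun l _ =>
          setIntegral_max_one_mul_norm_exp_sub_one_le hq hR (x l)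
    _ = _ := by simp [mul_pow]

lemma tsum_dd_mul_eChar {u : (Fin n → ℤ) → ℂ} (hu : u.HasFiniteSupport) (l : Fin n)
    (z : Fin n → ℝ) :
    ∑' ξ, dd l u ξ * eChar z ξ = (eChar z (-Pi.single l 1) - 1) * ∑' ξ, u ξ * eChar z ξ := by
  have hs : Summable fun ξ => u ξ * eChar z ξ :=
    summable_of_hasFiniteSupport (hu.subset fun ξ h h0 => h (by simp [h0]))
  set e := Equiv.addRight (Pi.single l (1 : ℤ) : Fin n → ℤ) with he
  have hs2 : Summable fun ξ => u (e ξ) * eChar z (e ξ) :=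
    hs.comp_injective e.injective
  have h2 : ∑' ξ, u (e ξ) * eChar z (e ξ) = ∑' ξ, u ξ * eChar z ξ :=
    e.tsum_eq fun ξ => u ξ * eChar z ξ
  have h1 : ∀ ξ, dd l u ξ * eChar z ξ = eChar z (-Pi.single l 1) *
      (u (e ξ) * eChar z (e ξ)) - u ξ * eChar z ξ := by
    intro ξ
    have h3 : eChar z ξ = eChar z (-Pi.single l 1) * eChar z (e ξ) := by
      rw [← eChar_add, he, Equiv.coe_addRight]; congr 1; simp [add_comm ξ]
    have h4 : dd l u ξ = u (e ξ) - u ξ := rfl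
    rw [h4, sub_mul]
    nth_rewrite 1 [h3]
    ring
  rw [tsum_congr h1, (hs2.mul_left _).tsum_sub hs, tsum_mul_left, h2]
  ring

lemma hasFiniteSupport_dd {u : (Fin n → ℤ) → ℂ} (hu : u.HasFiniteSupport) (l : Fin n) :
    (dd l u).HasFiniteSupport := by
  have h1 : (Function.support fun ξ => u (ξ + Pi.single l 1)).Finite :=
    Set.Finite.preimage (f := fun ξ : Fin n → ℤ => ξ + Pi.single l 1)
      (fun ξ _ η _ h => add_right_cancel h) hu
  refine (h1.union hu).subset fun ξ h => ?_
  by_contra h2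
  rw [Set.mem_union, not_or, Function.notMem_support, Function.notMem_support] at h2
  exact h (by simp [dd, h2.1, h2.2])

lemma tsum_iterate_dd_mul_eChar (l : Fin n) (i : ℕ) {u : (Fin n → ℤ) → ℂ}
    (hu : u.HasFiniteSupport) (z : Fin n → ℝ) :
    ∑' ξ, (dd l)^[i] u ξ * eChar z ξ =
      (eChar z (-Pi.single l 1) - 1) ^ i * ∑' ξ, u ξ * eChar z ξ := by
  induction i generalizing u with
  | zero => simp
  | succ i ih =>
    rw [Function.iterate_succ_apply, ih (hasFiniteSupport_dd hu l), tsum_dd_mul_eChar hu]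
    ring

lemma integral_norm_sq_trigPoly_sub_left (F : Finset (Fin n → ℤ)) (c : (Fin n → ℤ) → ℂ)
    (x : Fin n → ℝ) :
    ∫ y, ‖∑ ξ ∈ F, c ξ * eChar (y - x) ξ‖ ^ 2 ∂(μT n) = ∑ ξ ∈ F, ‖c ξ‖ ^ 2 := by
  have h := integral_norm_sq_trigPoly F fun ξ => c ξ * eChar x (-ξ)
  simp only [norm_mul, norm_eChar, mul_one] at h
  rw [← h]
  simp_rw [eChar_sub_left]
  refine integral_congr_ae (Filter.Eventually.of_forall fun y => ?_)
  simp only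
  congr 2
  exact Finset.sum_congr rfl fun ξ _ => by ring

theorem exists_integral_norm_kernel_le (hn : n ≠ 0) (hk : n < 2 * k) :
    ∃ D : ℝ, 0 ≤ D ∧ ∀ (R S : ℝ), 0 < R → ∀ (F : Finset (Fin n → ℤ)) (u : (Fin n → ℤ) → ℂ),
      (∀ ξ ∉ F, u ξ = 0) → (∀ l, ∀ ξ ∉ F, (dd l)^[k] u ξ = 0) →
      ∑ ξ ∈ F, ‖u ξ‖ ^ 2 ≤ S * R ^ n →
      (∀ l, R ^ (2 * k) * ∑ ξ ∈ F, ‖(dd l)^[k] u ξ‖ ^ 2 ≤ S * R ^ n) →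
      ∀ x : Fin n → ℝ, ∫ y, ‖∑ ξ ∈ F, u ξ * eChar (y - x) ξ‖ ∂(μT n) ≤ D + (1 + n) * S := by
  obtain ⟨D, hD0, hD⟩ := exists_integral_inv_weight_le hn hk
  refine ⟨D, hD0, fun R S hR F u hu hdu hS hdS x => ?_⟩
  have hfin : u.HasFiniteSupport := F.finite_toSet.subset fun ξ h => by
    by_contra h2; exact h (hu ξ h2)
  set P : (Fin n → ℝ) → ℂ := fun y => ∑ ξ ∈ F, u ξ * eChar (y - x) ξ with hP
  set w : (Fin n → ℝ) → ℝ := fun y =>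
    1 + ∑ l, (R * ‖eChar (y - x) (-Pi.single l 1) - 1‖) ^ (2 * k) with hw
  have hw0 : ∀ y, 0 < w y := fun y => by positivity
  have hce : ∀ ξ : Fin n → ℤ, Continuous fun y : Fin n → ℝ => eChar (y - x) ξ := fun ξ =>
    (continuous_eChar ξ).comp (by fun_prop)
  have hPc : Continuous P := by fun_prop
  have hwc : Continuous w := by fun_prop
  have hdd : ∀ l y, (eChar (y - x) (-Pi.single l 1) - 1) ^ k * P y =
      ∑ ξ ∈ F, (dd l)^[k] u ξ * eChar (y - x) ξ := by
    intro l y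
    have h1 : P y = ∑' ξ, u ξ * eChar (y - x) ξ :=
      (tsum_eq_sum fun ξ hξ => by simp [hu ξ hξ]).symm
    have h2 : ∑' ξ, (dd l)^[k] u ξ * eChar (y - x) ξ =
        ∑ ξ ∈ F, (dd l)^[k] u ξ * eChar (y - x) ξ :=
      tsum_eq_sum fun ξ hξ => by simp [hdu l ξ hξ]
    rw [h1, ← tsum_iterate_dd_mul_eChar l k hfin, h2]
  have hwP : ∀ y, w y * ‖P y‖ ^ 2 = ‖P y‖ ^ 2 +
      ∑ l, R ^ (2 * k) * ‖∑ ξ ∈ F, (dd l)^[k] u ξ * eChar (y - x) ξ‖ ^ 2 := by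
    intro y
    simp_rw [← hdd, hw, add_mul, one_mul, Finset.sum_mul, norm_mul, norm_pow]
    congr 1
    exact Finset.sum_congr rfl fun l _ => by ring
  have hintegral : ∫ y, w y * ‖P y‖ ^ 2 ∂(μT n) ≤ (1 + n) * S * R ^ n := by
    simp_rw [hwP]
    rw [integral_add (by fun_prop : Continuous _).integrable_μT
      (by fun_prop : Continuous _).integrable_μT,
      integral_finsetSum _ fun l _ => (by fun_prop : Continuous _).integrable_μT]
    simp_rw [integral_const_mul, hP, integral_norm_sq_trigPoly_sub_left]
    calc _ ≤ S * R ^ n + ∑ _l : Fin n, S * R ^ n :=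
          add_le_add hS (Finset.sum_le_sum fun l _ => hdS l)
      _ = _ := by simp; ring
  have hRn : 0 < R ^ n := by positivity
  have hwi : Continuous fun y => (w y)⁻¹ := hwc.inv₀ fun y => (hw0 y).ne'
  have hamgm : ∀ y, ‖P y‖ ≤ R ^ n * (w y)⁻¹ + (R ^ n)⁻¹ * (w y * ‖P y‖ ^ 2) := by
    intro y
    have h1 : R ^ n * (w y)⁻¹ + (R ^ n)⁻¹ * (w y * ‖P y‖ ^ 2) - 2 * ‖P y‖ =
        (R ^ n)⁻¹ * (w y)⁻¹ * (R ^ n - w y * ‖P y‖) ^ 2 := by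
      have := (hw0 y).ne'
      field_simp
      ring
    have h2 : 0 ≤ (R ^ n)⁻¹ * (w y)⁻¹ * (R ^ n - w y * ‖P y‖) ^ 2 := by
      have := hw0 y
      positivity
    linarith [norm_nonneg (P y)]
  calc ∫ y, ‖P y‖ ∂(μT n)
      ≤ ∫ y, (R ^ n * (w y)⁻¹ + (R ^ n)⁻¹ * (w y * ‖P y‖ ^ 2)) ∂(μT n) :=
        integral_mono (by fun_prop : Continuous _).integrable_μT
          (by fun_prop : Continuous _).integrable_μT hamgm
    _ = R ^ n * ∫ y, (w y)⁻¹ ∂(μT n) + (R ^ n)⁻¹ * ∫ y, w y * ‖P y‖ ^ 2 ∂(μT n) := by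
        rw [integral_add (by fun_prop : Continuous _).integrable_μT
          (by fun_prop : Continuous _).integrable_μT, integral_const_mul, integral_const_mul]
    _ ≤ R ^ n * (D * (R ^ n)⁻¹) + (R ^ n)⁻¹ * ((1 + n) * S * R ^ n) := by
        gcongr
        exact hD R hR x
    _ = _ := by field_simp

lemma norm_Op_le_of_integral_kernel_le {σ : (Fin n → ℝ) → (Fin n → ℤ) → ℂ}
    {F : Finset (Fin n → ℤ)} (hF : ∀ x, ∀ ξ ∉ F, σ x ξ = 0) {A : ℝ} {x : Fin n → ℝ}
    (hA : ∫ y, ‖∑ ξ ∈ F, (starRingEnd ℂ) (σ x ξ) * eChar (y - x) ξ‖ ∂(μT n) ≤ A)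
    {g : (Fin n → ℝ) → ℂ} (hg : AEStronglyMeasurable g (μT n)) {M : ℝ} (hM0 : 0 ≤ M)
    (hM : ∀ᵐ y ∂(μT n), ‖g y‖ ≤ M) : ‖Op σ g x‖ ≤ A * M := by
  have hgi : Integrable g (μT n) := Integrable.of_bound hg M hM
  have hce : ∀ ξ : Fin n → ℤ, Continuous fun y : Fin n → ℝ => eChar (y - x) ξ := fun ξ =>
    (continuous_eChar ξ).comp (by fun_prop)
  have hconj : ∀ y, (starRingEnd ℂ) (∑ ξ ∈ F, (starRingEnd ℂ) (σ x ξ) * eChar (y - x) ξ) * g y =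
      ∑ ξ ∈ F, eChar x ξ * σ x ξ * (eChar y (-ξ) * g y) := by
    intro y
    rw [map_sum, Finset.sum_mul]
    refine Finset.sum_congr rfl fun ξ _ => ?_
    rw [map_mul, Complex.conj_conj, ← eChar_neg, ← eChar_neg_left, neg_sub, eChar_sub_left]
    ring
  have hOp : Op σ g x = ∫ y, (starRingEnd ℂ)
      (∑ ξ ∈ F, (starRingEnd ℂ) (σ x ξ) * eChar (y - x) ξ) * g y ∂(μT n) := by
    simp_rw [hconj]
    rw [Op_eq_sum hF, integral_finsetSum _ fun ξ _ => (hgi.bdd_mul (c := 1)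
      (continuous_eChar (-ξ)).aestronglyMeasurable (by simp)).const_mul _]
    simp_rw [integral_const_mul, fc_eq]
  rw [hOp]
  calc _ ≤ ∫ y, ‖∑ ξ ∈ F, (starRingEnd ℂ) (σ x ξ) * eChar (y - x) ξ‖ * M ∂(μT n) := by
        refine norm_integral_le_of_norm_le (by fun_prop : Continuous _).integrable_μT ?_
        filter_upwards [hM] with y hy
        rw [norm_mul, Complex.norm_conj]
        gcongr
    _ ≤ A * M := by
        rw [integral_mul_const]
        gcongr

end Kernel

lemma lintegral_Ioi_indicator_rpow_le {r b : ℝ} (hr : 0 < r) (hb : 0 ≤ b) :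
    ∫⁻ s in Set.Ioi (0 : ℝ), (Set.Iio b).indicator (fun s => ENNReal.ofReal (s ^ (r - 1))) s =
      ENNReal.ofReal (b ^ r / r) := by
  rw [lintegral_indicator measurableSet_Iio, Measure.restrict_restrict measurableSet_Iio,
    Set.inter_comm, Set.Ioi_inter_Iio, ← setLIntegral_congr Ioo_ae_eq_Ioc.symm,
    ← ofReal_integral_eq_lintegral_ofReal, ← intervalIntegral.integral_of_le hb,
    integral_rpow (Or.inl (by linarith)), sub_add_cancel, Real.zero_rpow hr.ne', sub_zero]
  · exact (intervalIntegral.intervalIntegrable_rpow' (by linarith)).1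
  · filter_upwards [ae_restrict_mem measurableSet_Ioc] with s hs
    have := hs.1
    positivity

theorem lintegral_rpow_le_of_forall_splitting {α : Type*} [MeasurableSpace α] {μ : Measure α}
    [SFinite μ] {F f : α → ℝ} (hF0 : ∀ x, 0 ≤ F x) (hF : AEMeasurable F μ)
    (hf0 : ∀ x, 0 ≤ f x) (hf : Measurable f) {p A : ℝ} (hp : 2 < p) (hA : 0 < A) {B : ℝ≥0∞}
    (hsplit : ∀ t, 0 < t → ∃ h : α → ℝ≥0∞, AEMeasurable h μ ∧
      (∀ x, ENNReal.ofReal (F x) ≤ ENNReal.ofReal (A * t) + h x) ∧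
      ∫⁻ x, h x ^ 2 ∂μ ≤ B * ∫⁻ x in {x | t < f x}, ENNReal.ofReal (f x) ^ 2 ∂μ) :
    ∫⁻ x, ENNReal.ofReal (F x ^ p) ∂μ ≤
      ENNReal.ofReal (4 * p / (p - 2) * (2 * A) ^ (p - 2)) * B *
        ∫⁻ x, ENNReal.ofReal (f x ^ p) ∂μ := by
  have h2A : 0 < 2 * A := by linarith
  have hdist : ∀ s, 0 < s → μ {x | s < F x} * ENNReal.ofReal (s ^ (p - 1)) ≤
      ENNReal.ofReal 4 * B * ∫⁻ x, {x | s < 2 * A * f x}.indicator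
        (fun x => ENNReal.ofReal (s ^ (p - 2 - 1)) * ENNReal.ofReal (f x) ^ 2) x ∂μ := by
    intro s hs
    obtain ⟨h, hm, hle, hintegral⟩ := hsplit (s / (2 * A)) (by positivity)
    have hset : {x | s / (2 * A) < f x} = {x | s < 2 * A * f x} := by
      ext x; rw [Set.mem_ofPred_eq, Set.mem_ofPred_eq, div_lt_iff₀' h2A]
    have hAs : A * (s / (2 * A)) = s / 2 := by field_simp
    rw [hset] at hintegral
    simp_rw [hAs] at hle
    have hsub : {x | s < F x} ⊆ {x | ENNReal.ofReal (s / 2) ^ 2 ≤ h x ^ 2} := by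
      intro x hx
      refine pow_le_pow_left' (M := ℝ≥0∞) ?_ 2
      have h1 : ENNReal.ofReal (s / 2) + ENNReal.ofReal (s / 2) ≤
          ENNReal.ofReal (s / 2) + h x := by
        rw [← ENNReal.ofReal_add (by positivity) (by positivity), add_halves]
        exact (ENNReal.ofReal_le_ofReal (le_of_lt hx)).trans (hle x)
      exact (ENNReal.add_le_add_iff_left ENNReal.ofReal_ne_top).1 h1
    have hcheb : ENNReal.ofReal (s / 2) ^ 2 * μ {x | s < F x} ≤ ∫⁻ x, h x ^ 2 ∂μ :=
      (mul_le_mul_right (α := ℝ≥0∞) (measure_mono hsub) _).trans (mul_meas_ge_le_lintegral₀ (hm.pow_const 2) _)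
    have hs1 : ENNReal.ofReal (s ^ (p - 1)) =
        ENNReal.ofReal 4 * ENNReal.ofReal (s ^ (p - 2 - 1)) * ENNReal.ofReal (s / 2) ^ 2 := by
      rw [← ENNReal.ofReal_pow (by positivity), ← ENNReal.ofReal_mul (by positivity),
        ← ENNReal.ofReal_mul (by positivity)]
      congr 1
      rw [show p - 1 = p - 2 - 1 + (2 : ℕ) by push_cast; ring, Real.rpow_add_natCast hs.ne']
      ring
    have hms : MeasurableSet {x | s < 2 * A * f x} :=
      measurableSet_lt measurable_const (hf.const_mul _)
    rw [lintegral_indicator hms, lintegral_const_mul _ (hf.ennreal_ofReal.pow_const 2), hs1]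
    calc μ {x | s < F x} * (ENNReal.ofReal 4 * ENNReal.ofReal (s ^ (p - 2 - 1)) *
          ENNReal.ofReal (s / 2) ^ 2)
        = ENNReal.ofReal 4 * ENNReal.ofReal (s ^ (p - 2 - 1)) *
          (ENNReal.ofReal (s / 2) ^ 2 * μ {x | s < F x}) := by ring
      _ ≤ ENNReal.ofReal 4 * ENNReal.ofReal (s ^ (p - 2 - 1)) *
          (B * ∫⁻ x in {x | s < 2 * A * f x}, ENNReal.ofReal (f x) ^ 2 ∂μ) := by
          exact mul_le_mul_right (α := ℝ≥0∞) (hcheb.trans hintegral) _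
      _ = _ := by ring
  have hmeas : Measurable fun z : ℝ × α => {z : ℝ × α | z.1 < 2 * A * f z.2}.indicator
      (fun z => ENNReal.ofReal (z.1 ^ (p - 2 - 1)) * ENNReal.ofReal (f z.2) ^ 2) z := by
    refine Measurable.indicator (by fun_prop) ?_
    exact measurableSet_lt measurable_fst ((hf.comp measurable_snd).const_mul _)
  have hinner : ∀ x, ∫⁻ s in Set.Ioi (0 : ℝ), {z : ℝ × α | z.1 < 2 * A * f z.2}.indicator
      (fun z => ENNReal.ofReal (z.1 ^ (p - 2 - 1)) * ENNReal.ofReal (f z.2) ^ 2) (s, x) =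
      ENNReal.ofReal ((2 * A) ^ (p - 2) / (p - 2)) * ENNReal.ofReal (f x ^ p) := by
    intro x
    have h1 : ∀ s : ℝ, {z : ℝ × α | z.1 < 2 * A * f z.2}.indicator
        (fun z => ENNReal.ofReal (z.1 ^ (p - 2 - 1)) * ENNReal.ofReal (f z.2) ^ 2) (s, x) =
        (Set.Iio (2 * A * f x)).indicator (fun s => ENNReal.ofReal (s ^ (p - 2 - 1))) s *
          ENNReal.ofReal (f x) ^ 2 := by
      intro s
      by_cases hs : s < 2 * A * f x <;> simp [hs]
    simp_rw [h1]
    have hfx := hf0 x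
    have hp2 : 0 < p - 2 := by linarith
    rw [lintegral_mul_const _ (Measurable.indicator (by fun_prop) measurableSet_Iio),
      lintegral_Ioi_indicator_rpow_le hp2 (by positivity), ← ENNReal.ofReal_pow hfx,
      ← ENNReal.ofReal_mul (by positivity), ← ENNReal.ofReal_mul (by positivity)]
    congr 1
    rw [Real.mul_rpow (by positivity) hfx]
    have h2 : f x ^ p = f x ^ (p - 2) * f x ^ 2 := by
      rw [← Real.rpow_natCast, ← Real.rpow_add_of_nonneg hfx (by linarith) (by norm_num)]
      congr 1; push_cast; ring
    rw [h2]; ring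
  calc ∫⁻ x, ENNReal.ofReal (F x ^ p) ∂μ
      = ENNReal.ofReal p * ∫⁻ s in Set.Ioi (0 : ℝ), μ {x | s < F x} *
          ENNReal.ofReal (s ^ (p - 1)) :=
        lintegral_rpow_eq_lintegral_meas_lt_mul μ (Filter.Eventually.of_forall hF0) hF
          (by linarith)
    _ ≤ ENNReal.ofReal p * ∫⁻ s in Set.Ioi (0 : ℝ), ENNReal.ofReal 4 * B *
          ∫⁻ x, {z : ℝ × α | z.1 < 2 * A * f z.2}.indicator
            (fun z => ENNReal.ofReal (z.1 ^ (p - 2 - 1)) * ENNReal.ofReal (f z.2) ^ 2) (s, x) ∂μ := by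
        gcongr ENNReal.ofReal p * ?_
        exact setLIntegral_mono' measurableSet_Ioi fun s hs => hdist s hs
    _ = ENNReal.ofReal p * (ENNReal.ofReal 4 * B * ∫⁻ x,
          ENNReal.ofReal ((2 * A) ^ (p - 2) / (p - 2)) * ENNReal.ofReal (f x ^ p) ∂μ) := by
        rw [lintegral_const_mul _ hmeas.lintegral_prod_right', lintegral_lintegral_swap
          hmeas.aemeasurable]
        simp_rw [hinner]
    _ = _ := by
        have hp2 : 0 < p - 2 := by linarith
        rw [lintegral_const_mul _ (by fun_prop), show 4 * p / (p - 2) * (2 * A) ^ (p - 2) =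
          p * (4 * ((2 * A) ^ (p - 2) / (p - 2))) by ring, ENNReal.ofReal_mul (by linarith),
          ENNReal.ofReal_mul (by norm_num)]
        ring

section OpInterpolation

variable {n : ℕ}

lemma fc_add {f g : (Fin n → ℝ) → ℂ} (hf : Integrable f (μT n)) (hg : Integrable g (μT n))
    (ξ : Fin n → ℤ) : fc (f + g) ξ = fc f ξ + fc g ξ := by
  have hei : ∀ {h : (Fin n → ℝ) → ℂ}, Integrable h (μT n) →
      Integrable (fun x => eChar x (-ξ) * h x) (μT n) := fun hh =>
    hh.bdd_mul (c := 1) (continuous_eChar _).aestronglyMeasurable (by simp)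
  simp_rw [fc_eq, Pi.add_apply, mul_add]
  exact integral_add (hei hf) (hei hg)

lemma Op_add {σ : (Fin n → ℝ) → (Fin n → ℤ) → ℂ} {F : Finset (Fin n → ℤ)}
    (hF : ∀ x, ∀ ξ ∉ F, σ x ξ = 0) {f g : (Fin n → ℝ) → ℂ}
    (hf : Integrable f (μT n)) (hg : Integrable g (μT n)) (x : Fin n → ℝ) :
    Op σ (f + g) x = Op σ f x + Op σ g x := by
  simp_rw [Op_eq_sum hF, fc_add hf hg, mul_add, Finset.sum_add_distrib]

lemma continuous_Op {σ : (Fin n → ℝ) → (Fin n → ℤ) → ℂ} {F : Finset (Fin n → ℤ)}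
    (hF : ∀ x, ∀ ξ ∉ F, σ x ξ = 0) (hσ : ∀ ξ, Continuous fun x => σ x ξ)
    (f : (Fin n → ℝ) → ℂ) : Continuous (Op σ f) := by
  rw [show Op σ f = fun x => ∑ ξ ∈ F, eChar x ξ * σ x ξ * fc f ξ from funext (Op_eq_sum hF f)]
  fun_prop

theorem lintegral_Op_rpow_le {σ : (Fin n → ℝ) → (Fin n → ℤ) → ℂ} {F : Finset (Fin n → ℤ)}
    (hF : ∀ x, ∀ ξ ∉ F, σ x ξ = 0) (hσ : ∀ ξ, Continuous fun x => σ x ξ) {A : ℝ} (hA : 0 < A)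
    (hbdd : ∀ (g : (Fin n → ℝ) → ℂ) (M : ℝ), 0 ≤ M → AEStronglyMeasurable g (μT n) →
      (∀ᵐ y ∂(μT n), ‖g y‖ ≤ M) → ∀ x, ‖Op σ g x‖ ≤ A * M) {B : ℝ≥0∞}
    (hsq : ∀ (g : (Fin n → ℝ) → ℂ) (M : ℝ), AEStronglyMeasurable g (μT n) →
      (∀ᵐ y ∂(μT n), ‖g y‖ ≤ M) →
      ∫⁻ x, ‖Op σ g x‖ₑ ^ 2 ∂(μT n) ≤ B * ∫⁻ x, ‖g x‖ₑ ^ 2 ∂(μT n))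
    {p : ℝ} (hp : 2 < p) {f : (Fin n → ℝ) → ℂ} (hf : Continuous f) {M : ℝ}
    (hM : ∀ᵐ y ∂(μT n), ‖f y‖ ≤ M) :
    ∫⁻ x, ENNReal.ofReal (‖Op σ f x‖ ^ p) ∂(μT n) ≤
      ENNReal.ofReal (4 * p / (p - 2) * (2 * A) ^ (p - 2)) * B *
        ∫⁻ x, ENNReal.ofReal (‖f x‖ ^ p) ∂(μT n) := by
  refine lintegral_rpow_le_of_forall_splitting (fun x => norm_nonneg _)
    (continuous_Op hF hσ f).norm.measurable.aemeasurable (fun x => norm_nonneg _)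
    hf.norm.measurable hp hA fun t ht => ?_
  have hs : MeasurableSet {x | t < ‖f x‖} := measurableSet_lt measurable_const hf.norm.measurable
  set g₁ := {x | t < ‖f x‖}.indicator f
  set g₂ := {x | t < ‖f x‖}ᶜ.indicator f
  have hm₁ : AEStronglyMeasurable g₁ (μT n) := hf.aestronglyMeasurable.indicator hs
  have hm₂ : AEStronglyMeasurable g₂ (μT n) := hf.aestronglyMeasurable.indicator hs.compl
  have hb₁ : ∀ᵐ y ∂(μT n), ‖g₁ y‖ ≤ M := hM.mono fun y hy => (norm_indicator_le_norm_self _ _).trans hy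
  have hb₂ : ∀ y, ‖g₂ y‖ ≤ t := fun y => by
    by_cases hy : t < ‖f y‖
    · simp [g₂, hy, ht.le]
    · have h1 : g₂ y = f y := Set.indicator_of_mem hy f
      rw [h1]
      exact not_lt.1 hy
  have hsum : g₂ + g₁ = f := Set.indicator_compl_add_self _ f
  refine ⟨fun x => ‖Op σ g₁ x‖ₑ, (continuous_Op hF hσ g₁).measurable.enorm.aemeasurable,
    fun x => ?_, ?_⟩
  · simp only [← ofReal_norm]
    rw [← ENNReal.ofReal_add (by positivity) (norm_nonneg _)]
    refine ENNReal.ofReal_le_ofReal ?_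
    rw [← hsum, Op_add hF (Integrable.of_bound hm₂ t (Filter.Eventually.of_forall hb₂))
      (Integrable.of_bound hm₁ M hb₁)]
    exact (norm_add_le _ _).trans
      (add_le_add (hbdd g₂ t ht.le hm₂ (Filter.Eventually.of_forall hb₂) x) le_rfl)
  · refine (hsq g₁ M hm₁ hb₁).trans (le_of_eq ?_)
    rw [← lintegral_indicator hs]
    congr 2
    ext x
    by_cases hx : t < ‖f x‖ <;> simp [g₁, hx]

end OpInterpolation

section FiniteDifferences

variable {n : ℕ}

lemma iterate_dd_add (l : Fin n) (i : ℕ) (u v : (Fin n → ℤ) → ℂ) :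
    (dd l)^[i] (u + v) = (dd l)^[i] u + (dd l)^[i] v := by
  induction i generalizing u v with
  | zero => rfl
  | succ i ih =>
    have : dd l (u + v) = dd l u + dd l v := by
      ext ξ; simp only [dd, Pi.add_apply]; ring
    rw [Function.iterate_succ_apply, Function.iterate_succ_apply, Function.iterate_succ_apply,
      this, ih]

lemma iterate_dd_sub (l : Fin n) (i : ℕ) (u v : (Fin n → ℤ) → ℂ) :
    (dd l)^[i] (u - v) = (dd l)^[i] u - (dd l)^[i] v := by
  rw [eq_sub_iff_add_eq, ← iterate_dd_add, sub_add_cancel]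

lemma iterate_dd_conj (l : Fin n) (i : ℕ) (u : (Fin n → ℤ) → ℂ) (ξ : Fin n → ℤ) :
    (dd l)^[i] (fun η => (starRingEnd ℂ) (u η)) ξ = (starRingEnd ℂ) ((dd l)^[i] u ξ) := by
  induction i generalizing ξ with
  | zero => rfl
  | succ i ih => simp only [Function.iterate_succ_apply', dd, ih, map_sub]

lemma iterate_dd_comp_add (l : Fin n) (i : ℕ) (u : (Fin n → ℤ) → ℂ) (v ξ : Fin n → ℤ) :
    (dd l)^[i] (fun η => u (η + v)) ξ = (dd l)^[i] u (ξ + v) := by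
  induction i generalizing ξ with
  | zero => rfl
  | succ i ih => simp only [Function.iterate_succ_apply', dd, ih, add_right_comm]

lemma iterate_dd_eq_zero (l : Fin n) (i : ℕ) {u : (Fin n → ℤ) → ℂ} {ξ : Fin n → ℤ}
    (h : ∀ s ≤ i, u (ξ + s • Pi.single l 1) = 0) : (dd l)^[i] u ξ = 0 := by
  induction i generalizing ξ with
  | zero => simpa using h 0 le_rfl
  | succ i ih =>
    rw [Function.iterate_succ_apply', dd, ih fun s hs => ?_, ih fun s hs => h s (by omega),
      sub_zero]
    have := h (s + 1) (by omega)
    rwa [succ_nsmul', ← add_assoc] at this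

theorem norm_iterate_dd_mul_le (l : Fin n) (i : ℕ) {u v : (Fin n → ℤ) → ℂ} {ξ : Fin n → ℤ}
    {U V r : ℝ}
    (hu : ∀ s m, s + m ≤ i → ‖(dd l)^[m] u (ξ + s • Pi.single l 1)‖ ≤ U * r ^ m)
    (hv : ∀ s m, s + m ≤ i → ‖(dd l)^[m] v (ξ + s • Pi.single l 1)‖ ≤ V * r ^ m) :
    ‖(dd l)^[i] (u * v) ξ‖ ≤ 2 ^ i * (U * V) * r ^ i := by
  induction i generalizing u v U V with
  | zero =>
    have h1 := hu 0 0 le_rfl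
    have h2 := hv 0 0 le_rfl
    simp only [Function.iterate_zero, id, zero_smul, add_zero, pow_zero, mul_one, one_mul,
      Pi.mul_apply, norm_mul] at *
    exact mul_le_mul h1 h2 (norm_nonneg _) ((norm_nonneg _).trans h1)
  | succ i ih =>
    have hmul : dd l (u * v) = dd l u * (fun η => v (η + Pi.single l 1)) + u * dd l v := by
      ext η; simp only [dd, Pi.mul_apply, Pi.add_apply]; ring
    rw [Function.iterate_succ_apply, hmul, iterate_dd_add, Pi.add_apply]
    have h1 : ‖(dd l)^[i] (dd l u * fun η => v (η + Pi.single l 1)) ξ‖ ≤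
        2 ^ i * ((U * r) * V) * r ^ i := by
      refine ih (fun s m hsm => ?_) fun s m hsm => ?_
      · have := hu s (m + 1) (by omega)
        rwa [Function.iterate_succ_apply, pow_succ', ← mul_assoc] at this
      · have := hv (s + 1) m (by omega)
        rwa [succ_nsmul, ← add_assoc, ← iterate_dd_comp_add] at this
    have h2 : ‖(dd l)^[i] (u * dd l v) ξ‖ ≤ 2 ^ i * (U * (V * r)) * r ^ i := by
      refine ih (fun s m hsm => hu s m (by omega)) fun s m hsm => ?_
      have := hv s (m + 1) (by omega)
      rwa [Function.iterate_succ_apply, pow_succ', ← mul_assoc] at this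
    refine (norm_add_le_of_le h1 h2).trans (le_of_eq ?_)
    ring

end FiniteDifferences

lemma norm_iterate_fwdDiff_le {f : ℝ → ℂ} (hf : ContDiff ℝ (⊤ : ℕ∞) f) (i : ℕ) {C : ℝ}
    (hC : ∀ x, ‖iteratedDeriv i f x‖ ≤ C) (h x : ℝ) :
    ‖(fwdDiff h)^[i] f x‖ ≤ C * |h| ^ i := by
  induction i generalizing f C x with
  | zero => simpa using hC x
  | succ i ih =>
    have hf2 : ContDiff ℝ (⊤ : ℕ∞) fun y => f (y + h) := hf.comp (by fun_prop)
    have hfd : ContDiff ℝ (⊤ : ℕ∞) (fwdDiff h f) := hf2.sub hf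
    rw [Function.iterate_succ_apply, pow_succ', ← mul_assoc]
    refine ih hfd (fun y => ?_) x
    have h1 : iteratedDeriv i (fwdDiff h f) y = iteratedDeriv i f (y + h) - iteratedDeriv i f y := by
      have : fwdDiff h f = (fun y => f (y + h)) - f := rfl
      rw [this, iteratedDeriv_sub (hf2.of_le (mod_cast le_top)).contDiffAt
        (hf.of_le (mod_cast le_top)).contDiffAt, iteratedDeriv_comp_add_const]
    rw [h1]
    have hd : Differentiable ℝ (iteratedDeriv i f) :=
      hf.differentiable_iteratedDeriv i (mod_cast WithTop.coe_lt_top _)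
    have := Convex.norm_image_sub_le_of_norm_deriv_le (f := iteratedDeriv i f) (s := Set.univ)
      (fun z _ => hd z) (fun z _ => by rw [← iteratedDeriv_succ]; exact hC z) convex_univ
      (Set.mem_univ y) (Set.mem_univ (y + h))
    simpa using this

lemma exists_norm_iterate_fwdDiff_le {f : ℝ → ℂ} (hf : ContDiff ℝ (⊤ : ℕ∞) f)
    (hs : HasCompactSupport f) (k : ℕ) :
    ∃ C : ℝ, 0 ≤ C ∧ ∀ i ≤ k, ∀ h x, ‖(fwdDiff h)^[i] f x‖ ≤ C * |h| ^ i := by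
  have h1 : ∀ i : ℕ, ∃ C, ∀ x, ‖iteratedDeriv i f x‖ ≤ C := by
    intro i
    obtain ⟨C, hC⟩ := (hs.iteratedFDeriv (𝕜 := ℝ) i).exists_bound_of_continuous
      (hf.continuous_iteratedFDeriv (mod_cast le_top))
    exact ⟨C, fun x => by rw [← norm_iteratedFDeriv_eq_norm_iteratedDeriv]; exact hC x⟩
  choose C hC using h1
  have hC0 : ∀ i, 0 ≤ C i := fun i => (norm_nonneg _).trans (hC i 0)
  refine ⟨∑ i ∈ Finset.range (k + 1), C i, Finset.sum_nonneg fun i _ => hC0 i,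
    fun i hi h x => (norm_iterate_fwdDiff_le hf i (hC i) h x).trans ?_⟩
  gcongr
  exact Finset.single_le_sum (fun i _ => hC0 i) (Finset.mem_range.2 (by omega))

lemma exists_smooth_cutoff : ∃ ψ : ℝ → ℂ, ContDiff ℝ (⊤ : ℕ∞) ψ ∧ HasCompactSupport ψ ∧
    (∀ t, ‖ψ t‖ ≤ 1) ∧ (∀ t, |t| ≤ 1 → ψ t = 1) ∧ ∀ t, 2 ≤ |t| → ψ t = 0 := by
  let b : ContDiffBump (0 : ℝ) := ⟨1, 2, one_pos, one_lt_two⟩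
  refine ⟨fun t => (b t : ℂ), Complex.ofRealCLM.contDiff.comp b.contDiff,
    b.hasCompactSupport.comp_left (g := fun s : ℝ => (s : ℂ)) Complex.ofReal_zero, fun t => ?_,
    fun t ht => ?_, fun t ht => ?_⟩
  · rw [Complex.norm_real, Real.norm_of_nonneg b.nonneg]; exact b.le_one
  · simp only
    rw [b.one_of_mem_closedBall (by simpa [b] using ht), Complex.ofReal_one]
  · simp only
    rw [b.zero_of_le_dist (by simpa [b] using ht), Complex.ofReal_zero]

section Cutoff

variable {n : ℕ}

lemma iterate_dd_prod_mul (l : Fin n) (i : ℕ) (q : ℤ → ℂ) (g : ℝ → ℂ) (h : ℝ) (ξ : Fin n → ℤ) :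
    (dd l)^[i] (fun η => (∏ m ∈ Finset.univ.erase l, q (η m)) * g (η l * h)) ξ =
      (∏ m ∈ Finset.univ.erase l, q (ξ m)) * (fwdDiff h)^[i] g (ξ l * h) := by
  induction i generalizing ξ with
  | zero => rfl
  | succ i ih =>
    rw [Function.iterate_succ_apply', dd, ih, ih, Function.iterate_succ_apply', fwdDiff]
    have h1 : ∏ m ∈ Finset.univ.erase l, q ((ξ + Pi.single l 1 : Fin n → ℤ) m) =
        ∏ m ∈ Finset.univ.erase l, q (ξ m) :=
      Finset.prod_congr rfl fun m hm => by simp [Finset.ne_of_mem_erase hm]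
    have h2 : (((ξ + Pi.single l 1 : Fin n → ℤ) l : ℤ) : ℝ) * h = ξ l * h + h := by
      simp; ring
    rw [h1, h2]; ring

theorem exists_dyadic_partition (n k : ℕ) : ∃ (C : ℝ) (φ : ℕ → (Fin n → ℤ) → ℂ), 0 ≤ C ∧
    (∀ j l, ∀ i ≤ k, ∀ ξ, ‖(dd l)^[i] (φ j) ξ‖ ≤ C * ((2 ^ j : ℝ)⁻¹) ^ i) ∧
    (∀ j ξ, ‖φ j ξ‖ ≤ C) ∧
    (∀ j ξ, φ j ξ ≠ 0 → ∀ m, |(ξ m : ℝ)| ≤ 2 * 2 ^ j) ∧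
    (∀ j ξ, φ j ξ ≠ 0 → (2 : ℝ) ^ j ≤ 2 ∨ ∃ m, (2 : ℝ) ^ j / 2 ≤ |(ξ m : ℝ)|) ∧
    (∀ J ξ, ‖∑ j ∈ Finset.range (J + 1), φ j ξ‖ ≤ 1) ∧
    ∀ ξ, ∀ᶠ J in Filter.atTop, ∑ j ∈ Finset.range (J + 1), φ j ξ = 1 := by
  obtain ⟨ψ, hψ, hψs, hψ1, hψin, hψout⟩ := exists_smooth_cutoff
  obtain ⟨C, hC0, hC⟩ := exists_norm_iterate_fwdDiff_le hψ hψs k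
  let Φ : ℕ → (Fin n → ℤ) → ℂ := fun J ξ => ∏ m, ψ (ξ m * (2 ^ J : ℝ)⁻¹)
  have hΦ1 : ∀ J ξ, ‖Φ J ξ‖ ≤ 1 := fun J ξ => by
    rw [norm_prod]
    exact Finset.prod_le_one (fun m _ => norm_nonneg _) fun m _ => hψ1 _
  have habs : ∀ (J : ℕ) (t : ℤ), |(t : ℝ) * (2 ^ J : ℝ)⁻¹| = |(t : ℝ)| / 2 ^ J := fun J t => by
    rw [abs_mul, abs_of_pos (by positivity : (0 : ℝ) < (2 ^ J : ℝ)⁻¹), div_eq_mul_inv]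
  have hΦin : ∀ J ξ, (∀ m, |(ξ m : ℝ)| ≤ 2 ^ J) → Φ J ξ = 1 := fun J ξ h =>
    Finset.prod_eq_one fun m _ => hψin _ (by
      rw [habs, div_le_one (by positivity)]; exact h m)
  have hΦout : ∀ J ξ m, 2 * 2 ^ J ≤ |(ξ m : ℝ)| → Φ J ξ = 0 := fun J ξ m h =>
    Finset.prod_eq_zero (Finset.mem_univ m) (hψout _ (by
      rw [habs, le_div_iff₀ (by positivity)]; exact h))
  have hΦd : ∀ J l, ∀ i ≤ k, ∀ ξ, ‖(dd l)^[i] (Φ J) ξ‖ ≤ C * ((2 ^ J : ℝ)⁻¹) ^ i := by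
    intro J l i hi ξ
    have h1 : Φ J = fun η => (∏ m ∈ Finset.univ.erase l, (fun t : ℤ => ψ (t * (2 ^ J : ℝ)⁻¹)) (η m)) *
        ψ (η l * (2 ^ J : ℝ)⁻¹) := by
      ext η
      exact (Finset.prod_erase_mul _ _ (Finset.mem_univ l)).symm
    rw [h1, iterate_dd_prod_mul l i (fun t : ℤ => ψ (t * (2 ^ J : ℝ)⁻¹)) ψ, norm_mul, norm_prod]
    calc _ ≤ 1 * (C * |(2 ^ J : ℝ)⁻¹| ^ i) := by
          refine mul_le_mul ?_ (hC i hi _ _) (norm_nonneg _) zero_le_one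
          exact Finset.prod_le_one (fun m _ => norm_nonneg _) fun m _ => hψ1 _
      _ = _ := by rw [one_mul, abs_of_pos (by positivity)]
  let φ : ℕ → (Fin n → ℤ) → ℂ := fun j => Nat.casesOn j (Φ 0) fun j => Φ (j + 1) - Φ j
  have hsum : ∀ J ξ, ∑ j ∈ Finset.range (J + 1), φ j ξ = Φ J ξ := by
    intro J ξ
    induction J with
    | zero => simp [φ]
    | succ J ih => rw [Finset.sum_range_succ, ih]; simp [φ]
  refine ⟨C * (1 + 2 ^ k) + 2, φ, by positivity, ?_, ?_, ?_, ?_, ?_, ?_⟩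
  · intro j l i hi ξ
    have h2k : (0 : ℝ) ≤ C * 2 ^ k := by positivity
    cases j with
    | zero =>
      refine (hΦd 0 l i hi ξ).trans ?_
      gcongr
      nlinarith
    | succ j =>
      have h1 : (dd l)^[i] (φ (j + 1)) ξ = (dd l)^[i] (Φ (j + 1)) ξ - (dd l)^[i] (Φ j) ξ := by
        rw [show φ (j + 1) = Φ (j + 1) - Φ j from rfl, iterate_dd_sub, Pi.sub_apply]
      rw [h1]
      refine (norm_sub_le_of_le (hΦd (j + 1) l i hi ξ) (hΦd j l i hi ξ)).trans ?_
      have h2 : ((2 ^ j : ℝ)⁻¹) ^ i = 2 ^ i * ((2 ^ (j + 1) : ℝ)⁻¹) ^ i := by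
        rw [← mul_pow]; congr 1; rw [pow_succ]; field_simp
      have h3 : (2 : ℝ) ^ i ≤ 2 ^ k := pow_le_pow_right₀ one_le_two hi
      rw [h2, ← mul_assoc, ← add_mul]
      refine mul_le_mul_of_nonneg_right ?_ (by positivity)
      nlinarith
  · intro j ξ
    have : (0 : ℝ) ≤ C * (1 + 2 ^ k) := by positivity
    cases j with
    | zero => exact (hΦ1 0 ξ).trans (by linarith)
    | succ j => exact (norm_sub_le_of_le (hΦ1 (j + 1) ξ) (hΦ1 j ξ)).trans (by linarith)
  · intro j ξ hne m
    by_contra! hlt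
    cases j with
    | zero => exact hne (hΦout 0 ξ m hlt.le)
    | succ j =>
      refine hne ?_
      have : (2 : ℝ) * 2 ^ j ≤ 2 * 2 ^ (j + 1) := by rw [pow_succ]; linarith [pow_pos (two_pos : (0:ℝ) < 2) j]
      change Φ (j + 1) ξ - Φ j ξ = 0
      rw [hΦout (j + 1) ξ m hlt.le, hΦout j ξ m (this.trans hlt.le), sub_zero]
  · intro j ξ hne
    cases j with
    | zero => left; norm_num
    | succ j =>
      right
      by_contra! hlt
      refine hne ?_
      have h1 : ∀ m, |(ξ m : ℝ)| ≤ 2 ^ j := fun m => by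
        have := (hlt m).le
        rwa [pow_succ, mul_div_cancel_right₀ _ two_ne_zero] at this
      have h2 : ∀ m, |(ξ m : ℝ)| ≤ 2 ^ (j + 1) := fun m =>
        (h1 m).trans (pow_le_pow_right₀ one_le_two j.le_succ)
      change Φ (j + 1) ξ - Φ j ξ = 0
      rw [hΦin _ _ h1, hΦin _ _ h2, sub_self]
  · intro J ξ
    rw [hsum]; exact hΦ1 J ξ
  · intro ξ
    obtain ⟨J₀, hJ₀⟩ := pow_unbounded_of_one_lt (∑ m, |(ξ m : ℝ)|) (one_lt_two : (1 : ℝ) < 2)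
    filter_upwards [Filter.eventually_ge_atTop J₀] with J hJ
    rw [hsum]
    refine hΦin J ξ fun m => ?_
    calc |(ξ m : ℝ)| ≤ ∑ m, |(ξ m : ℝ)| :=
          Finset.single_le_sum (f := fun m => |(ξ m : ℝ)|) (fun _ _ => abs_nonneg _) (Finset.mem_univ m)
      _ ≤ 2 ^ J₀ := hJ₀.le
      _ ≤ 2 ^ J := pow_le_pow_right₀ one_le_two hJ

end Cutoff

section Symbols

variable {n k : ℕ}

lemma List.flatMap_replicate_single {ι : Type*} [DecidableEq ι] (l : ι) (i : ℕ) {L : List ι}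
    (hL : L.Nodup) (hl : l ∈ L) :
    L.flatMap (fun j => List.replicate ((Pi.single l i : ι → ℕ) j) j) = List.replicate i l := by
  induction L with
  | nil => simp at hl
  | cons b L ih =>
    rw [List.nodup_cons] at hL
    rw [List.flatMap_cons]
    by_cases hb : b = l
    · subst hb
      have : L.flatMap (fun j => List.replicate ((Pi.single b i : ι → ℕ) j) j) = [] := by
        rw [List.flatMap_eq_nil_iff]
        intro j hj
        have hne : j ≠ b := fun h => hL.1 (h ▸ hj)
        simp [hne]
      rw [this, Pi.single_eq_same, List.append_nil]
    · have hmem : l ∈ L := by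
        rcases List.mem_cons.1 hl with h | h
        · exact absurd h.symm hb
        · exact h
      rw [ih hL.2 hmem, Pi.single_eq_of_ne hb, List.replicate_zero, List.nil_append]

lemma foldr_replicate_eq_iterate {ι β : Type*} (g : ι → β → β) (l : ι) (i : ℕ) (b : β) :
    (List.replicate i l).foldr g b = (g l)^[i] b := by
  induction i with
  | zero => rfl
  | succ i ih => rw [List.replicate_succ, List.foldr_cons, ih, Function.iterate_succ_apply']

lemma mIdxList_single (l : Fin n) (i : ℕ) :
    mIdxList (Pi.single l i : Fin n → ℕ) = List.replicate i l :=
  List.flatMap_replicate_single l i (List.nodup_finRange n) (List.mem_finRange l)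

lemma pdM_single (l : Fin n) (i : ℕ) (f : (Fin n → ℝ) → ℂ) :
    pdM (Pi.single l i) f = (pd l)^[i] f := by
  rw [pdM, mIdxList_single, foldr_replicate_eq_iterate]

lemma ddM_single (l : Fin n) (i : ℕ) (g : (Fin n → ℤ) → ℂ) :
    ddM (Pi.single l i) g = (dd l)^[i] g := by
  rw [ddM, mIdxList_single, foldr_replicate_eq_iterate]

lemma iterate_pd_const_mul (l : Fin n) (i : ℕ) (c : ℂ) (f : (Fin n → ℝ) → ℂ) :
    (pd l)^[i] (fun x => c * f x) = fun x => c * (pd l)^[i] f x := by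
  induction i generalizing f with
  | zero => rfl
  | succ i ih =>
    have h : pd l (fun x => c * f x) = fun x => c * pd l f x := by
      ext x
      change fderiv ℝ (c • f) x _ = _
      rw [fderiv_const_smul_field]
      simp [pd]
    rw [Function.iterate_succ_apply, h, ih]
    rfl

lemma one_le_jb (ξ : Fin n → ℤ) : 1 ≤ jb ξ := by
  rw [jb, Real.one_le_sqrt]
  have : 0 ≤ ∑ j, (ξ j : ℝ) ^ 2 := by positivity
  linarith

lemma abs_le_jb (ξ : Fin n → ℤ) (m : Fin n) : |(ξ m : ℝ)| ≤ jb ξ := by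
  refine Real.abs_le_sqrt ?_
  have := Finset.single_le_sum (f := fun j => (ξ j : ℝ) ^ 2) (fun _ _ => sq_nonneg _)
    (Finset.mem_univ m)
  linarith

lemma abs_add_smul_single_sub_le (ξ : Fin n → ℤ) (l m : Fin n) {s t : ℕ} (hs : s ≤ k)
    (ht : t ≤ k) :
    |(((ξ + s • Pi.single l 1 : Fin n → ℤ) m : ℤ) : ℝ)| ≤
      |(((ξ + t • Pi.single l 1 : Fin n → ℤ) m : ℤ) : ℝ)| + k := by
  have hs' : (s : ℝ) ≤ k := by exact_mod_cast hs
  have ht' : (t : ℝ) ≤ k := by exact_mod_cast ht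
  have hs0 : (0 : ℝ) ≤ s := by positivity
  have ht0 : (0 : ℝ) ≤ t := by positivity
  have h : |(((ξ + s • Pi.single l 1 : Fin n → ℤ) m : ℤ) : ℝ) -
      (((ξ + t • Pi.single l 1 : Fin n → ℤ) m : ℤ) : ℝ)| ≤ k := by
    by_cases hm : m = l
    · subst hm
      simp
      exact abs_le.2 ⟨by linarith, by linarith⟩
    · simp [hm]
  have h2 := abs_sub_abs_le_abs_sub (((ξ + s • Pi.single l 1 : Fin n → ℤ) m : ℤ) : ℝ)
    (((ξ + t • Pi.single l 1 : Fin n → ℤ) m : ℤ) : ℝ)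
  linarith

lemma Per.exists_norm_le {f : (Fin n → ℝ) → ℂ} (hf : Per f) (hc : Continuous f) :
    ∃ M, ∀ x, ‖f x‖ ≤ M := by
  obtain ⟨M, hM⟩ := (isCompact_Icc (a := (0 : Fin n → ℝ)) (b := 1)).exists_bound_of_continuousOn
    hc.continuousOn
  refine ⟨M, fun x => ?_⟩
  have hx : (fun j => Int.fract (x j)) + (fun j => ((⌊x j⌋ : ℤ) : ℝ)) = x := by
    ext j; exact Int.fract_add_floor (x j)
  rw [← hx, hf]
  exact hM _ ⟨fun j => Int.fract_nonneg _, fun j => (Int.fract_lt_one _).le⟩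

theorem exists_dyadic_piece_bounds (hn : n ≠ 0) (hk : n < 2 * k) {ε : ℝ} (hε0 : 0 < ε)
    (hε1 : ε < 1) {a : (Fin n → ℝ) → (Fin n → ℤ) → ℂ}
    (hsm : ∀ ξ, ContDiff ℝ (⊤ : ℕ∞) fun x => a x ξ) (hper : ∀ ξ, Per fun x => a x ξ)
    {C₁ : ℝ} (hC₁ : 0 ≤ C₁)
    (h1 : ∀ l, ∀ i ≤ k, ∀ x ξ,
      ‖(dd l)^[i] (a x) ξ‖ ≤ C₁ * jb ξ ^ (-((n : ℝ) / 2) * ε - (1 - ε) * (i : ℝ)))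
    (h2 : ∀ l x ξ, ‖(pd l)^[k] (fun y => a y ξ) x‖ ≤ C₁ * jb ξ ^ (-((n : ℝ) / 2) * ε))
    {Cφ : ℝ} {φ : ℕ → (Fin n → ℤ) → ℂ} (hCφ : 0 ≤ Cφ)
    (hφd : ∀ j l, ∀ i ≤ k, ∀ ξ, ‖(dd l)^[i] (φ j) ξ‖ ≤ Cφ * ((2 ^ j : ℝ)⁻¹) ^ i)
    (hφb : ∀ j ξ, ‖φ j ξ‖ ≤ Cφ)
    (hφu : ∀ j ξ, φ j ξ ≠ 0 → ∀ m, |(ξ m : ℝ)| ≤ 2 * 2 ^ j)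
    (hφl : ∀ j ξ, φ j ξ ≠ 0 → (2 : ℝ) ^ j ≤ 2 ∨ ∃ m, (2 : ℝ) ^ j / 2 ≤ |(ξ m : ℝ)|) :
    ∃ A : ℝ, 0 < A ∧ ∃ B : ℝ≥0∞, B ≠ ∞ ∧ ∀ j, ∃ F : Finset (Fin n → ℤ),
      (∀ x, ∀ ξ ∉ F, φ j ξ * a x ξ = 0) ∧
      (∀ (g : (Fin n → ℝ) → ℂ) (M : ℝ), 0 ≤ M → AEStronglyMeasurable g (μT n) →
        (∀ᵐ y ∂(μT n), ‖g y‖ ≤ M) → ∀ x, ‖Op (fun x ξ => φ j ξ * a x ξ) g x‖ ≤ A * M) ∧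
      (∀ (g : (Fin n → ℝ) → ℂ) (M : ℝ), AEStronglyMeasurable g (μT n) →
        (∀ᵐ y ∂(μT n), ‖g y‖ ≤ M) →
        ∫⁻ x, ‖Op (fun x ξ => φ j ξ * a x ξ) g x‖ₑ ^ 2 ∂(μT n) ≤
          B * ENNReal.ofReal ((2 : ℝ) ^ (-(n * ε))) ^ j * ∫⁻ x, ‖g x‖ₑ ^ 2 ∂(μT n)) := by
  obtain ⟨D, hD0, hD⟩ := exists_integral_norm_kernel_le hn hk
  obtain ⟨D₂, hD₂, hL2⟩ := exists_lintegral_Op_sq_le hn hk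
  set c : ℝ := (2 * (k + 1))⁻¹ with hc
  have hc0 : 0 < c := by positivity
  have hk0' : (0 : ℝ) ≤ k := by positivity
  have hc1 : c ≤ 1 := inv_le_one_of_one_le₀ (by linarith)
  set Q : ℝ := 2 ^ k * (Cφ * C₁) with hQ
  have hQ0 : 0 ≤ Q := by positivity
  set S : ℝ := ((2 * k + 5) / c) ^ n * Q ^ 2 with hS
  have hS0 : 0 ≤ S := by positivity
  refine ⟨D + (1 + n) * S + 1, by positivity,
    D₂ * ENNReal.ofReal (Q ^ 2 * c ^ (-(n * ε))),
    ENNReal.mul_ne_top hD₂ ENNReal.ofReal_ne_top, fun j => ?_⟩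
  set N : ℝ := 2 ^ j with hN
  have hN1 : 1 ≤ N := one_le_pow₀ one_le_two
  have hN0 : 0 < N := by linarith
  set T : ℝ := c * N with hT
  have hT0 : 0 < T := by positivity
  have hTN : T ≤ N := by nlinarith
  set r : ℝ := T ^ (-(1 - ε)) with hr
  have hr0 : 0 < r := by positivity
  have hNr : N⁻¹ ≤ r := by
    calc N⁻¹ = N ^ (-1 : ℝ) := (Real.rpow_neg_one N).symm
      _ ≤ N ^ (-(1 - ε)) := Real.rpow_le_rpow_of_exponent_le hN1 (by linarith)
      _ ≤ T ^ (-(1 - ε)) := Real.rpow_le_rpow_of_nonpos hT0 hTN (by linarith)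
  set σ : (Fin n → ℝ) → (Fin n → ℤ) → ℂ := fun x ξ => φ j ξ * a x ξ with hσ
  have hjb : ∀ l ξ s t, s ≤ k → t ≤ k → φ j (ξ + s • Pi.single l 1) ≠ 0 →
      T ≤ jb (ξ + t • Pi.single l 1) := by
    intro l ξ s t hs ht hne
    have hone := one_le_jb (ξ + t • Pi.single l 1)
    have hk0 : (0 : ℝ) ≤ k := by positivity
    rw [hT, hc, inv_mul_le_iff₀ (by positivity)]
    rcases hφl j _ hne with h | ⟨m, hm⟩
    · nlinarith
    · have h3 := abs_add_smul_single_sub_le ξ l m hs ht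
      have h4 := abs_le_jb (ξ + t • Pi.single l 1) m
      nlinarith
  have hjb0 : ∀ ξ, φ j ξ ≠ 0 → T ≤ jb ξ := by
    intro ξ hne
    have := hjb ⟨0, Nat.pos_of_ne_zero hn⟩ ξ 0 0 (Nat.zero_le k) (Nat.zero_le k)
    simp only [zero_smul, add_zero] at this
    exact this hne
  set γ : ℝ := n / 2 * ε with hγ
  have hγ0 : 0 ≤ γ := by positivity
  have hpow : ∀ ξ : Fin n → ℤ, T ≤ jb ξ → ∀ i : ℕ,
      jb ξ ^ (-((n : ℝ) / 2) * ε - (1 - ε) * (i : ℝ)) ≤ T ^ (-γ) * r ^ i := by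
    intro ξ h i
    have : T ^ (-γ) * r ^ i = T ^ (-((n : ℝ) / 2) * ε - (1 - ε) * (i : ℝ)) := by
      rw [hr, ← Real.rpow_natCast, ← Real.rpow_mul hT0.le, ← Real.rpow_add hT0, hγ]
      congr 1; ring
    rw [this]
    refine Real.rpow_le_rpow_of_nonpos hT0 h ?_
    have h3 : 0 ≤ (1 - ε) * i := mul_nonneg (by linarith) (by positivity)
    linarith
  have hTγ : 0 ≤ T ^ (-γ) := by positivity
  have hQ1 : Cφ * C₁ ≤ Q := le_mul_of_one_le_left (by positivity) (one_le_pow₀ one_le_two)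
  have hb0 : ∀ x ξ, ‖σ x ξ‖ ≤ Q * T ^ (-γ) := by
    intro x ξ
    by_cases hne : φ j ξ = 0
    · simp only [hσ, hne, zero_mul, norm_zero]; positivity
    · have h3 := h1 ⟨0, Nat.pos_of_ne_zero hn⟩ 0 (Nat.zero_le k) x ξ
      have h4 := hpow ξ (hjb0 ξ hne) 0
      rw [pow_zero, mul_one] at h4
      calc ‖σ x ξ‖ = ‖φ j ξ‖ * ‖a x ξ‖ := norm_mul _ _
        _ ≤ Cφ * (C₁ * T ^ (-γ)) := mul_le_mul (hφb j ξ)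
            (h3.trans (mul_le_mul_of_nonneg_left h4 hC₁)) (norm_nonneg _) hCφ
        _ = Cφ * C₁ * T ^ (-γ) := by ring
        _ ≤ _ := by gcongr
  have hbp : ∀ l ξ x, ‖(pd l)^[k] (fun y => σ y ξ) x‖ ≤ Q * T ^ (-γ) := by
    intro l ξ x
    rw [hσ, iterate_pd_const_mul l k (φ j ξ) fun y => a y ξ]
    by_cases hne : φ j ξ = 0
    · simp only [hne, zero_mul, norm_zero]; positivity
    · have h3 := h2 l x ξ
      have h4 := hpow ξ (hjb0 ξ hne) 0
      rw [pow_zero, mul_one, Nat.cast_zero, mul_zero, sub_zero] at h4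
      calc ‖φ j ξ * _‖ = ‖φ j ξ‖ * ‖(pd l)^[k] (fun y => a y ξ) x‖ := norm_mul _ _
        _ ≤ Cφ * (C₁ * T ^ (-γ)) := mul_le_mul (hφb j ξ)
            (h3.trans (mul_le_mul_of_nonneg_left h4 hC₁)) (norm_nonneg _) hCφ
        _ = Cφ * C₁ * T ^ (-γ) := by ring
        _ ≤ _ := by gcongr
  have hbd : ∀ l x ξ, ‖(dd l)^[k] (σ x) ξ‖ ≤ Q * T ^ (-γ) * r ^ k := by
    intro l x ξ
    by_cases hex : ∃ s ≤ k, φ j (ξ + s • Pi.single l 1) ≠ 0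
    · obtain ⟨s, hs, hne⟩ := hex
      have h3 := norm_iterate_dd_mul_le l k (u := φ j) (v := a x) (ξ := ξ) (U := Cφ)
        (V := C₁ * T ^ (-γ)) (r := r) (fun t m htm => ?_) fun t m htm => ?_
      · refine h3.trans (le_of_eq ?_)
        rw [hQ]; ring
      · refine (hφd j l m (by omega) _).trans ?_
        gcongr
      · refine (h1 l m (by omega) x _).trans ?_
        rw [mul_assoc]
        exact mul_le_mul_of_nonneg_left (hpow _ (hjb l ξ s t hs (by omega) hne) m) hC₁
    · push Not at hex
      rw [iterate_dd_eq_zero l k fun s hs => by simp only [hσ, hex s hs, zero_mul], norm_zero]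
      positivity
  set L : ℕ := 2 * 2 ^ j + k with hL
  have hLr : (L : ℝ) = 2 * N + k := by rw [hL, hN]; push_cast; ring
  set F : Finset (Fin n → ℤ) := Fintype.piFinset fun _ => Finset.Icc (-(L : ℤ)) L with hF
  have hmem : ∀ l ξ s, s ≤ k → φ j (ξ + s • Pi.single l 1) ≠ 0 → ξ ∈ F := by
    intro l ξ s hs hne
    rw [hF, Fintype.mem_piFinset]
    intro m
    have h3 := hφu j _ hne m
    have h4 := abs_add_smul_single_sub_le ξ l m (Nat.zero_le k) hs
    rw [zero_smul, add_zero] at h4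
    have h5 : |(ξ m : ℝ)| ≤ L := by rw [hLr]; linarith
    have h6 : |ξ m| ≤ (L : ℤ) := by exact_mod_cast h5
    exact Finset.mem_Icc.2 (abs_le.1 h6)
  have hσF : ∀ x, ∀ ξ ∉ F, σ x ξ = 0 := by
    intro x ξ hξ
    by_contra hne
    refine hξ (hmem ⟨0, Nat.pos_of_ne_zero hn⟩ ξ 0 (Nat.zero_le k) ?_)
    rw [zero_smul, add_zero]
    exact left_ne_zero_of_mul hne
  have hdσF : ∀ x l, ∀ ξ ∉ F, (dd l)^[k] (σ x) ξ = 0 := by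
    intro x l ξ hξ
    refine iterate_dd_eq_zero l k fun s hs => ?_
    by_contra hne
    exact hξ (hmem l ξ s hs (left_ne_zero_of_mul hne))
  have hcard : (F.card : ℝ) ≤ ((2 * k + 5) / c) ^ n * T ^ n := by
    have h3 : F.card = (2 * L + 1) ^ n := by
      rw [hF, Fintype.card_piFinset, Finset.prod_const, Finset.card_univ, Fintype.card_fin,
        Int.card_Icc]
      congr 1; omega
    rw [h3, ← mul_pow, hT, div_mul_eq_mul_div, mul_left_comm, mul_div_cancel_left₀ _ hc0.ne']
    push_cast
    gcongr
    rw [hLr]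
    have hk0 : (0 : ℝ) ≤ k := by positivity
    nlinarith
  have hTT : (T ^ (-γ)) ^ 2 = T ^ (-(n * ε)) := by
    rw [← Real.rpow_natCast, ← Real.rpow_mul hT0.le, hγ]; congr 1; push_cast; ring
  have hrn : (r⁻¹) ^ n = T ^ n * (T ^ (-γ)) ^ 2 := by
    rw [hTT, hr, ← Real.rpow_neg hT0.le, ← Real.rpow_natCast, ← Real.rpow_natCast,
      ← Real.rpow_mul hT0.le, ← Real.rpow_add hT0]
    congr 1; ring
  have hsumle : ∀ (w : (Fin n → ℤ) → ℂ) (W : ℝ), (∀ ξ, ‖w ξ‖ ≤ W) →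
      ∑ ξ ∈ F, ‖w ξ‖ ^ 2 ≤ ((2 * k + 5) / c) ^ n * T ^ n * W ^ 2 := by
    intro w W hw
    calc ∑ ξ ∈ F, ‖w ξ‖ ^ 2 ≤ ∑ _ξ ∈ F, W ^ 2 := Finset.sum_le_sum fun ξ _ => by
          have := hw ξ; gcongr
      _ = F.card * W ^ 2 := by rw [Finset.sum_const, nsmul_eq_mul]
      _ ≤ _ := by gcongr
  refine ⟨F, hσF, fun g M hM0 hg hM x => ?_, fun g M hg hM => ?_⟩
  · refine (norm_Op_le_of_integral_kernel_le hσF (A := D + (1 + n) * S) ?_ hg hM0 hM).trans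
      (mul_le_mul_of_nonneg_right (by linarith) hM0)
    refine hD r⁻¹ S (by positivity) F (fun ξ => (starRingEnd ℂ) (σ x ξ)) (fun ξ hξ => ?_)
      (fun l ξ hξ => ?_) ?_ (fun l => ?_) x
    · rw [hσF x ξ hξ, map_zero]
    · rw [iterate_dd_conj, hdσF x l ξ hξ, map_zero]
    · refine (hsumle _ (Q * T ^ (-γ)) fun ξ => ?_).trans (le_of_eq ?_)
      · rw [Complex.norm_conj]; exact hb0 x ξ
      · rw [hrn, hS]; ring
    · have h3 := hsumle ((dd l)^[k] fun ξ => (starRingEnd ℂ) (σ x ξ)) (Q * T ^ (-γ) * r ^ k)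
        fun ξ => by rw [iterate_dd_conj, Complex.norm_conj]; exact hbd l x ξ
      calc _ ≤ (r⁻¹) ^ (2 * k) *
            (((2 * k + 5) / c) ^ n * T ^ n * (Q * T ^ (-γ) * r ^ k) ^ 2) := by gcongr
        _ = (r⁻¹ * r) ^ (2 * k) * (S * (r⁻¹) ^ n) := by rw [hrn, hS]; ring
        _ = _ := by rw [inv_mul_cancel₀ hr0.ne', one_pow, one_mul]
  · have hσsm : ∀ ξ, ContDiff ℝ (⊤ : ℕ∞) fun x => σ x ξ := fun ξ => contDiff_const.mul (hsm ξ)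
    have hσper : ∀ ξ, Per fun x => σ x ξ := fun ξ x v => by
      have h3 : a (x + fun j => (v j : ℝ)) ξ = a x ξ := hper ξ x v
      simp only [hσ, h3]
    refine (hL2 σ F (Q * T ^ (-γ)) hσsm hσper hσF hb0 hbp g M hg hM).trans (le_of_eq ?_)
    congr 1
    rw [mul_assoc D₂, ← ENNReal.ofReal_pow (by positivity), ← ENNReal.ofReal_mul (by positivity)]
    congr 2
    rw [mul_pow, hTT, hT, Real.mul_rpow hc0.le hN0.le, hN, ← Real.rpow_natCast 2 j,
      ← Real.rpow_mul zero_le_two, ← Real.rpow_natCast _ j, ← Real.rpow_mul zero_le_two,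
      mul_comm (j : ℝ)]
    ring

end Symbols

section Boundedness

variable {n : ℕ}

lemma eLpNorm_le_of_lintegral_rpow_le {α E : Type*} [MeasurableSpace α] {μ : Measure α}
    [NormedAddCommGroup E] {f g : α → E} {p : ℝ} (hp : 0 < p) {K : ℝ≥0∞}
    (h : ∫⁻ x, ‖g x‖ₑ ^ p ∂μ ≤ K * ∫⁻ x, ‖f x‖ₑ ^ p ∂μ) :
    eLpNorm g (ENNReal.ofReal p) μ ≤ K ^ (1 / p) * eLpNorm f (ENNReal.ofReal p) μ := by
  have h0 : ENNReal.ofReal p ≠ 0 := (ENNReal.ofReal_pos.2 hp).ne'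
  rw [eLpNorm_eq_lintegral_rpow_enorm_toReal h0 ENNReal.ofReal_ne_top,
    eLpNorm_eq_lintegral_rpow_enorm_toReal h0 ENNReal.ofReal_ne_top,
    ENNReal.toReal_ofReal hp.le, ← ENNReal.mul_rpow_of_nonneg _ _ (by positivity)]
  exact ENNReal.rpow_le_rpow h (by positivity)

theorem eLpNorm_Op_le {σ : (Fin n → ℝ) → (Fin n → ℤ) → ℂ} {F : Finset (Fin n → ℤ)}
    (hF : ∀ x, ∀ ξ ∉ F, σ x ξ = 0) (hσ : ∀ ξ, Continuous fun x => σ x ξ) {A : ℝ} (hA : 0 < A)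
    (hbdd : ∀ (g : (Fin n → ℝ) → ℂ) (M : ℝ), 0 ≤ M → AEStronglyMeasurable g (μT n) →
      (∀ᵐ y ∂(μT n), ‖g y‖ ≤ M) → ∀ x, ‖Op σ g x‖ ≤ A * M) {B : ℝ≥0∞}
    (hsq : ∀ (g : (Fin n → ℝ) → ℂ) (M : ℝ), AEStronglyMeasurable g (μT n) →
      (∀ᵐ y ∂(μT n), ‖g y‖ ≤ M) →
      ∫⁻ x, ‖Op σ g x‖ₑ ^ 2 ∂(μT n) ≤ B * ∫⁻ x, ‖g x‖ₑ ^ 2 ∂(μT n))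
    {p : ℝ} (hp : 2 ≤ p) {f : (Fin n → ℝ) → ℂ} (hf : Continuous f) {M : ℝ}
    (hM : ∀ᵐ y ∂(μT n), ‖f y‖ ≤ M) :
    eLpNorm (Op σ f) (ENNReal.ofReal p) (μT n) ≤
      ((1 + ENNReal.ofReal (4 * p / (p - 2) * (2 * A) ^ (p - 2))) * B) ^ (1 / p) *
        eLpNorm f (ENNReal.ofReal p) (μT n) := by
  refine eLpNorm_le_of_lintegral_rpow_le (by linarith) ?_
  rcases hp.eq_or_lt with rfl | hp
  · simp only [ENNReal.rpow_two]
    refine (hsq f M hf.aestronglyMeasurable hM).trans ?_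
    gcongr
    exact le_mul_of_one_le_left zero_le le_self_add
  · have he : ∀ z : ℂ, ‖z‖ₑ ^ p = ENNReal.ofReal (‖z‖ ^ p) := fun z => by
      rw [← ofReal_norm, ENNReal.ofReal_rpow_of_nonneg (norm_nonneg _) (by linarith)]
    simp only [he]
    refine (lintegral_Op_rpow_le hF hσ hA hbdd hsq hp hf hM).trans ?_
    gcongr
    exact le_add_self

lemma sum_Op_eq {a : (Fin n → ℝ) → (Fin n → ℤ) → ℂ} {φ : ℕ → (Fin n → ℤ) → ℂ}
    {F : ℕ → Finset (Fin n → ℤ)} (hF : ∀ j x, ∀ ξ ∉ F j, φ j ξ * a x ξ = 0)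
    (s : Finset ℕ) (f : (Fin n → ℝ) → ℂ) (x : Fin n → ℝ) :
    ∑ j ∈ s, Op (fun x ξ => φ j ξ * a x ξ) f x =
      Op (fun x ξ => (∑ j ∈ s, φ j ξ) * a x ξ) f x := by
  unfold Op
  rw [← Summable.tsum_finsetSum fun j _ => summable_of_ne_finset_zero (s := F j) fun ξ hξ => by
    simp only [hF j x ξ hξ, mul_zero, zero_mul]]
  simp only [Finset.sum_mul, Finset.mul_sum]

lemma tendsto_Op_mul {a : (Fin n → ℝ) → (Fin n → ℤ) → ℂ} {C : ℝ} (ha : ∀ x ξ, ‖a x ξ‖ ≤ C)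
    {Φ : ℕ → (Fin n → ℤ) → ℂ} (hΦ : ∀ J ξ, ‖Φ J ξ‖ ≤ 1)
    (hΦ1 : ∀ ξ, ∀ᶠ J in Filter.atTop, Φ J ξ = 1) {f : (Fin n → ℝ) → ℂ} (hf : Summable (fc f))
    (x : Fin n → ℝ) :
    Filter.Tendsto (fun J => Op (fun x ξ => Φ J ξ * a x ξ) f x) Filter.atTop
      (nhds (Op a f x)) := by
  refine tendsto_tsum_of_dominated_convergence (bound := fun ξ => C * ‖fc f ξ‖)
    (hf.norm.mul_left C) (fun ξ => ?_) (Filter.Eventually.of_forall fun J ξ => ?_)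
  · refine tendsto_const_nhds.congr' ?_
    filter_upwards [hΦ1 ξ] with J hJ
    rw [hJ, one_mul]
  · rw [norm_mul, norm_mul, norm_mul, norm_eChar, one_mul]
    gcongr
    calc ‖Φ J ξ‖ * ‖a x ξ‖ ≤ 1 * C := mul_le_mul (hΦ J ξ) (ha x ξ) (norm_nonneg _) zero_le_one
      _ = C := one_mul C

lemma eLpNorm_tsum_le_of_tendsto {α E : Type*} [MeasurableSpace α] {μ : Measure α}
    [NormedAddCommGroup E] {q : ℝ≥0∞} (hq : 1 ≤ q) {T : ℕ → α → E} {g : α → E}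
    (hT : ∀ j, AEStronglyMeasurable (T j) μ)
    (hg : ∀ x, Filter.Tendsto (fun J => ∑ j ∈ Finset.range (J + 1), T j x) Filter.atTop
      (nhds (g x))) :
    eLpNorm g q μ ≤ ∑' j, eLpNorm (T j) q μ := by
  have hm : ∀ J : ℕ, AEStronglyMeasurable (∑ j ∈ Finset.range (J + 1), T j) μ := fun J =>
    Finset.aestronglyMeasurable_sum _ fun j _ => hT j
  refine (Lp.eLpNorm_lim_le_liminf_eLpNorm hm g
    (Filter.Eventually.of_forall fun x => by simpa using hg x)).trans ?_
  refine Filter.liminf_le_of_le (by isBoundedDefault) fun b hb => ?_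
  obtain ⟨J, hJ⟩ := hb.exists
  exact hJ.trans ((eLpNorm_sum_le (fun j _ => hT j) hq).trans (ENNReal.sum_le_tsum _))

lemma lpT_eq_toReal_eLpNorm {p : ℝ} (hp : 0 < p) {g : (Fin n → ℝ) → ℂ}
    (hg : MemLp g (ENNReal.ofReal p) (μT n)) :
    lpT n p g = (eLpNorm g (ENNReal.ofReal p) (μT n)).toReal := by
  rw [hg.eLpNorm_eq_integral_rpow_norm (ENNReal.ofReal_pos.2 hp).ne' ENNReal.ofReal_ne_top,
    ENNReal.toReal_ofReal hp.le, ENNReal.toReal_ofReal (by positivity), lpT, one_div]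

lemma exists_uniform_bound {ι X : Type*} [Finite ι] {u v : ι → X → ℝ} (hv : ∀ i x, 0 ≤ v i x)
    (h : ∀ i, ∃ C : ℝ, 0 < C ∧ ∀ x, u i x ≤ C * v i x) :
    ∃ C : ℝ, 0 ≤ C ∧ ∀ i x, u i x ≤ C * v i x := by
  choose C hC hu using h
  have := Fintype.ofFinite ι
  refine ⟨∑ i, C i, Finset.sum_nonneg fun i _ => (hC i).le, fun i x => (hu i x).trans ?_⟩
  exact mul_le_mul_of_nonneg_right
    (Finset.single_le_sum (fun j _ => (hC j).le) (Finset.mem_univ i)) (hv i x)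

end Boundedness

/-- **Delgado.** Let `0 < ε < 1`, `k = [n/2]+1` and `2 ≤ p < ∞`.  If `a : 𝕋ⁿ × ℤⁿ → ℂ`
satisfies `|Δ_ξ^α a(x,ξ)| ≤ C_α ⟨ξ⟩^{-(n/2)ε - (1-ε)|α|}` and
`|∂_x^β a(x,ξ)| ≤ C_β ⟨ξ⟩^{-(n/2)ε}` for `|α|, |β| ≤ k`, then
`a(x,D) : L^p(𝕋ⁿ) → L^p(𝕋ⁿ)` is bounded. -/
theorem periodic_pseudodiff_delgado_Lp_bounded
    (n : ℕ) (hn : 1 ≤ n) (ε p : ℝ)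
    (hε0 : 0 < ε) (hε1 : ε < 1) (hp2 : 2 ≤ p)
    (a : (Fin n → ℝ) → (Fin n → ℤ) → ℂ)
    (ha_smooth : ∀ ξ, ContDiff ℝ (⊤ : ℕ∞) fun x => a x ξ)
    (ha_per : ∀ ξ, Per fun x => a x ξ)
    (ha₁ : ∀ α : Fin n → ℕ, (∑ j, α j) ≤ n / 2 + 1 →
      ∃ C : ℝ, 0 < C ∧ ∀ (x : Fin n → ℝ) (ξ : Fin n → ℤ),
        ‖ddM α (a x) ξ‖ ≤ C * jb ξ ^ (-((n : ℝ) / 2) * ε - (1 - ε) * ∑ j, (α j : ℝ)))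
    (ha₂ : ∀ β : Fin n → ℕ, (∑ j, β j) ≤ n / 2 + 1 →
      ∃ C : ℝ, 0 < C ∧ ∀ (x : Fin n → ℝ) (ξ : Fin n → ℤ),
        ‖pdM β (fun x' => a x' ξ) x‖ ≤ C * jb ξ ^ (-((n : ℝ) / 2) * ε)) :
    ∃ C : ℝ, 0 < C ∧ ∀ f : (Fin n → ℝ) → ℂ, ContDiff ℝ (⊤ : ℕ∞) f → Per f →
      lpT n p (Op a f) ≤ C * lpT n p f := by
  have hn0 : n ≠ 0 := by omega
  set k : ℕ := n / 2 + 1 with hk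
  have hnk : n < 2 * k := by omega
  have hjb0 : ∀ ξ : Fin n → ℤ, 0 ≤ jb ξ := fun ξ => zero_le_one.trans (one_le_jb ξ)
  obtain ⟨C₁, hC₁, h1⟩ := exists_uniform_bound (ι := Fin n × Fin (k + 1))
    (X := (Fin n → ℝ) × (Fin n → ℤ)) (u := fun i x => ‖(dd i.1)^[i.2] (a x.1) x.2‖)
    (v := fun i x => jb x.2 ^ (-((n : ℝ) / 2) * ε - (1 - ε) * ((i.2 : ℕ) : ℝ)))
    (fun i x => Real.rpow_nonneg (hjb0 _) _) fun i => by
      obtain ⟨C, hC, h⟩ := ha₁ (Pi.single i.1 i.2) (by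
        rw [Finset.sum_pi_single']; simpa using Nat.lt_succ_iff.1 i.2.2)
      refine ⟨C, hC, fun x => ?_⟩
      have h3 := h x.1 x.2
      rwa [ddM_single, ← Nat.cast_sum, Finset.sum_pi_single', if_pos (Finset.mem_univ _)] at h3
  obtain ⟨C₂, hC₂, h2⟩ := exists_uniform_bound (ι := Fin n)
    (X := (Fin n → ℝ) × (Fin n → ℤ)) (u := fun l x => ‖(pd l)^[k] (fun y => a y x.2) x.1‖)
    (v := fun _ x => jb x.2 ^ (-((n : ℝ) / 2) * ε))
    (fun i x => Real.rpow_nonneg (hjb0 _) _) fun l => by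
      obtain ⟨C, hC, h⟩ := ha₂ (Pi.single l k) (by rw [Finset.sum_pi_single']; simp)
      refine ⟨C, hC, fun x => ?_⟩
      have h3 := h x.1 x.2
      rwa [pdM_single] at h3
  have hab : ∀ x ξ, ‖a x ξ‖ ≤ C₁ := fun x ξ => by
    refine (h1 (⟨0, hn⟩, 0) (x, ξ)).trans (mul_le_of_le_one_right hC₁ ?_)
    refine Real.rpow_le_one_of_one_le_of_nonpos (one_le_jb ξ) ?_
    have : 0 ≤ (n : ℝ) / 2 * ε := by positivity
    simpa using this
  obtain ⟨Cφ, φ, hCφ, hφd, hφb, hφu, hφl, hφs, hφ1⟩ := exists_dyadic_partition n k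
  obtain ⟨A, hA, B, hB, hpiece⟩ := exists_dyadic_piece_bounds hn0 hnk hε0 hε1 ha_smooth ha_per
    (C₁ := C₁ + C₂) (by positivity)
    (fun l i hi x ξ => (h1 (l, ⟨i, Nat.lt_succ_iff.2 hi⟩) (x, ξ)).trans (by
      have := Real.rpow_nonneg (hjb0 ξ) (-((n : ℝ) / 2) * ε - (1 - ε) * (i : ℝ))
      gcongr; linarith))
    (fun l x ξ => (h2 l (x, ξ)).trans (by
      have := Real.rpow_nonneg (hjb0 ξ) (-((n : ℝ) / 2) * ε)
      gcongr; linarith))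
    hCφ hφd hφb hφu hφl
  choose F hF hbdd hsq using hpiece
  have hp0 : 0 < p := by linarith
  set q : ℝ≥0∞ := ENNReal.ofReal p with hq
  have hq1 : 1 ≤ q := by
    rw [hq, ← ENNReal.ofReal_one]; exact ENNReal.ofReal_le_ofReal (by linarith)
  set E : ℝ≥0∞ := (1 + ENNReal.ofReal (4 * p / (p - 2) * (2 * A) ^ (p - 2))) * B with hE
  have hE_top : E ≠ ∞ := ENNReal.mul_ne_top
    (ENNReal.add_ne_top.2 ⟨ENNReal.one_ne_top, ENNReal.ofReal_ne_top⟩) hB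
  set ρ : ℝ≥0∞ := ENNReal.ofReal ((2 : ℝ) ^ (-(n * ε))) with hρ
  have hρ1 : ρ < 1 := by
    rw [hρ, ENNReal.ofReal_lt_one]
    have : 0 < (n : ℝ) * ε := mul_pos (by exact_mod_cast hn) hε0
    exact Real.rpow_lt_one_of_one_lt_of_neg one_lt_two (by linarith)
  have hρp : ρ ^ (1 / p) < 1 := ENNReal.rpow_lt_one hρ1 (by positivity)
  set K : ℝ≥0∞ := E ^ (1 / p) * (1 - ρ ^ (1 / p))⁻¹ with hK
  have hK_top : K ≠ ∞ := ENNReal.mul_ne_top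
    (ENNReal.rpow_ne_top_of_nonneg (by positivity) hE_top)
    (ENNReal.inv_ne_top.2 (tsub_pos_of_lt hρp).ne')
  refine ⟨K.toReal + 1, by positivity, fun f hf hfper => ?_⟩
  obtain ⟨M₀, hM₀⟩ := hfper.exists_norm_le hf.continuous
  have hdf : ∀ i l, ContDiff ℝ (⊤ : ℕ∞) ((pd l)^[i] f) ∧ Per ((pd l)^[i] f) := by
    intro i l
    induction i with
    | zero => exact ⟨hf, hfper⟩
    | succ i ih =>
      rw [Function.iterate_succ_apply']
      exact ⟨pd_contDiff l ih.1, ih.2.pd l⟩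
  have hdb : ∀ l, ∃ M, ∀ x, ‖(pd l)^[k] f x‖ ≤ M := fun l =>
    (hdf k l).2.exists_norm_le (hdf k l).1.continuous
  choose M hM using hdb
  have hM0 : ∀ l, 0 ≤ M l := fun l => (norm_nonneg _).trans (hM l 0)
  have hsum : Summable (fc f) := summable_fc hn0 hnk hf hfper (M := M₀ + ∑ l, M l)
    (fun x => (hM₀ x).trans (le_add_of_nonneg_right (Finset.sum_nonneg fun l _ => hM0 l)))
    fun l x => (hM l x).trans ((Finset.single_le_sum (fun j _ => hM0 j)
      (Finset.mem_univ l)).trans (le_add_of_nonneg_left ((norm_nonneg _).trans (hM₀ 0))))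
  have hcont : ∀ j, Continuous (Op (fun x ξ => φ j ξ * a x ξ) f) := fun j =>
    continuous_Op (hF j) (fun ξ => continuous_const.mul (ha_smooth ξ).continuous) f
  have hlim : ∀ x, Filter.Tendsto
      (fun J => ∑ j ∈ Finset.range (J + 1), Op (fun x ξ => φ j ξ * a x ξ) f x) Filter.atTop
      (nhds (Op a f x)) := fun x => by
    simp only [sum_Op_eq hF]
    exact tendsto_Op_mul hab hφs hφ1 hsum x
  have hKf : eLpNorm (Op a f) q (μT n) ≤ K * eLpNorm f q (μT n) := by
    refine (eLpNorm_tsum_le_of_tendsto hq1 (fun j => (hcont j).aestronglyMeasurable) hlim).trans ?_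
    calc ∑' j, eLpNorm (Op (fun x ξ => φ j ξ * a x ξ) f) q (μT n)
        ≤ ∑' j : ℕ, E ^ (1 / p) * (ρ ^ (1 / p)) ^ j * eLpNorm f q (μT n) := by
          refine ENNReal.tsum_le_tsum fun j => ?_
          refine (eLpNorm_Op_le (hF j) (fun ξ => continuous_const.mul (ha_smooth ξ).continuous) hA
            (hbdd j) (hsq j) hp2 hf.continuous (Filter.Eventually.of_forall hM₀)).trans
            (le_of_eq ?_)
          rw [← mul_assoc, ENNReal.mul_rpow_of_nonneg _ _ (by positivity : 0 ≤ 1 / p),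
            ← ENNReal.rpow_natCast, ← ENNReal.rpow_natCast, ← ENNReal.rpow_mul,
            ← ENNReal.rpow_mul, mul_comm (j : ℝ)]
      _ = K * eLpNorm f q (μT n) := by
          rw [ENNReal.tsum_mul_right, ENNReal.tsum_mul_left, ENNReal.tsum_geometric]
  have hfL : MemLp f q (μT n) :=
    MemLp.of_bound hf.continuous.aestronglyMeasurable M₀ (Filter.Eventually.of_forall hM₀)
  have hOm : AEStronglyMeasurable (Op a f) (μT n) :=
    aestronglyMeasurable_of_tendsto_ae Filter.atTop
      (fun J => Finset.aestronglyMeasurable_fun_sum (Finset.range (J + 1)) fun j _ =>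
        (hcont j).aestronglyMeasurable)
      (Filter.Eventually.of_forall hlim)
  have hKf_top : K * eLpNorm f q (μT n) ≠ ∞ := ENNReal.mul_ne_top hK_top hfL.eLpNorm_ne_top
  have hOL : MemLp (Op a f) q (μT n) := ⟨hOm, hKf.trans_lt hKf_top.lt_top⟩
  rw [lpT_eq_toReal_eLpNorm hp0 hfL, lpT_eq_toReal_eLpNorm hp0 hOL]
  calc (eLpNorm (Op a f) q (μT n)).toReal ≤ (K * eLpNorm f q (μT n)).toReal :=
        ENNReal.toReal_mono hKf_top hKf
    _ = K.toReal * (eLpNorm f q (μT n)).toReal := ENNReal.toReal_mul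
    _ ≤ (K.toReal + 1) * (eLpNorm f q (μT n)).toReal := by gcongr; linarith
end
end

section
/- Let n ≥ 1 and 1 ≤ p ≤ ∞. Let σ : ℝⁿ → ℂ be a bounded measurable symbol such that the Fourier multiplier T_σ on ℝⁿ, defined by (T_σ u)^∧(ξ) = σ(ξ) û(ξ), is bounded on L^p(ℝⁿ), and suppose σ is continuous at each point of ℤⁿ. Then the periodic Fourier multiplier σ(D)f(x) = Σ_{ξ∈ℤⁿ} e^{2πi⟨x,ξ⟩} σ(ξ) f̂(ξ) is a bounded operator from L^p(𝕋ⁿ) to L^p(𝕋ⁿ). -/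
open MeasureTheory Real ENNReal

noncomputable section

namespace Transference

open Set Filter Topology
open scoped FourierTransform SchwartzMap

variable {n : ℕ}

/-- The character `e^{2πi⟨x,ξ⟩}` for a real frequency `ξ`. -/
def character (x ξ : Fin n → ℝ) : ℂ :=
  Complex.exp (2 * (π : ℂ) * Complex.I * ∑ j, (x j : ℂ) * (ξ j : ℂ))

lemma eChar_eq_character (x : Fin n → ℝ) (ξ : Fin n → ℤ) :
    eChar x ξ = character x (castZ ξ) := by
  simp [eChar, character, castZ]

lemma character_eq_exp_ofReal (x ξ : Fin n → ℝ) :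
    character x ξ = Complex.exp ((2 * π * ∑ j, x j * ξ j : ℝ) * Complex.I) := by
  rw [character]
  push_cast
  ring_nf

@[simp]
lemma norm_character (x ξ : Fin n → ℝ) : ‖character x ξ‖ = 1 := by
  rw [character_eq_exp_ofReal, Complex.norm_exp_ofReal_mul_I]

lemma character_neg_left (x ξ : Fin n → ℝ) :
    character (-x) ξ =
      Complex.exp (-(2 * (π : ℂ) * Complex.I) * ∑ j, (x j : ℂ) * (ξ j : ℂ)) := by
  simp [character]

lemma character_add_left (x y ξ : Fin n → ℝ) :
    character (x + y) ξ = character x ξ * character y ξ := by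
  simp only [character, ← Complex.exp_add, ← mul_add, ← Finset.sum_add_distrib]
  simp [add_mul]

lemma character_add_right (x ξ η : Fin n → ℝ) :
    character x (ξ + η) = character x ξ * character x η := by
  simp only [character, ← Complex.exp_add, ← mul_add, ← Finset.sum_add_distrib]
  simp [mul_add]

lemma character_sub_right (x ξ η : Fin n → ℝ) :
    character x (ξ - η) = character x ξ * character (-x) η := by
  rw [sub_eq_add_neg, character_add_right]
  simp [character]

lemma character_smul_left (c : ℝ) (x ξ : Fin n → ℝ) :
    character (c • x) ξ = character x (c • ξ) := by
  simp only [character, Pi.smul_apply, smul_eq_mul, Complex.ofReal_mul]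
  congr 2
  exact Finset.sum_congr rfl fun j _ => by ring

@[fun_prop]
lemma continuous_character : Continuous fun q : (Fin n → ℝ) × (Fin n → ℝ) =>
    character q.1 q.2 := by
  unfold character
  fun_prop

@[fun_prop]
lemma Continuous.character {X : Type*} [TopologicalSpace X] {a b : X → Fin n → ℝ}
    (ha : Continuous a) (hb : Continuous b) : Continuous fun x => character (a x) (b x) :=
  continuous_character.comp (ha.prodMk hb)

/-- The projection `ℝⁿ → 𝕋ⁿ`. -/
def toTorus (x : Fin n → ℝ) : Fin n → UnitAddCircle := fun j => (x j : UnitAddCircle)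

lemma isOpenQuotientMap_toTorus :
    IsOpenQuotientMap (toTorus : (Fin n → ℝ) → Fin n → UnitAddCircle) :=
  IsOpenQuotientMap.piMap fun _ => QuotientAddGroup.isOpenQuotientMap_mk

lemma measurable_toTorus : Measurable (toTorus : (Fin n → ℝ) → Fin n → UnitAddCircle) :=
  isOpenQuotientMap_toTorus.continuous.measurable

/-- A continuous periodic function descends to a continuous function on the torus. -/
lemma exists_continuousMap_torus {f : (Fin n → ℝ) → ℂ} (hf : Continuous f) (hper : Per f) :
    ∃ F : C(Fin n → UnitAddCircle, ℂ), ∀ x, F (toTorus x) = f x := by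
  have hq := (isOpenQuotientMap_toTorus (n := n)).isQuotientMap
  have hfac : ∀ x y : Fin n → ℝ, toTorus x = toTorus y → f x = f y := by
    intro x y hxy
    have h : ∀ j, ∃ k : ℤ, x j = y j + k := by
      intro j
      obtain ⟨k, hk⟩ := AddSubgroup.mem_zmultiples_iff.1
        (QuotientAddGroup.eq.1 (congrFun hxy j).symm)
      refine ⟨k, ?_⟩
      rw [zsmul_eq_mul, mul_one] at hk
      linarith
    choose k hk using h
    rw [← hper y k]
    exact congrArg f (funext hk)
  let π' : C(Fin n → ℝ, Fin n → UnitAddCircle) := ⟨toTorus, isOpenQuotientMap_toTorus.continuous⟩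
  have hq' : IsQuotientMap π' := hq
  have hfac' : Function.FactorsThrough (⟨f, hf⟩ : C(Fin n → ℝ, ℂ)) π' := hfac
  exact ⟨hq'.lift ⟨f, hf⟩ hfac', fun x => congrArg (fun g => g x) (hq'.lift_comp ⟨f, hf⟩ hfac')⟩

/-- The half-open cube `[a, b)ⁿ`. -/
def box (n : ℕ) (a b : ℝ) : Set (Fin n → ℝ) := Set.univ.pi fun _ => Set.Ico a b

lemma map_coe_restrict_Ico (a : ℝ) (N : ℕ) :
    (volume.restrict (Ico a (a + N))).map ((↑) : ℝ → UnitAddCircle) = (N : ℝ≥0∞) • volume := by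
  induction N with
  | zero => simp
  | succ N ih =>
    have hun : Ico a (a + (N + 1 : ℕ)) = Ico a (a + N) ∪ Ico (a + N) (a + N + 1) := by
      rw [Ico_union_Ico_eq_Ico (by simp) (by simp)]
      push_cast
      rw [add_assoc]
    have hdisj : Disjoint (Ico a (a + N)) (Ico (a + N) (a + N + 1)) :=
      Ico_disjoint_Ico_same
    have h1 : (volume.restrict (Ico (a + N) (a + N + 1))).map ((↑) : ℝ → UnitAddCircle)
        = volume := by
      rw [restrict_Ico_eq_restrict_Ioc]
      exact (UnitAddCircle.measurePreserving_mk _).map_eq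
    rw [hun, Measure.restrict_union hdisj measurableSet_Ico,
      Measure.map_add _ _ AddCircle.measurable_mk', ih, h1]
    push_cast
    rw [add_smul, one_smul]

lemma map_toTorus_restrict_box (n : ℕ) (a : ℝ) (N : ℕ) :
    (volume.restrict (box n a (a + N))).map toTorus = (N : ℝ≥0∞) ^ n • volume := by
  have hσ : ∀ _ : Fin n, SigmaFinite
      ((volume.restrict (Ico a (a + N))).map ((↑) : ℝ → UnitAddCircle)) := by
    intro _
    infer_instance
  rw [box, volume_pi, Measure.restrict_pi_pi]
  have := Measure.pi_map_pi (μ := fun _ : Fin n => volume.restrict (Ico a (a + N)))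
    (f := fun _ => ((↑) : ℝ → UnitAddCircle)) (fun _ => AddCircle.measurable_mk'.aemeasurable)
  refine Eq.trans this ?_
  refine Measure.pi_eq fun s hs => ?_
  simp only [map_coe_restrict_Ico]
  simp [volume_pi, Measure.pi_pi, Finset.prod_mul_distrib]

lemma μT_eq (n : ℕ) : μT n = volume.restrict (box n 0 (0 + (1 : ℕ))) := by
  simp [μT, cube, box]

lemma map_toTorus_μT (n : ℕ) : (μT n).map toTorus = volume := by
  rw [μT_eq, map_toTorus_restrict_box]
  simp

instance (n : ℕ) : IsProbabilityMeasure (μT n) := by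
  have h := Measure.map_apply (μ := μT n) measurable_toTorus MeasurableSet.univ
  rw [map_toTorus_μT] at h
  exact ⟨by simpa [volume_pi, Measure.pi_univ] using h.symm⟩

lemma eLpNorm_restrict_box {f : (Fin n → ℝ) → ℂ} (hf : Continuous f) (hper : Per f)
    (p : ℝ≥0∞) (a : ℝ) {N : ℕ} (hN : N ≠ 0) :
    eLpNorm f p (volume.restrict (box n a (a + N))) =
      ((N : ℝ≥0∞) ^ n) ^ (1 / p).toReal * eLpNorm f p (μT n) := by
  obtain ⟨F, hF⟩ := exists_continuousMap_torus hf hper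
  have hFf : F ∘ toTorus = f := funext hF
  have key : ∀ μ : Measure (Fin n → ℝ), eLpNorm f p μ = eLpNorm F p (μ.map toTorus) := by
    intro μ
    rw [eLpNorm_map_measure F.continuous.aestronglyMeasurable measurable_toTorus.aemeasurable, hFf]
  rw [key, key, map_toTorus_restrict_box, map_toTorus_μT,
    eLpNorm_smul_measure_of_ne_zero (by positivity), smul_eq_mul]

lemma integral_translate {f : (Fin n → ℝ) → ℂ} (hf : Continuous f) (hper : Per f)
    (v : Fin n → ℝ) : ∫ x, f (x + v) ∂(μT n) = ∫ x, f x ∂(μT n) := by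
  obtain ⟨F, hF⟩ := exists_continuousMap_torus hf hper
  have key : ∀ G : C(Fin n → UnitAddCircle, ℂ),
      ∫ x, G (toTorus x) ∂(μT n) = ∫ t, G t := by
    intro G
    rw [← map_toTorus_μT, integral_map measurable_toTorus.aemeasurable
      G.continuous.aestronglyMeasurable]
  have h1 := key (F.comp ⟨fun t => t + toTorus v, by fun_prop⟩)
  have h2 := key F
  simp only [ContinuousMap.comp_apply, ContinuousMap.coe_mk] at h1
  rw [integral_add_right_eq_self (fun t => F t)] at h1
  simp only [← hF]
  rw [h2, ← h1]
  rfl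

lemma fc_eq (f : (Fin n → ℝ) → ℂ) (ξ : Fin n → ℤ) :
    fc f ξ = ∫ x, character (-x) (castZ ξ) * f x ∂(μT n) := by
  simp only [fc, character_neg_left, castZ, Complex.ofReal_intCast]

lemma character_intCast (v ξ : Fin n → ℤ) : character (castZ v) (castZ ξ) = 1 := by
  rw [character, Complex.exp_eq_one_iff]
  refine ⟨∑ j, v j * ξ j, ?_⟩
  simp only [castZ]
  push_cast
  ring

lemma per_character_neg (ξ : Fin n → ℤ) : Per fun x => character (-x) (castZ ξ) := by
  intro x v
  have h : -(x + fun j => (v j : ℝ)) = -x + castZ (-v) := by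
    ext j
    simp [castZ]
    ring
  simp only [h, character_add_left, character_intCast, mul_one]

lemma exists_norm_le_of_per {f : (Fin n → ℝ) → ℂ} (hf : Continuous f) (hper : Per f) :
    ∃ B : ℝ, ∀ x, ‖f x‖ ≤ B := by
  obtain ⟨F, hF⟩ := exists_continuousMap_torus hf hper
  exact ⟨‖F‖, fun x => hF x ▸ F.norm_coe_le_norm _⟩

lemma integral_character_mul_translate {f : (Fin n → ℝ) → ℂ} (hf : Continuous f) (hper : Per f)
    (ξ : Fin n → ℤ) (v : Fin n → ℝ) :
    ∫ x, character (-x) (castZ ξ) * f (x + v) ∂(μT n) = character v (castZ ξ) * fc f ξ := by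
  have h := integral_translate (f := fun x => character (-x) (castZ ξ) * f x) (by fun_prop)
    (fun x w => by simp only [per_character_neg ξ x w, hper x w]) v
  rw [fc_eq, ← h, ← integral_const_mul]
  congr 1
  ext x
  have h1 : (-x : Fin n → ℝ) = v + -(x + v) := by abel
  rw [h1, character_add_left]
  ring

lemma contDiff_pd {f : (Fin n → ℝ) → ℂ} (hf : ContDiff ℝ (⊤ : ℕ∞) f) (j : Fin n) :
    ContDiff ℝ (⊤ : ℕ∞) (pd j f) := by
  unfold pd
  exact (hf.fderiv_right (m := (⊤ : ℕ∞)) (by simp)).clm_apply contDiff_const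

lemma per_pd {f : (Fin n → ℝ) → ℂ} (hper : Per f) (j : Fin n) : Per (pd j f) := by
  intro x v
  unfold pd
  rw [← fderiv_comp_add_right]
  congr 2
  exact funext fun y => hper y v

lemma fc_pd {f : (Fin n → ℝ) → ℂ} (hf : ContDiff ℝ (⊤ : ℕ∞) f) (hper : Per f) (j : Fin n)
    (ξ : Fin n → ℤ) : fc (pd j f) ξ = 2 * π * Complex.I * ξ j * fc f ξ := by
  have hcf := hf.continuous
  have hcpd := (contDiff_pd hf j).continuous
  obtain ⟨B, hB⟩ := exists_norm_le_of_per hcpd (per_pd hper j)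
  obtain ⟨B₀, hB₀⟩ := exists_norm_le_of_per hcf hper
  set e : Fin n → ℝ := Pi.single j 1 with he
  have hderiv : HasDerivAt (fun t : ℝ => ∫ x, character (-x) (castZ ξ) * f (x + t • e) ∂(μT n))
      (∫ x, character (-x) (castZ ξ) * pd j f (x + (0 : ℝ) • e) ∂(μT n)) 0 := by
    refine (hasDerivAt_integral_of_dominated_loc_of_deriv_le
      (F := fun (t : ℝ) x => character (-x) (castZ ξ) * f (x + t • e))
      (F' := fun (t : ℝ) x => character (-x) (castZ ξ) * pd j f (x + t • e))
      (bound := fun _ => B) univ_mem ?_ ?_ ?_ ?_ (integrable_const _) ?_).2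
    · refine Eventually.of_forall fun t => Continuous.aestronglyMeasurable ?_
      fun_prop
    · refine Integrable.of_bound (Continuous.aestronglyMeasurable (by fun_prop)) B₀ ?_
      refine Eventually.of_forall fun x => ?_
      simpa using hB₀ _
    · exact Continuous.aestronglyMeasurable (by fun_prop)
    · refine Eventually.of_forall fun x t _ => ?_
      simpa using hB _
    · refine Eventually.of_forall fun x t _ => ?_
      refine HasDerivAt.const_mul _ ?_
      have h1 : HasFDerivAt f (fderiv ℝ f (x + t • e)) (x + t • e) :=
        (hf.differentiable (by simp) _).hasFDerivAt
      have h2 : HasDerivAt (fun t : ℝ => x + t • e) e t := by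
        simpa using ((hasDerivAt_id t).smul_const e).const_add x
      exact h1.comp_hasDerivAt t h2
  simp only [integral_character_mul_translate hcf hper, zero_smul, add_zero] at hderiv
  rw [← fc_eq] at hderiv
  have hchar : HasDerivAt (fun t : ℝ => character (t • e) (castZ ξ) * fc f ξ)
      (2 * π * Complex.I * ξ j * fc f ξ) 0 := by
    have h0 : ∀ t : ℝ, character (t • e) (castZ ξ) =
        Complex.exp ((t : ℂ) * (2 * π * Complex.I * ξ j)) := by
      intro t
      rw [character]
      congr 1
      rw [Finset.sum_eq_single j]
      · simp [he, castZ]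
        ring
      · intro b _ hb
        simp [he, hb]
      · simp
    simp only [h0]
    have h1 : HasDerivAt (fun t : ℝ => (t : ℂ) * (2 * π * Complex.I * ξ j))
        (2 * π * Complex.I * ξ j) 0 := by
      simpa using (Complex.ofRealCLM.hasDerivAt (x := (0 : ℝ))).mul_const
        (2 * π * Complex.I * ξ j : ℂ)
    simpa using (h1.cexp).mul_const (fc f ξ)
  exact hderiv.unique hchar

lemma exists_abs_pow_mul_norm_fc_le {f : (Fin n → ℝ) → ℂ} (hf : ContDiff ℝ (⊤ : ℕ∞) f)
    (hper : Per f) (j : Fin n) (k : ℕ) :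
    ∃ B : ℝ, 0 ≤ B ∧ ∀ ξ : Fin n → ℤ, |(ξ j : ℝ)| ^ k * ‖fc f ξ‖ ≤ B := by
  induction k generalizing f with
  | zero =>
    obtain ⟨B, hB⟩ := exists_norm_le_of_per hf.continuous hper
    refine ⟨B, (norm_nonneg _).trans (hB 0), fun ξ => ?_⟩
    rw [pow_zero, one_mul, fc_eq]
    refine (norm_integral_le_of_norm_le_const (C := B) (Eventually.of_forall fun x => ?_)).trans
      (by simp)
    simpa using hB x
  | succ k ih =>
    obtain ⟨B, hB0, hB⟩ := ih (contDiff_pd hf j) (per_pd hper j)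
    refine ⟨B, hB0, fun ξ => le_trans ?_ (hB ξ)⟩
    rw [fc_pd hf hper, pow_succ, mul_assoc]
    gcongr
    simp only [norm_mul, Complex.norm_I, Complex.norm_intCast, Complex.norm_real, mul_one,
      RCLike.norm_ofNat, Real.norm_eq_abs, abs_of_pos pi_pos]
    gcongr
    have : (1 : ℝ) ≤ 2 * π := by linarith [pi_gt_three]
    exact le_mul_of_one_le_left (abs_nonneg _) this

lemma summable_norm_castZ_inv_pow (n : ℕ) :
    Summable fun ξ : Fin n → ℤ => ‖(castZ ξ : Fin n → ℝ)‖⁻¹ ^ (n + 1) := by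
  obtain ⟨b, hb⟩ : ∃ b, b = Pi.basisFun ℝ (Fin n) := ⟨_, rfl⟩
  have hmem : ∀ ξ : Fin n → ℤ, castZ ξ ∈ Submodule.span ℤ (Set.range b) := by
    intro ξ
    exact (b.mem_span_iff_repr_mem ℤ _).2 fun i => ⟨ξ i, by simp [hb, castZ]⟩
  have hrank : Module.finrank ℤ (Submodule.span ℤ (Set.range b)) < n + 1 := by
    rw [ZLattice.rank ℝ]
    simp
  have hinj : Function.Injective fun ξ : Fin n → ℤ =>
      (⟨castZ ξ, hmem ξ⟩ : Submodule.span ℤ (Set.range b)) := by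
    intro ξ η h
    ext i
    have := congrFun (Subtype.ext_iff.1 h) i
    simpa [castZ] using this
  have hsum := ZLattice.summable_norm_pow_inv (Submodule.span ℤ (Set.range b)) (n + 1) hrank
  refine (hsum.comp_injective hinj).congr fun ξ => ?_
  rw [Function.comp_apply, Submodule.coe_norm]

lemma summable_norm_fc {f : (Fin n → ℝ) → ℂ} (hf : ContDiff ℝ (⊤ : ℕ∞) f) (hper : Per f) :
    Summable fun ξ => ‖fc f ξ‖ := by
  rcases isEmpty_or_nonempty (Fin n) with hn | hn
  · exact Summable.of_finite
  choose B hB0 hB using fun j => exists_abs_pow_mul_norm_fc_le hf hper j (n + 1)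
  refine Summable.of_norm_bounded_eventually
    ((summable_norm_castZ_inv_pow n).mul_left (∑ j, B j)) ?_
  refine (Set.finite_singleton (0 : Fin n → ℤ)).subset fun ξ hξ => ?_
  by_contra hne
  apply hξ
  obtain ⟨j, hj⟩ := Finite.exists_max fun j => |(ξ j : ℝ)|
  have hnorm : ‖(castZ ξ : Fin n → ℝ)‖ ≤ |(ξ j : ℝ)| :=
    (pi_norm_le_iff_of_nonneg (abs_nonneg _)).2 hj
  have hpos : 0 < ‖(castZ ξ : Fin n → ℝ)‖ := by
    rw [norm_pos_iff]
    intro h0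
    apply hne
    ext i
    simpa [castZ] using congrFun h0 i
  change ‖‖fc f ξ‖‖ ≤ _
  rw [norm_norm, inv_pow, ← div_eq_mul_inv, le_div_iff₀ (by positivity), mul_comm]
  calc _ ≤ |(ξ j : ℝ)| ^ (n + 1) * ‖fc f ξ‖ := by gcongr
    _ ≤ B j := hB j ξ
    _ ≤ _ := Finset.single_le_sum (fun i _ => hB0 i) (Finset.mem_univ j)

lemma mFourier_toTorus (x : Fin n → ℝ) (ξ : Fin n → ℤ) :
    UnitAddTorus.mFourier ξ (toTorus x) = eChar x ξ := by
  simp only [UnitAddTorus.mFourier, ContinuousMap.coe_mk, toTorus, fourier_coe_apply, eChar,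
    ← Complex.exp_sum, Finset.mul_sum]
  congr 1
  refine Finset.sum_congr rfl fun j _ => ?_
  simp
  ring

/-- A smooth periodic function is the sum of its Fourier series. -/
lemma hasSum_fc {f : (Fin n → ℝ) → ℂ} (hf : ContDiff ℝ (⊤ : ℕ∞) f) (hper : Per f)
    (x : Fin n → ℝ) : HasSum (fun ξ => fc f ξ * character x (castZ ξ)) (f x) := by
  obtain ⟨F, hF⟩ := exists_continuousMap_torus hf.continuous hper
  have hcoeff : ∀ ξ, UnitAddTorus.mFourierCoeff F ξ = fc f ξ := by
    intro ξ
    have hset : {x : Fin n → ℝ | ∀ i, x i ∈ Ioc ((0 : Fin n → ℝ) i) ((0 : Fin n → ℝ) i + 1)} =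
        Set.univ.pi fun _ => Ioc (0 : ℝ) 1 := by
      ext x
      simp
    rw [UnitAddTorus.mFourierCoeff_eq_integral F ξ 0, hset, fc_eq, μT, cube]
    have hae : (Set.univ.pi fun _ : Fin n => Ioc (0 : ℝ) 1) =ᵐ[volume]
        Set.univ.pi fun _ => Ico (0 : ℝ) 1 :=
      (Measure.univ_pi_Ioc_ae_eq_Icc (f := fun _ => (0 : ℝ)) (g := fun _ => (1 : ℝ))).trans
        (Measure.univ_pi_Ico_ae_eq_Icc (f := fun _ => (0 : ℝ)) (g := fun _ => (1 : ℝ))).symm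
    rw [setIntegral_congr_set hae]
    congr 1
    ext x
    have h1 := mFourier_toTorus x (-ξ)
    have h2 : eChar x (-ξ) = character (-x) (castZ ξ) := by
      simp [eChar, character, castZ]
    rw [h2] at h1
    rw [← h1, ← hF x]
    rfl
  have hsum : Summable (UnitAddTorus.mFourierCoeff F) := by
    rw [funext hcoeff]
    exact (summable_norm_fc hf hper).of_norm
  have := UnitAddTorus.hasSum_mFourier_series_apply_of_summable hsum (toTorus x)
  simpa only [hcoeff, mFourier_toTorus, eChar_eq_character, smul_eq_mul, hF] using this

lemma FT_eq (u : (Fin n → ℝ) → ℂ) (ξ : Fin n → ℝ) : FT u ξ = ∫ x, character (-x) ξ * u x := by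
  simp only [FT, character_neg_left]

lemma OpR_eq (σ u : (Fin n → ℝ) → ℂ) (x : Fin n → ℝ) :
    OpR (fun _ ξ => σ ξ) u x = ∫ ξ, character x ξ * σ ξ * FT u ξ := rfl

/-- A Schwartz function on `ℝⁿ` with the supremum norm, seen on Euclidean space. -/
def toEuclidean (u : 𝓢(Fin n → ℝ, ℂ)) : 𝓢(EuclideanSpace ℝ (Fin n), ℂ) :=
  SchwartzMap.compCLMOfContinuousLinearEquiv ℂ (EuclideanSpace.equiv (Fin n) ℝ) u

lemma integral_toLp {G : EuclideanSpace ℝ (Fin n) → ℂ} :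
    ∫ x : Fin n → ℝ, G (WithLp.toLp 2 x) = ∫ y, G y :=
  (PiLp.volume_preserving_toLp (Fin n)).integral_comp
    (MeasurableEquiv.toLp 2 (Fin n → ℝ)).measurableEmbedding G

lemma FT_schwartz (u : 𝓢(Fin n → ℝ, ℂ)) (ξ : Fin n → ℝ) :
    FT u ξ = 𝓕 (toEuclidean u) (WithLp.toLp 2 ξ) := by
  rw [SchwartzMap.fourier_coe, Real.fourier_eq', ← integral_toLp, FT_eq]
  refine integral_congr_ae (Eventually.of_forall fun x => ?_)
  simp only [character_eq_exp_ofReal, smul_eq_mul]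
  congr 3
  simp [PiLp.inner_apply, mul_comm]

lemma continuous_FT (u : 𝓢(Fin n → ℝ, ℂ)) : Continuous (FT u) := by
  rw [funext (FT_schwartz u)]
  exact (𝓕 (toEuclidean u)).continuous.comp (PiLp.continuous_toLp 2 _)

lemma integrable_FT (u : 𝓢(Fin n → ℝ, ℂ)) : Integrable (FT u) := by
  rw [funext (FT_schwartz u)]
  exact (PiLp.volume_preserving_toLp (Fin n)).integrable_comp_of_integrable
    (𝓕 (toEuclidean u)).integrable

lemma integral_character_mul_FT (u : 𝓢(Fin n → ℝ, ℂ)) (x : Fin n → ℝ) :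
    ∫ ξ, character x ξ * FT u ξ = u x := by
  have h : 𝓕⁻ (𝓕 (toEuclidean u)) (WithLp.toLp 2 x) = u x := by
    rw [FourierTransform.fourierInv_fourier_eq]
    rfl
  rw [← h, SchwartzMap.fourierInv_coe, Real.fourierInv_eq', ← integral_toLp]
  refine integral_congr_ae (Eventually.of_forall fun ξ => ?_)
  simp only [character_eq_exp_ofReal, smul_eq_mul, FT_schwartz]
  congr 3

section Dilation

variable {c : (Fin n → ℤ) → ℂ} {f : (Fin n → ℝ) → ℂ} {g u : 𝓢(Fin n → ℝ, ℂ)} {r : ℝ}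

lemma integral_character_mul_comp_inv_smul (g : 𝓢(Fin n → ℝ, ℂ)) (hr : 0 < r) (ω : Fin n → ℝ) :
    ∫ x, character (-x) ω * g (r⁻¹ • x) = (r : ℂ) ^ n * FT g (r • ω) := by
  have h := Measure.integral_comp_inv_smul_of_nonneg (volume : Measure (Fin n → ℝ))
    (fun y => character (-y) (r • ω) * g y) hr.le
  rw [FT_eq]
  simp only [Module.finrank_fin_fun, Complex.real_smul, Complex.ofReal_pow] at h
  rw [← h]
  refine integral_congr_ae (Eventually.of_forall fun x => ?_)
  simp only
  rw [← character_smul_left, smul_neg, smul_inv_smul₀ hr.ne']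

lemma integrable_comp_inv_smul (g : 𝓢(Fin n → ℝ, ℂ)) (hr : 0 < r) :
    Integrable fun x => g (r⁻¹ • x) :=
  g.integrable.comp_smul (inv_ne_zero hr.ne')

/-- The Fourier transform of a periodic function modulated by a dilated Schwartz function. -/
lemma hasSum_FT (hc : Summable fun ξ => ‖c ξ‖)
    (hf : ∀ x, HasSum (fun ξ => c ξ * character x (castZ ξ)) (f x)) (hr : 0 < r)
    (hu : ∀ x, u x = f x * g (r⁻¹ • x)) (η : Fin n → ℝ) :
    HasSum (fun ξ => c ξ * ((r : ℂ) ^ n * FT g (r • (η - castZ ξ)))) (FT u η) := by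
  have hg := integrable_comp_inv_smul g hr
  set F : (Fin n → ℤ) → (Fin n → ℝ) → ℂ :=
    fun ξ x => c ξ * (character (-x) (η - castZ ξ) * g (r⁻¹ • x)) with hF
  have hnorm : ∀ ξ x, ‖F ξ x‖ = ‖c ξ‖ * ‖g (r⁻¹ • x)‖ := by
    intro ξ x
    simp [hF]
  have hint : ∀ ξ, Integrable (F ξ) := by
    intro ξ
    refine (hg.norm.const_mul ‖c ξ‖).mono' ?_ (Eventually.of_forall fun x => (hnorm ξ x).le)
    exact Continuous.aestronglyMeasurable (by have := g.continuous; fun_prop)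
  have hsum : Summable fun ξ => ∫ x, ‖F ξ x‖ := by
    simp only [hnorm, integral_const_mul]
    exact hc.mul_right _
  have h := hasSum_integral_of_summable_integral_norm hint hsum
  have hval : ∀ ξ, ∫ x, F ξ x = c ξ * ((r : ℂ) ^ n * FT g (r • (η - castZ ξ))) := by
    intro ξ
    rw [hF, integral_const_mul, integral_character_mul_comp_inv_smul g hr]
  simp only [hval] at h
  have heq : FT u η = ∫ x, ∑' ξ, F ξ x := by
    rw [FT_eq]
    refine integral_congr_ae (Eventually.of_forall fun x => ?_)
    have h1 := ((hf x).mul_left (character (-x) η * g (r⁻¹ • x))).tsum_eq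
    simp only [hu x]
    refine Eq.trans ?_ (h1.symm.trans (tsum_congr fun ξ => ?_))
    · ring
    · simp only [hF, character_sub_right, character_neg_left, neg_neg]
      ring
  rw [heq]
  exact h

lemma integral_comp_smul_sub (h : (Fin n → ℝ) → ℂ) (hr : 0 < r) (ω : Fin n → ℝ) :
    ∫ η, (r : ℂ) ^ n * h (r • (η - ω)) = ∫ ζ, h ζ := by
  rw [integral_const_mul, integral_sub_right_eq_self (fun η => h (r • η)) ω,
    Measure.integral_comp_smul_of_nonneg _ _ _ (hR := hr.le), Complex.real_smul]
  have : (r : ℂ) ≠ 0 := by exact_mod_cast hr.ne'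
  simp [this]

variable {σ : (Fin n → ℝ) → ℂ} {M : ℝ}

lemma hasSum_OpR (hσ : Measurable σ) (hM : ∀ ξ, ‖σ ξ‖ ≤ M) (hc : Summable fun ξ => ‖c ξ‖)
    (hf : ∀ x, HasSum (fun ξ => c ξ * character x (castZ ξ)) (f x)) (hr : 0 < r)
    (hu : ∀ x, u x = f x * g (r⁻¹ • x)) (x : Fin n → ℝ) :
    HasSum (fun ξ => c ξ * ∫ ζ, character x (castZ ξ + r⁻¹ • ζ) * σ (castZ ξ + r⁻¹ • ζ) * FT g ζ)
      (OpR (fun _ ξ => σ ξ) u x) := by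
  set F : (Fin n → ℤ) → (Fin n → ℝ) → ℂ := fun ξ η =>
    c ξ * ((r : ℂ) ^ n * (character x η * σ η * FT g (r • (η - castZ ξ)))) with hF
  have hcast : ∀ (ξ : Fin n → ℤ) (η : Fin n → ℝ), castZ ξ + r⁻¹ • (r • (η - castZ ξ)) = η := by
    intro ξ η
    rw [inv_smul_smul₀ hr.ne']
    abel
  have hval : ∀ ξ, ∫ η, F ξ η =
      c ξ * ∫ ζ, character x (castZ ξ + r⁻¹ • ζ) * σ (castZ ξ + r⁻¹ • ζ) * FT g ζ := by
    intro ξ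
    have h1 := integral_comp_smul_sub (fun ζ => character x (castZ ξ + r⁻¹ • ζ) *
      σ (castZ ξ + r⁻¹ • ζ) * FT g ζ) hr (castZ ξ)
    simp only [hcast] at h1
    rw [hF, integral_const_mul, h1]
  have hbase : Integrable fun η : Fin n → ℝ => FT g (r • η) :=
    (integrable_FT g).comp_smul hr.ne'
  have hmeasFT := (continuous_FT g).measurable
  have hle : ∀ ξ η, ‖F ξ η‖ ≤ ‖c ξ‖ * (r ^ n * (M * ‖FT g (r • (η - castZ ξ))‖)) := by
    intro ξ η
    simp only [hF, norm_mul, norm_pow, norm_character, one_mul, Complex.norm_real,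
      Real.norm_eq_abs, abs_of_pos hr]
    gcongr
    exact hM η
  have hdom : ∀ ξ, Integrable fun η =>
      ‖c ξ‖ * (r ^ n * (M * ‖FT g (r • (η - castZ ξ))‖)) := fun ξ =>
    (((hbase.comp_sub_right (castZ ξ)).norm.const_mul M).const_mul (r ^ n)).const_mul ‖c ξ‖
  have hint : ∀ ξ, Integrable (F ξ) := by
    intro ξ
    refine (hdom ξ).mono' ?_ (Eventually.of_forall (hle ξ))
    have hch : Measurable fun η => character x η := (by fun_prop : Continuous _).measurable
    exact Measurable.aestronglyMeasurable (by fun_prop)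
  have hsum : Summable fun ξ => ∫ η, ‖F ξ η‖ := by
    refine Summable.of_nonneg_of_le (fun ξ => integral_nonneg fun _ => norm_nonneg _)
      (fun ξ => integral_mono (hint ξ).norm (hdom ξ) (hle ξ)) ?_
    simp only [integral_const_mul,
      integral_sub_right_eq_self (fun η : Fin n → ℝ => ‖FT g (r • η)‖)]
    exact hc.mul_right _
  have h := hasSum_integral_of_summable_integral_norm hint hsum
  simp only [hval] at h
  have heq : OpR (fun _ ξ => σ ξ) u x = ∫ η, ∑' ξ, F ξ η := by
    rw [OpR_eq]
    refine integral_congr_ae (Eventually.of_forall fun η => ?_)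
    simp only
    rw [← ((hasSum_FT hc hf hr hu η).mul_left (character x η * σ η)).tsum_eq]
    refine tsum_congr fun ξ => ?_
    simp only [hF]
    ring
  rw [heq]
  exact h

/-- The modulus of continuity that controls the transference error at scale `r`. -/
def transferenceError (σ : (Fin n → ℝ) → ℂ) (g : 𝓢(Fin n → ℝ, ℂ)) (c : (Fin n → ℤ) → ℂ)
    (r : ℝ) : ℝ :=
  ∑' ξ, ‖c ξ‖ * ∫ ζ, ‖σ (castZ ξ + r⁻¹ • ζ) - σ (castZ ξ)‖ * ‖FT g ζ‖

lemma norm_sub_mul_FT_le (hM : ∀ ξ, ‖σ ξ‖ ≤ M) (ξ η ζ : Fin n → ℝ) :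
    ‖σ ξ - σ η‖ * ‖FT g ζ‖ ≤ 2 * M * ‖FT g ζ‖ := by
  gcongr
  linarith [norm_sub_le (σ ξ) (σ η), hM ξ, hM η]

lemma integrable_norm_sub_mul_FT (hσ : Measurable σ) (hM : ∀ ξ, ‖σ ξ‖ ≤ M) (ξ : Fin n → ℝ)
    (r : ℝ) : Integrable fun ζ => ‖σ (ξ + r⁻¹ • ζ) - σ ξ‖ * ‖FT g ζ‖ := by
  refine ((integrable_FT g).norm.const_mul (2 * M)).mono' ?_
    (Eventually.of_forall fun ζ => ?_)
  · have := (continuous_FT g).measurable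
    exact Measurable.aestronglyMeasurable (by fun_prop)
  · rw [norm_mul, norm_norm, norm_norm]
    exact norm_sub_mul_FT_le hM _ _ _

lemma integral_norm_sub_mul_FT_le (hσ : Measurable σ) (hM : ∀ ξ, ‖σ ξ‖ ≤ M) (ξ : Fin n → ℝ)
    (r : ℝ) : ∫ ζ, ‖σ (ξ + r⁻¹ • ζ) - σ ξ‖ * ‖FT g ζ‖ ≤ ∫ ζ, 2 * M * ‖FT g ζ‖ :=
  integral_mono (integrable_norm_sub_mul_FT hσ hM ξ r) ((integrable_FT g).norm.const_mul _)
    fun _ => norm_sub_mul_FT_le hM _ _ _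

lemma integral_norm_sub_mul_FT_nonneg (ξ : Fin n → ℝ) (r : ℝ) :
    0 ≤ ∫ ζ, ‖σ (ξ + r⁻¹ • ζ) - σ ξ‖ * ‖FT g ζ‖ :=
  integral_nonneg fun _ => by positivity

lemma summable_transferenceError (hσ : Measurable σ) (hM : ∀ ξ, ‖σ ξ‖ ≤ M)
    (hc : Summable fun ξ => ‖c ξ‖) (r : ℝ) :
    Summable fun ξ => ‖c ξ‖ * ∫ ζ, ‖σ (castZ ξ + r⁻¹ • ζ) - σ (castZ ξ)‖ * ‖FT g ζ‖ := by
  refine Summable.of_nonneg_of_le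
    (fun ξ => mul_nonneg (norm_nonneg _) (integral_norm_sub_mul_FT_nonneg _ r)) (fun ξ => ?_)
    (hc.mul_right (∫ ζ, 2 * M * ‖FT g ζ‖))
  exact mul_le_mul_of_nonneg_left (integral_norm_sub_mul_FT_le hσ hM _ _) (norm_nonneg _)

lemma tendsto_transferenceError (hσ : Measurable σ) (hM : ∀ ξ, ‖σ ξ‖ ≤ M)
    (hcont : ∀ ξ : Fin n → ℤ, ContinuousAt σ (castZ ξ)) (hc : Summable fun ξ => ‖c ξ‖) :
    Tendsto (fun N : ℕ => transferenceError σ g c N) atTop (𝓝 0) := by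
  have h0 : (0 : ℝ) = ∑' ξ : Fin n → ℤ, ‖c ξ‖ * ∫ _ : Fin n → ℝ, (0 : ℝ) := by simp
  rw [h0]
  refine tendsto_tsum_of_dominated_convergence (hc.mul_right (∫ ζ, 2 * M * ‖FT g ζ‖))
    (fun ξ => ?_) (Eventually.of_forall fun N ξ => ?_)
  · refine Tendsto.const_mul _ (tendsto_integral_of_dominated_convergence
      (fun ζ => 2 * M * ‖FT g ζ‖)
      (fun N => (integrable_norm_sub_mul_FT hσ hM _ _).aestronglyMeasurable)
      ((integrable_FT g).norm.const_mul _)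
      (fun N => Eventually.of_forall fun ζ => ?_) (Eventually.of_forall fun ζ => ?_))
    · rw [norm_mul, norm_norm, norm_norm]
      exact norm_sub_mul_FT_le hM _ _ _
    · have h1 : Tendsto (fun N : ℕ => castZ ξ + (N : ℝ)⁻¹ • ζ) atTop (𝓝 (castZ ξ)) := by
        simpa using (tendsto_inv_atTop_nhds_zero_nat (𝕜 := ℝ)).smul_const ζ |>.const_add (castZ ξ)
      have h2 := ((hcont ξ).tendsto.comp h1).sub_const (σ (castZ ξ))
      simpa using h2.norm.mul_const ‖FT g ζ‖
  · rw [Real.norm_of_nonneg (mul_nonneg (norm_nonneg _) (integral_norm_sub_mul_FT_nonneg _ _))]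
    exact mul_le_mul_of_nonneg_left (integral_norm_sub_mul_FT_le hσ hM _ _) (norm_nonneg _)

lemma norm_OpR_sub_tsum_le (hσ : Measurable σ) (hM : ∀ ξ, ‖σ ξ‖ ≤ M)
    (hc : Summable fun ξ => ‖c ξ‖)
    (hf : ∀ x, HasSum (fun ξ => c ξ * character x (castZ ξ)) (f x)) (hr : 0 < r)
    (hu : ∀ x, u x = f x * g (r⁻¹ • x)) {x : Fin n → ℝ} (hx : g (r⁻¹ • x) = 1) :
    ‖OpR (fun _ ξ => σ ξ) u x - ∑' ξ, character x (castZ ξ) * σ (castZ ξ) * c ξ‖ ≤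
      transferenceError σ g c r := by
  have hsumOp : Summable fun ξ => character x (castZ ξ) * σ (castZ ξ) * c ξ := by
    refine Summable.of_norm_bounded (hc.mul_left M) fun ξ => ?_
    rw [norm_mul, norm_mul, norm_character, one_mul]
    gcongr
    exact hM _
  have hdiff := (hasSum_OpR hσ hM hc hf hr hu x).sub hsumOp.hasSum
  have hint : ∀ (s : (Fin n → ℝ) → ℂ), Measurable s → (∀ ζ, ‖s ζ‖ ≤ M) → ∀ ξ : Fin n → ℝ,
      Integrable fun ζ => character x (ξ + r⁻¹ • ζ) * s ζ * FT g ζ := by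
    intro s hs hsM ξ
    refine ((integrable_FT g).norm.const_mul M).mono' ?_ (Eventually.of_forall fun ζ => ?_)
    · have := (continuous_FT g).measurable
      have hch : Measurable fun ζ => character x (ξ + r⁻¹ • ζ) :=
        (by fun_prop : Continuous _).measurable
      exact Measurable.aestronglyMeasurable (by fun_prop)
    · rw [norm_mul, norm_mul, norm_character, one_mul]
      gcongr
      exact hsM ζ
  have hterm : ∀ ξ : Fin n → ℤ, ‖c ξ * (∫ ζ, character x (castZ ξ + r⁻¹ • ζ) *
        σ (castZ ξ + r⁻¹ • ζ) * FT g ζ) - character x (castZ ξ) * σ (castZ ξ) * c ξ‖ ≤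
      ‖c ξ‖ * ∫ ζ, ‖σ (castZ ξ + r⁻¹ • ζ) - σ (castZ ξ)‖ * ‖FT g ζ‖ := by
    intro ξ
    have h1 : character x (castZ ξ) * σ (castZ ξ) =
        ∫ ζ, character x (castZ ξ + r⁻¹ • ζ) * σ (castZ ξ) * FT g ζ := by
      calc character x (castZ ξ) * σ (castZ ξ)
          = character x (castZ ξ) * σ (castZ ξ) * ∫ ζ, character (r⁻¹ • x) ζ * FT g ζ := by
            rw [integral_character_mul_FT, hx, mul_one]
        _ = _ := by
            rw [← integral_const_mul]
            congr 1
            ext ζ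
            rw [character_add_right, character_smul_left]
            ring
    rw [h1, mul_comm _ (c ξ), ← mul_sub, ← integral_sub
      (hint (fun ζ => σ (castZ ξ + r⁻¹ • ζ)) (by fun_prop) (fun _ => hM _) _)
      (hint (fun _ => σ (castZ ξ)) (by fun_prop) (fun _ => hM _) _), norm_mul]
    gcongr
    refine (norm_integral_le_integral_norm _).trans_eq ?_
    congr 1
    ext ζ
    rw [← sub_mul, ← mul_sub, norm_mul, norm_mul, norm_character, one_mul]
  rw [← hdiff.tsum_eq]
  exact tsum_of_norm_bounded (summable_transferenceError hσ hM hc r).hasSum hterm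

end Dilation

section Bound

variable {σ : (Fin n → ℝ) → ℂ} {M : ℝ} {f : (Fin n → ℝ) → ℂ}

lemma continuous_OpR (hσ : Measurable σ) (hM : ∀ ξ, ‖σ ξ‖ ≤ M) (u : 𝓢(Fin n → ℝ, ℂ)) :
    Continuous (OpR (fun _ ξ => σ ξ) u) := by
  have hFT := (continuous_FT u).measurable
  refine continuous_of_dominated (bound := fun ξ => M * ‖FT u ξ‖) (fun x => ?_)
    (fun x => Eventually.of_forall fun ξ => ?_) ((integrable_FT u).norm.const_mul M)
    (Eventually.of_forall fun ξ => ?_)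
  · have hch : Measurable fun ξ => character x ξ := (by fun_prop : Continuous _).measurable
    exact ((hch.mul hσ).mul hFT).aestronglyMeasurable
  · change ‖character x ξ * σ ξ * FT u ξ‖ ≤ _
    rw [norm_mul, norm_mul, norm_character, one_mul]
    gcongr
    exact hM ξ
  · change Continuous fun x => character x ξ * σ ξ * FT u ξ
    fun_prop

lemma Op_eq (σ : (Fin n → ℝ) → ℂ) (f : (Fin n → ℝ) → ℂ) (x : Fin n → ℝ) :
    Op (fun _ ξ => σ (castZ ξ)) f x = ∑' ξ, character x (castZ ξ) * σ (castZ ξ) * fc f ξ := by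
  simp only [Op, eChar_eq_character]

lemma continuous_Op (hM : ∀ ξ, ‖σ ξ‖ ≤ M) (hc : Summable fun ξ => ‖fc f ξ‖) :
    Continuous (Op (fun _ ξ => σ (castZ ξ)) f) := by
  rw [funext (Op_eq σ f)]
  refine continuous_tsum (fun ξ => by fun_prop) (hc.mul_left M) fun ξ x => ?_
  rw [norm_mul, norm_mul, norm_character, one_mul]
  gcongr
  exact hM _

lemma per_Op (σ : (Fin n → ℝ) → ℂ) (f : (Fin n → ℝ) → ℂ) :
    Per (Op (fun _ ξ => σ (castZ ξ)) f) := by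
  intro x v
  simp only [Op_eq]
  refine tsum_congr fun ξ => ?_
  have h := character_add_left x (castZ v) (castZ ξ)
  rw [character_intCast, mul_one] at h
  exact congrArg (fun z => z * σ (castZ ξ) * fc f ξ) h

lemma exists_schwartz_cutoff (n : ℕ) : ∃ g : 𝓢(Fin n → ℝ, ℂ),
    (∀ x ∈ Metric.closedBall 0 1, g x = 1) ∧ (∀ x ∉ Metric.ball 0 2, g x = 0) ∧
      ∀ x, ‖g x‖ ≤ 1 := by
  let φ : ContDiffBump (0 : Fin n → ℝ) := ⟨1, 2, one_pos, one_lt_two⟩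
  have hcd : ContDiff ℝ (⊤ : ℕ∞) fun x => (φ x : ℂ) :=
    Complex.ofRealCLM.contDiff.comp φ.contDiff
  have hcs : HasCompactSupport fun x => (φ x : ℂ) :=
    φ.hasCompactSupport.comp_left (g := ((↑) : ℝ → ℂ)) Complex.ofReal_zero
  refine ⟨hcs.toSchwartzMap hcd, fun x hx => ?_, fun x hx => ?_, fun x => ?_⟩
  · change (φ x : ℂ) = 1
    exact_mod_cast φ.one_of_mem_closedBall hx
  · change (φ x : ℂ) = 0
    have : x ∉ Function.support φ := by rwa [φ.support_eq]
    exact_mod_cast Function.notMem_support.1 this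
  · change ‖(φ x : ℂ)‖ ≤ 1
    rw [Complex.norm_real, Real.norm_of_nonneg φ.nonneg]
    exact φ.le_one

lemma exists_schwartz_mul_dilate (hf : ContDiff ℝ (⊤ : ℕ∞) f) {g : 𝓢(Fin n → ℝ, ℂ)}
    (hg : ∀ x ∉ Metric.ball 0 2, g x = 0) {r : ℝ} (hr : 0 < r) :
    ∃ u : 𝓢(Fin n → ℝ, ℂ), ∀ x, u x = f x * g (r⁻¹ • x) := by
  have hcd : ContDiff ℝ (⊤ : ℕ∞) fun x => f x * g (r⁻¹ • x) :=
    hf.mul ((g.smooth _).comp (contDiff_const_smul _))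
  have hcs : HasCompactSupport fun x => f x * g (r⁻¹ • x) := by
    have h : HasCompactSupport g :=
      HasCompactSupport.intro (isCompact_closedBall 0 2) fun x hx =>
        hg x fun h => hx (Metric.ball_subset_closedBall h)
    exact (h.comp_smul (inv_ne_zero hr.ne')).mul_left
  exact ⟨hcs.toSchwartzMap hcd, fun _ => rfl⟩

lemma eLpNorm_mul_dilate_le (hf : Continuous f) (hper : Per f) {g : 𝓢(Fin n → ℝ, ℂ)}
    (hg : ∀ x ∉ Metric.ball 0 2, g x = 0) (hg1 : ∀ x, ‖g x‖ ≤ 1) (p : ℝ≥0∞) {N : ℕ}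
    (hN : N ≠ 0) :
    eLpNorm (fun x => f x * g ((N : ℝ)⁻¹ • x)) p volume ≤
      ((((4 * N : ℕ) : ℝ≥0∞)) ^ n) ^ (1 / p).toReal * eLpNorm f p (μT n) := by
  have hN' : (0 : ℝ) < N := by positivity
  have hmeas : MeasurableSet (box n (-(2 * N : ℝ)) (-(2 * N : ℝ) + (4 * N : ℕ))) :=
    MeasurableSet.univ_pi fun _ => measurableSet_Ico
  rw [← eLpNorm_restrict_box hf hper p (-(2 * N : ℝ)) (N := 4 * N) (by positivity),
    ← eLpNorm_indicator_eq_eLpNorm_restrict hmeas]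
  refine eLpNorm_mono fun x => ?_
  by_cases hx : x ∈ box n (-(2 * N : ℝ)) (-(2 * N : ℝ) + (4 * N : ℕ))
  · rw [indicator_of_mem hx, norm_mul]
    exact mul_le_of_le_one_right (norm_nonneg _) (hg1 _)
  · rw [hg, mul_zero, norm_zero]
    · positivity
    · contrapose! hx
      rw [mem_ball_zero_iff, norm_smul, norm_inv, Real.norm_of_nonneg hN'.le,
        inv_mul_lt_iff₀ hN'] at hx
      intro i _
      have := abs_lt.1 ((norm_le_pi_norm x i).trans_lt hx)
      push_cast
      constructor <;> linarith [this.1, this.2]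

lemma eLpNorm_le_of_norm_sub_le {F G : (Fin n → ℝ) → ℂ} (hF : Continuous F) (hG : Continuous G)
    {p : ℝ≥0∞} (hp : 1 ≤ p) {δ : ℝ} (N : ℕ) (hN : N ≠ 0)
    (hle : ∀ x ∈ box n 0 (0 + N), ‖G x - F x‖ ≤ δ) :
    eLpNorm F p (volume.restrict (box n 0 (0 + N))) ≤ eLpNorm G p volume +
      ((N : ℝ≥0∞) ^ n) ^ (1 / p).toReal * ENNReal.ofReal δ := by
  have hmeas : MeasurableSet (box n 0 (0 + N)) :=
    MeasurableSet.univ_pi fun _ => measurableSet_Ico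
  have hsub : F = G - (G - F) := by abel
  have hconst := eLpNorm_restrict_box (n := n) (f := fun _ => (δ : ℂ)) continuous_const
    (fun _ _ => rfl) p 0 hN
  have h0 : 0 ≤ δ := (norm_nonneg _).trans
    (hle 0 fun i _ => by simp [Nat.pos_of_ne_zero hN])
  have hδ : eLpNorm (fun _ => (δ : ℂ)) p (μT n) = ENNReal.ofReal δ := by
    rw [eLpNorm_const _ (one_pos.trans_le hp).ne' (NeZero.ne _)]
    simp [← ofReal_norm, abs_of_nonneg h0]
  have hdiff : eLpNorm (G - F) p (volume.restrict (box n 0 (0 + N))) ≤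
      ((N : ℝ≥0∞) ^ n) ^ (1 / p).toReal * ENNReal.ofReal δ := by
    rw [← hδ, ← hconst]
    refine eLpNorm_mono_ae ((ae_restrict_iff' hmeas).2 (Eventually.of_forall fun x hx => ?_))
    rw [Complex.norm_real, Real.norm_of_nonneg h0]
    exact hle x hx
  calc eLpNorm F p (volume.restrict (box n 0 (0 + N)))
      = eLpNorm (G - (G - F)) p (volume.restrict (box n 0 (0 + N))) := by rw [← hsub]
    _ ≤ _ := eLpNorm_sub_le hG.aestronglyMeasurable (hG.sub hF).aestronglyMeasurable hp
    _ ≤ _ := add_le_add (eLpNorm_mono_measure _ Measure.restrict_le_self) hdiff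

lemma eLpNorm_Op_le_add (hσ : Measurable σ) (hM : ∀ ξ, ‖σ ξ‖ ≤ M) {p : ℝ≥0∞} (hp : 1 ≤ p)
    {C : ℝ} (hC : ∀ u : 𝓢(Fin n → ℝ, ℂ), eLpNorm (OpR (fun _ ξ => σ ξ) u) p volume ≤
      ENNReal.ofReal C * eLpNorm u p volume) {g : 𝓢(Fin n → ℝ, ℂ)}
    (hg0 : ∀ x ∈ Metric.closedBall 0 1, g x = 1) (hg : ∀ x ∉ Metric.ball 0 2, g x = 0)
    (hg1 : ∀ x, ‖g x‖ ≤ 1) (hf : ContDiff ℝ (⊤ : ℕ∞) f) (hper : Per f) {N : ℕ} (hN : N ≠ 0) :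
    eLpNorm (Op (fun _ ξ => σ (castZ ξ)) f) p (μT n) ≤
      ENNReal.ofReal C * ((4 : ℝ≥0∞) ^ n) ^ (1 / p).toReal * eLpNorm f p (μT n) +
        ENNReal.ofReal (transferenceError σ g (fc f) N) := by
  have hN' : (0 : ℝ) < N := by positivity
  have hc := summable_norm_fc hf hper
  obtain ⟨u, hu⟩ := exists_schwartz_mul_dilate hf hg hN'
  have hOp := continuous_Op hM hc
  have hle : ∀ x ∈ box n 0 (0 + N), ‖OpR (fun _ ξ => σ ξ) u x -
      Op (fun _ ξ => σ (castZ ξ)) f x‖ ≤ transferenceError σ g (fc f) N := by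
    intro x hx
    rw [Op_eq]
    refine norm_OpR_sub_tsum_le hσ hM hc (hasSum_fc hf hper) hN' hu (hg0 _ ?_)
    rw [mem_closedBall_zero_iff, norm_smul, norm_inv, Real.norm_of_nonneg hN'.le,
      inv_mul_le_iff₀ hN', mul_one]
    refine (pi_norm_le_iff_of_nonneg hN'.le).2 fun i => abs_le.2 ?_
    have h := hx i (mem_univ i)
    constructor <;> linarith [h.1, h.2]
  have h := eLpNorm_le_of_norm_sub_le hOp (continuous_OpR hσ hM u) hp N hN hle
  set K : ℝ≥0∞ := ((N : ℝ≥0∞) ^ n) ^ (1 / p).toReal with hK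
  have hK0 : K ≠ 0 := by
    rw [hK]
    exact (ENNReal.rpow_pos (by positivity) (by finiteness)).ne'
  have hKtop : K ≠ ⊤ := by
    rw [hK]
    finiteness
  have hfour : (((4 * N : ℕ) : ℝ≥0∞) ^ n) ^ (1 / p).toReal =
      K * ((4 : ℝ≥0∞) ^ n) ^ (1 / p).toReal := by
    rw [hK, ← ENNReal.mul_rpow_of_nonneg _ _ ENNReal.toReal_nonneg, ← mul_pow]
    push_cast
    rw [mul_comm]
  have hunorm := eLpNorm_mul_dilate_le hf.continuous hper hg hg1 p hN
  rw [← funext hu, hfour] at hunorm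
  rw [eLpNorm_restrict_box hOp (per_Op σ f) p 0 hN] at h
  refine (ENNReal.mul_le_mul_iff_right hK0 hKtop).1 (h.trans ?_)
  rw [mul_add]
  gcongr
  calc eLpNorm (OpR (fun _ ξ => σ ξ) u) p volume
      ≤ ENNReal.ofReal C * eLpNorm u p volume := hC u
    _ ≤ ENNReal.ofReal C * (K * ((4 : ℝ≥0∞) ^ n) ^ (1 / p).toReal * eLpNorm f p (μT n)) := by
        gcongr
    _ = _ := by ring

end Bound

end Transference

/-- **Stein's transference.** Let `1 ≤ p ≤ ∞` and let `σ : ℝⁿ → ℂ` be a bounded measurable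
symbol whose Euclidean Fourier multiplier `T_σ` is bounded on `L^p(ℝⁿ)`, and which is
continuous at each point of `ℤⁿ`.  Then the periodic Fourier multiplier with symbol
`σ|_{ℤⁿ}` is bounded on `L^p(𝕋ⁿ)`. -/
theorem transference_multiplier_Lp_bounded
    (n : ℕ) (hn : 1 ≤ n) (p : ℝ≥0∞) (hp : 1 ≤ p)
    (σ : (Fin n → ℝ) → ℂ)
    (hσ_meas : Measurable σ)
    (hσ_bdd : ∃ M : ℝ, ∀ ξ, ‖σ ξ‖ ≤ M)
    (hσ_cont : ∀ ξ : Fin n → ℤ, ContinuousAt σ (castZ ξ))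
    (hσ_Lp : ∃ C : ℝ, 0 < C ∧ ∀ u : SchwartzMap (Fin n → ℝ) ℂ,
      eLpNorm (OpR (fun _ ξ => σ ξ) u) p volume ≤ ENNReal.ofReal C * eLpNorm (⇑u) p volume) :
    ∃ C : ℝ, 0 < C ∧ ∀ f : (Fin n → ℝ) → ℂ, ContDiff ℝ (⊤ : ℕ∞) f → Per f →
      eLpNorm (Op (fun _ ξ => σ (castZ ξ)) f) p (μT n) ≤
        ENNReal.ofReal C * eLpNorm f p (μT n) := by
  obtain ⟨M, hM⟩ := hσ_bdd
  obtain ⟨C, hC0, hC⟩ := hσ_Lp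
  obtain ⟨g, hg0, hg, hg1⟩ := Transference.exists_schwartz_cutoff n
  refine ⟨C * ((4 : ℝ) ^ n) ^ (1 / p).toReal, by positivity, fun f hf hper => ?_⟩
  have hconst : ENNReal.ofReal (C * ((4 : ℝ) ^ n) ^ (1 / p).toReal) =
      ENNReal.ofReal C * ((4 : ℝ≥0∞) ^ n) ^ (1 / p).toReal := by
    rw [ENNReal.ofReal_mul hC0.le, ← ENNReal.ofReal_rpow_of_nonneg (by positivity)
      ENNReal.toReal_nonneg, ENNReal.ofReal_pow (by norm_num), ENNReal.ofReal_ofNat]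
  rw [hconst]
  have hlim := (ENNReal.tendsto_ofReal (Transference.tendsto_transferenceError (g := g) hσ_meas hM
    hσ_cont (Transference.summable_norm_fc hf hper))).const_add
    (ENNReal.ofReal C * ((4 : ℝ≥0∞) ^ n) ^ (1 / p).toReal * eLpNorm f p (μT n))
  rw [ENNReal.ofReal_zero, add_zero] at hlim
  refine ge_of_tendsto hlim ?_
  filter_upwards [Filter.eventually_ne_atTop 0] with N hN
  exact Transference.eLpNorm_Op_le_add hσ_meas hM hp hC hg0 hg hg1 hf hper hN
end
end
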